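/- arXiv:1006.3867 — 4 statements merged into one kernel-verified Lean document; each statement's English description precedes it below -/
import Mathlib

section
/- Set p = min{2,q} and 1/p' = 1 − 1/p. (i) If Ñ(T,d,ε) ≤ c ε^{-a} |log ε|^b for some a > 0, b ≥ 0, c > 0 and all sufficiently small ε > 0, then there is a constant c' > 0 such that e_n(V_{α,σ} : ℓ_1(T) → ℓ_q(T)) ≤ c' n^{-1/a − 1/p'} (log n)^{b/a} for all n ≥ 2. (ii) If instead log Ñ(T,d,ε) ≤ c ε^{-a} for some a > 0, then e_n(V_{α,σ}) ≤ c' n^{-1/p'} (log n)^{1/p' − 1/a} for all n ≥ 2 when a < p', while e_n(V_{α,σ}) ≤ c' n^{-1/a} when a > p'. -/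
open scoped ENNReal NNReal
open MeasureTheory

noncomputable section

/-- A rooted tree structure on a partially ordered type with bottom element (the root):
the set of ancestors of any node is finite and totally ordered, and every node has
finitely many offspring (covering elements). -/
def IsTree (T : Type) [PartialOrder T] [OrderBot T] : Prop :=
  (∀ s : T, (Set.Iic s).Finite) ∧
  (∀ s a b : T, a ≤ s → b ≤ s → a ≤ b ∨ b ≤ a) ∧
  (∀ t : T, {s : T | t ⋖ s}.Finite)

/-- The binary tree: a rooted tree in which every node has exactly two offspring. -/
def IsBinaryTree (T : Type) [PartialOrder T] [OrderBot T] : Prop :=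
  IsTree T ∧ ∀ t : T, Nat.card {s : T | t ⋖ s} = 2

/-- `glb` assigns to any two nodes their greatest common ancestor. -/
def IsGCA {T : Type} [PartialOrder T] (glb : T → T → T) : Prop :=
  ∀ t s : T, glb t s ≤ t ∧ glb t s ≤ s ∧ ∀ u : T, u ≤ t → u ≤ s → u ≤ glb t s

/-- The generation `|t|` of a node: the number of its strict ancestors. -/
def gen {T : Type} [PartialOrder T] (t : T) : ℕ := Nat.card (Set.Iio t)

/-- The distance `max_{t ≺ v ⪯ s} (∑_{t ≺ r ⪯ v} α(r)^q)^{1/q} σ(v)` along a branch. -/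
def dOrd {T : Type} [PartialOrder T] (q : ℝ) (α σ : T → ℝ) (t s : T) : ℝ :=
  sSup ((fun v => (∑ᶠ r ∈ Set.Ioc t v, α r ^ q) ^ (1 / q) * σ v) '' Set.Ioc t s)

/- The tree metric `d`, extended by symmetry and via greatest common ancestors. -/
open Classical in
def treeDist {T : Type} [PartialOrder T] (q : ℝ) (α σ : T → ℝ)
    (glb : T → T → T) (t s : T) : ℝ :=
  if t ≤ s then dOrd q α σ t s
  else if s ≤ t then dOrd q α σ s t
  else dOrd q α σ (glb t s) t + dOrd q α σ (glb t s) s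

/-- `N(T,d,ε)`: minimal number of open `ε`-balls needed to cover `T` (`∞` if none). -/
def coveringNumber {T : Type} (d : T → T → ℝ) (ε : ℝ) : ℝ≥0∞ :=
  ⨅ S ∈ {S : Finset T | ∀ t : T, ∃ s ∈ S, d s t < ε}, (S.card : ℝ≥0∞)

/-- `Ñ(T,d,ε)`: minimal cardinality of an order `ε`-net of `T`. -/
def orderCoveringNumber {T : Type} [PartialOrder T] (d : T → T → ℝ) (ε : ℝ) : ℝ≥0∞ :=
  ⨅ S ∈ {S : Finset T | ∀ t : T, ∃ s ∈ S, s ≤ t ∧ d s t < ε}, (S.card : ℝ≥0∞)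

/-- Minimal number of open `ε`-balls of a normed space needed to cover the set `A`. -/
def setCoveringNumber {Y : Type} [NormedAddCommGroup Y] (A : Set Y) (ε : ℝ) : ℝ≥0∞ :=
  ⨅ F ∈ {F : Finset Y | ∀ a ∈ A, ∃ y ∈ F, ‖a - y‖ < ε}, (F.card : ℝ≥0∞)

/-- The dyadic entropy numbers `e_n(V)` of an operator `V`. -/
def entropyNumber {X Y : Type} [NormedAddCommGroup X] [NormedSpace ℝ X]
    [NormedAddCommGroup Y] [NormedSpace ℝ Y] (n : ℕ) (V : X →L[ℝ] Y) : ℝ :=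
  sInf {ε : ℝ | 0 < ε ∧ ∃ F : Finset Y, F.card ≤ 2 ^ (n - 1) ∧
    ∀ x : X, ‖x‖ ≤ 1 → ∃ y ∈ F, ‖V x - y‖ < ε}

/-- The space `ℓ₁(T)`. -/
abbrev ellOne (T : Type) := lp (fun _ : T => ℝ) 1

/-- The space `ℓ_q(T)`. -/
abbrev ellQ (T : Type) (q : ℝ) := lp (fun _ : T => ℝ) (ENNReal.ofReal q)

/-! ### Power-type smoothness of `ℓ_q` -/

theorem abs_one_add_rpow_le {q : ℝ} (hq : 1 < q) (u : ℝ) (hu : |u| ≤ 1 / q) :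
    |1 + u| ^ q ≤ 1 + q * u + q ^ 2 * u ^ 2 := by
  have hq0 : 0 < q := by linarith
  have h1 : 1 / q ≤ 1 := by rw [div_le_one hq0]; exact hq.le
  have hu0 : 0 ≤ 1 + u := by linarith [neg_abs_le u]
  have hqu : |q * u| ≤ 1 := by
    rw [abs_mul, abs_of_pos hq0]
    calc q * |u| ≤ q * (1 / q) := by gcongr
      _ = 1 := by field_simp
  have h2 := (abs_le.1 (Real.abs_exp_sub_one_sub_id_le hqu)).2
  calc |1 + u| ^ q = (1 + u) ^ q := by rw [abs_of_nonneg hu0]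
    _ ≤ (Real.exp u) ^ q := by
        gcongr
        linarith [Real.add_one_le_exp u]
    _ = Real.exp (q * u) := by rw [← Real.exp_mul, mul_comm]
    _ ≤ _ := by nlinarith

theorem abs_one_add_rpow_le_of_lt {q : ℝ} (hq : 1 < q) (u : ℝ) (hu : 1 / q < |u|) :
    |1 + u| ^ q ≤ 1 + q * u + ((q + 1) ^ q + q ^ q) * |u| ^ q := by
  have hq0 : 0 < q := by linarith
  have hqu : 1 < q * |u| := by rwa [div_lt_iff₀' hq0] at hu
  have h1 : |1 + u| ^ q ≤ (q + 1) ^ q * |u| ^ q := by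
    rw [← Real.mul_rpow (by positivity) (abs_nonneg u)]
    gcongr
    calc |1 + u| ≤ |1| + |u| := abs_add_le _ _
      _ ≤ _ := by rw [abs_one]; linarith
  have h2 : q * |u| ≤ q ^ q * |u| ^ q := by
    rw [← Real.mul_rpow (by positivity) (abs_nonneg u)]
    exact Real.self_le_rpow_of_one_le hqu.le hq.le
  have h3 : -(q * |u|) ≤ q * u := by nlinarith [neg_abs_le u]
  nlinarith

theorem abs_add_rpow_le_of_le_two {q : ℝ} (hq : 1 < q) (hq2 : q ≤ 2) (x y : ℝ) :
    |x + y| ^ q ≤ |x| ^ q + q * (|x| ^ q / x) * y +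
      ((q + 1) ^ q + q ^ q + q ^ 2) * |y| ^ q := by
  have hq0 : 0 < q := by linarith
  rcases eq_or_ne x 0 with rfl | hx
  · have : 1 ≤ (q + 1) ^ q := Real.one_le_rpow (by linarith) hq0.le
    have h2 : 0 ≤ q ^ q + q ^ 2 := by positivity
    have h3 : 0 ≤ |y| ^ q := by positivity
    simp only [zero_add, abs_zero, div_zero, mul_zero, zero_mul, add_zero,
      Real.zero_rpow hq0.ne']
    nlinarith
  · have key : |1 + y / x| ^ q ≤
        1 + q * (y / x) + ((q + 1) ^ q + q ^ q + q ^ 2) * |y / x| ^ q := by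
      have h3 : 0 ≤ |y / x| ^ q := by positivity
      rcases le_or_gt |y / x| (1 / q) with h | h
      · refine (abs_one_add_rpow_le hq _ h).trans ?_
        have h1 : |y / x| ≤ 1 := h.trans (by rw [div_le_one hq0]; exact hq.le)
        have h4 : (y / x) ^ 2 ≤ |y / x| ^ q := by
          rw [← sq_abs, ← Real.rpow_two]
          rcases (abs_nonneg (y / x)).eq_or_lt with h0 | h0
          · rw [← h0, Real.zero_rpow hq0.ne', Real.zero_rpow two_ne_zero]
          · exact Real.rpow_le_rpow_of_exponent_ge h0 h1 hq2
        have h5 : 0 ≤ (q + 1) ^ q + q ^ q := by positivity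
        nlinarith [sq_nonneg q]
      · refine (abs_one_add_rpow_le_of_lt hq _ h).trans ?_
        nlinarith [sq_nonneg q]
    have hx' : 0 < |x| ^ q := by positivity
    have h := mul_le_mul_of_nonneg_left key hx'.le
    have e1 : |x| ^ q * |1 + y / x| ^ q = |x + y| ^ q := by
      rw [← Real.mul_rpow (abs_nonneg _) (abs_nonneg _), ← abs_mul]
      congr 2; field_simp
    have e2 : |x| ^ q * |y / x| ^ q = |y| ^ q := by
      rw [← Real.mul_rpow (abs_nonneg _) (abs_nonneg _), ← abs_mul]
      congr 2; field_simp
    rw [e1] at h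
    calc _ ≤ _ := h
      _ = |x| ^ q + q * (|x| ^ q / x) * y +
          ((q + 1) ^ q + q ^ q + q ^ 2) * (|x| ^ q * |y / x| ^ q) := by ring
      _ = _ := by rw [e2]

theorem abs_add_rpow_le_of_two_lt {q : ℝ} (hq : 2 < q) (x y : ℝ) :
    |x + y| ^ q ≤ |x| ^ q + q * (|x| ^ q / x) * y +
      ((q + 1) ^ q + q ^ q + q ^ 2) * (|x| ^ q * (y / x) ^ 2 + |y| ^ q) := by
  have hq0 : 0 < q := by linarith
  have hq1 : 1 < q := by linarith
  rcases eq_or_ne x 0 with rfl | hx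
  · have : 1 ≤ (q + 1) ^ q := Real.one_le_rpow (by linarith) hq0.le
    have h2 : 0 ≤ q ^ q + q ^ 2 := by positivity
    have h3 : 0 ≤ |y| ^ q := by positivity
    simp only [zero_add, abs_zero, div_zero, mul_zero, zero_mul, add_zero,
      Real.zero_rpow hq0.ne']
    nlinarith
  · have key : |1 + y / x| ^ q ≤
        1 + q * (y / x) + ((q + 1) ^ q + q ^ q + q ^ 2) * ((y / x) ^ 2 + |y / x| ^ q) := by
      have h3 : 0 ≤ |y / x| ^ q := by positivity
      have h5 : 0 ≤ (q + 1) ^ q + q ^ q := by positivity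
      rcases le_or_gt |y / x| (1 / q) with h | h
      · refine (abs_one_add_rpow_le hq1 _ h).trans ?_
        nlinarith [sq_nonneg q, sq_nonneg (y / x)]
      · refine (abs_one_add_rpow_le_of_lt hq1 _ h).trans ?_
        nlinarith [sq_nonneg q, sq_nonneg (y / x)]
    have hx' : 0 < |x| ^ q := by positivity
    have h := mul_le_mul_of_nonneg_left key hx'.le
    have e1 : |x| ^ q * |1 + y / x| ^ q = |x + y| ^ q := by
      rw [← Real.mul_rpow (abs_nonneg _) (abs_nonneg _), ← abs_mul]
      congr 2; field_simp
    have e2 : |x| ^ q * |y / x| ^ q = |y| ^ q := by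
      rw [← Real.mul_rpow (abs_nonneg _) (abs_nonneg _), ← abs_mul]
      congr 2; field_simp
    rw [e1] at h
    calc _ ≤ _ := h
      _ = |x| ^ q + q * (|x| ^ q / x) * y +
          ((q + 1) ^ q + q ^ q + q ^ 2) *
            (|x| ^ q * (y / x) ^ 2 + |x| ^ q * |y / x| ^ q) := by ring
      _ = _ := by rw [e2]

theorem abs_rpow_div_mul_le {q : ℝ} (hq : 1 < q) (x y : ℝ) :
    |(|x| ^ q / x) * y| ≤ |x| ^ q + |y| ^ q := by
  have hx0 : 0 ≤ |x| ^ q := by positivity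
  have hy0 : 0 ≤ |y| ^ q := by positivity
  rcases eq_or_ne x 0 with rfl | hx
  · simp only [div_zero, zero_mul, abs_zero]; positivity
  have hx1 : 0 < |x| := abs_pos.2 hx
  rw [abs_mul, abs_div, abs_of_nonneg hx0]
  rcases le_or_gt |y| |x| with h | h
  · have : |x| ^ q / |x| * |y| ≤ |x| ^ q / |x| * |x| := by gcongr
    rw [div_mul_cancel₀ _ hx1.ne'] at this
    linarith
  · have hy1 : 0 < |y| := hx1.trans h
    have : |x| ^ q / |x| * |y| ≤ |y| ^ q / |y| * |y| := by
      rw [← Real.rpow_sub_one hx1.ne', ← Real.rpow_sub_one hy1.ne']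
      gcongr
    rw [div_mul_cancel₀ _ hy1.ne'] at this
    linarith

theorem abs_rpow_mul_div_sq_le {q : ℝ} (hq : 2 < q) (x y : ℝ) :
    |x| ^ q * (y / x) ^ 2 ≤ |x| ^ q + |y| ^ q := by
  have hx0 : 0 ≤ |x| ^ q := by positivity
  have hy0 : 0 ≤ |y| ^ q := by positivity
  rcases eq_or_ne x 0 with rfl | hx
  · simp only [div_zero]; norm_num; positivity
  have hx1 : 0 < |x| := abs_pos.2 hx
  rw [← sq_abs, abs_div]
  rcases le_or_gt |y| |x| with h | h
  · have : (|y| / |x|) ^ 2 ≤ 1 := by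
      apply pow_le_one₀ (by positivity)
      rwa [div_le_one hx1]
    nlinarith
  · have h1 : (|y| / |x|) ^ 2 ≤ (|y| / |x|) ^ q := by
      rw [← Real.rpow_two]
      apply Real.rpow_le_rpow_of_exponent_le _ hq.le
      rw [le_div_iff₀ hx1]; linarith
    have h2 : |x| ^ q * (|y| / |x|) ^ q = |y| ^ q := by
      rw [← Real.mul_rpow hx1.le (by positivity)]
      congr 1; field_simp
    nlinarith

/-- The norm of `Y` is power-type smooth with exponent `p` and constant `C`. -/
def PowerSmooth (Y : Type) [NormedAddCommGroup Y] [NormedSpace ℝ Y] (p C : ℝ) : Prop :=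
  ∀ x : Y, ∃ φ : Y →ₗ[ℝ] ℝ, ∀ y : Y, ‖x + y‖ ^ p ≤ ‖x‖ ^ p + φ y + C * ‖y‖ ^ p

section EllQ

variable {T : Type} {q : ℝ}

theorem ellQ_summable (hq : 1 < q) (x : ellQ T q) : Summable fun t => |x t| ^ q := by
  have h0 : 0 < (ENNReal.ofReal q).toReal := by rw [ENNReal.toReal_ofReal] <;> linarith
  have := (memℓp_gen_iff h0).1 (lp.memℓp x)
  rwa [ENNReal.toReal_ofReal (by linarith)] at this

theorem ellQ_norm_rpow (hq : 1 < q) (x : ellQ T q) : ‖x‖ ^ q = ∑' t, |x t| ^ q := by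
  have h0 : 0 < (ENNReal.ofReal q).toReal := by rw [ENNReal.toReal_ofReal] <;> linarith
  have := lp.norm_rpow_eq_tsum h0 x
  rwa [ENNReal.toReal_ofReal (by linarith)] at this

theorem ellQ_summable_pairing (hq : 1 < q) (x y : ellQ T q) :
    Summable fun t => |x t| ^ q / x t * y t :=
  Summable.of_norm_bounded ((ellQ_summable hq x).add (ellQ_summable hq y))
    fun t => abs_rpow_div_mul_le hq (x t) (y t)

/-- The derivative of `‖·‖ ^ q` on `ℓ_q` at the point `x`. -/
def ellQPairing (hq : 1 < q) (x : ellQ T q) : ellQ T q →ₗ[ℝ] ℝ where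
  toFun y := q * ∑' t, |x t| ^ q / x t * y t
  map_add' y z := by
    rw [← mul_add, ← (ellQ_summable_pairing hq x y).tsum_add (ellQ_summable_pairing hq x z)]
    simp only [lp.coeFn_add, Pi.add_apply, mul_add]
  map_smul' c y := by
    simp only [lp.coeFn_smul, Pi.smul_apply, smul_eq_mul, RingHom.id_apply]
    rw [mul_left_comm c q, ← tsum_mul_left (a := c)]
    congr 1
    exact tsum_congr fun t => by ring

theorem ellQPairing_apply (hq : 1 < q) (x y : ellQ T q) :
    ellQPairing hq x y = q * ∑' t, |x t| ^ q / x t * y t := rfl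

theorem abs_ellQPairing_le (hq : 1 < q) (x z : ellQ T q) (hx : ‖x‖ = 1) (hz : ‖z‖ = 1) :
    |ellQPairing hq x z| ≤ 2 * q := by
  have h1 : |∑' t, |x t| ^ q / x t * z t| ≤ ∑' t, (|x t| ^ q + |z t| ^ q) := by
    rw [← Real.norm_eq_abs]
    exact tsum_of_norm_bounded
      ((ellQ_summable hq x).add (ellQ_summable hq z)).hasSum
      fun t => abs_rpow_div_mul_le hq (x t) (z t)
  rw [(ellQ_summable hq x).tsum_add (ellQ_summable hq z), ← ellQ_norm_rpow hq,
    ← ellQ_norm_rpow hq, hx, hz, Real.one_rpow] at h1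
  rw [ellQPairing_apply, abs_mul, abs_of_pos (by linarith : (0:ℝ) < q)]
  nlinarith

theorem ellQ_norm_add_smul_rpow_le (hq : 2 < q) (x z : ellQ T q) (hx : ‖x‖ = 1)
    (hz : ‖z‖ = 1) (s : ℝ) (hs0 : 0 ≤ s) (hs1 : s ≤ 1) :
    ‖x + s • z‖ ^ q ≤ 1 + s * ellQPairing (by linarith : 1 < q) x z +
      3 * ((q + 1) ^ q + q ^ q + q ^ 2) * s ^ 2 := by
  have hq1 : 1 < q := by linarith
  set C := (q + 1) ^ q + q ^ q + q ^ 2 with hC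
  have hC0 : 0 ≤ C := by positivity
  have hsq : s ^ q ≤ s ^ 2 := by
    rw [← Real.rpow_two]
    rcases hs0.eq_or_lt with rfl | h0
    · rw [Real.zero_rpow (by linarith), Real.zero_rpow two_ne_zero]
    · exact Real.rpow_le_rpow_of_exponent_ge h0 hs1 hq.le
  have S1 := ellQ_summable hq1 x
  have S2 := (ellQ_summable_pairing hq1 x z).mul_left (s * q)
  have S3 := (((ellQ_summable hq1 x).add ((ellQ_summable hq1 z).mul_left 2)).mul_left (C * s ^ 2))
  have key : ‖x + s • z‖ ^ q ≤ ∑' t, (|x t| ^ q + s * q * (|x t| ^ q / x t * z t) +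
      C * s ^ 2 * (|x t| ^ q + 2 * |z t| ^ q)) := by
    rw [ellQ_norm_rpow hq1]
    refine Summable.tsum_le_tsum (fun t => ?_) (ellQ_summable hq1 _) ((S1.add S2).add S3)
    have h := abs_add_rpow_le_of_two_lt hq (x t) (s * z t)
    have h2 := abs_rpow_mul_div_sq_le hq (x t) (z t)
    have h3 : |s * z t| ^ q ≤ s ^ 2 * |z t| ^ q := by
      rw [abs_mul, abs_of_nonneg hs0, Real.mul_rpow hs0 (abs_nonneg _)]
      gcongr
    have h4 : |x t| ^ q * (s * z t / x t) ^ 2 ≤ s ^ 2 * (|x t| ^ q + |z t| ^ q) := by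
      calc _ = s ^ 2 * (|x t| ^ q * (z t / x t) ^ 2) := by ring
        _ ≤ _ := by gcongr
    have h5 : C * (|x t| ^ q * (s * z t / x t) ^ 2 + |s * z t| ^ q) ≤
        C * (s ^ 2 * (|x t| ^ q + |z t| ^ q) + s ^ 2 * |z t| ^ q) := by gcongr
    simp only [lp.coeFn_add, Pi.add_apply, lp.coeFn_smul, Pi.smul_apply, smul_eq_mul]
    linarith
  refine key.trans (le_of_eq ?_)
  rw [(S1.add S2).tsum_add S3, S1.tsum_add S2, tsum_mul_left, tsum_mul_left,
    (ellQ_summable hq1 x).tsum_add ((ellQ_summable hq1 z).mul_left 2), tsum_mul_left,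
    ← ellQ_norm_rpow hq1, ← ellQ_norm_rpow hq1, hx, hz, Real.one_rpow, ellQPairing_apply]
  ring

variable [Fact (1 ≤ ENNReal.ofReal q)]

theorem powerSmooth_ellQ_of_le_two (hq : 1 < q) (hq2 : q ≤ 2) :
    PowerSmooth (ellQ T q) q ((q + 1) ^ q + q ^ q + q ^ 2) := by
  intro x
  refine ⟨ellQPairing hq x, fun y => ?_⟩
  rw [ellQ_norm_rpow hq, ellQ_norm_rpow hq, ellQ_norm_rpow hq, ellQPairing_apply,
    ← tsum_mul_left, ← tsum_mul_left,
    ← (ellQ_summable hq x).tsum_add ((ellQ_summable_pairing hq x y).mul_left q),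
    ← Summable.tsum_add]
  · refine Summable.tsum_le_tsum (fun t => ?_) (ellQ_summable hq (x + y)) ?_
    · simpa only [lp.coeFn_add, Pi.add_apply, mul_assoc] using
        abs_add_rpow_le_of_le_two hq hq2 (x t) (y t)
    · exact ((ellQ_summable hq x).add ((ellQ_summable_pairing hq x y).mul_left q)).add
        ((ellQ_summable hq y).mul_left _)
  · exact (ellQ_summable hq x).add ((ellQ_summable_pairing hq x y).mul_left q)
  · exact (ellQ_summable hq y).mul_left _

theorem powerSmooth_ellQ_of_two_lt (hq : 2 < q) :
    PowerSmooth (ellQ T q) 2 (6 * ((q + 1) ^ q + q ^ q + q ^ 2) + 8) := by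
  have hq1 : 1 < q := by linarith
  have hq0 : 0 < q := by linarith
  set C := (q + 1) ^ q + q ^ q + q ^ 2 with hC
  have hC0 : 0 ≤ C := by positivity
  have unit : ∀ x : ellQ T q, ‖x‖ = 1 → ∀ y : ellQ T q,
      ‖x + y‖ ^ (2 : ℝ) ≤ 1 + 2 / q * ellQPairing hq1 x y + (6 * C + 8) * ‖y‖ ^ (2 : ℝ) := by
    intro x hx y
    rcases eq_or_ne y 0 with rfl | hy
    · simp [hx]
    have hs : 0 < ‖y‖ := norm_pos_iff.2 hy
    obtain ⟨z, hz, hyz⟩ : ∃ z : ellQ T q, ‖z‖ = 1 ∧ y = ‖y‖ • z :=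
      ⟨‖y‖⁻¹ • y, by rw [norm_smul, norm_inv, norm_norm, inv_mul_cancel₀ hs.ne'],
        by rw [smul_smul, mul_inv_cancel₀ hs.ne', one_smul]⟩
    have hφ : ellQPairing hq1 x y = ‖y‖ * ellQPairing hq1 x z := by
      conv_lhs => rw [hyz, map_smul, smul_eq_mul]
    have hb := abs_le.1 (abs_ellQPairing_le hq1 x z hx hz)
    rw [Real.rpow_two, Real.rpow_two]
    rcases le_or_gt ‖y‖ 1 with h1 | h1
    · have h := ellQ_norm_add_smul_rpow_le hq x z hx hz ‖y‖ hs.le h1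
      rw [← hyz, ← hφ, ← hC] at h
      have h0 : 0 ≤ ‖x + y‖ ^ q := by positivity
      have e : ‖x + y‖ ^ 2 = (‖x + y‖ ^ q) ^ (2 / q) := by
        rw [← Real.rpow_mul (norm_nonneg _), mul_div_cancel₀ _ hq0.ne', Real.rpow_two]
      set w := ellQPairing hq1 x y + 3 * C * ‖y‖ ^ 2 with hw
      have h2 : ‖x + y‖ ^ q ≤ 1 + w := by linarith
      have hq2 : 2 / q ≤ 1 := by rw [div_le_one hq0]; exact hq.le
      have h3 : ‖x + y‖ ^ 2 ≤ 1 + 2 / q * w := by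
        rw [e]
        exact (Real.rpow_le_rpow h0 h2 (by positivity)).trans
          (rpow_one_add_le_one_add_mul_self (by linarith) (by positivity) hq2)
      have h4 : 2 / q * (3 * C * ‖y‖ ^ 2) ≤ 1 * (3 * C * ‖y‖ ^ 2) := by gcongr
      have h5 : 0 ≤ C * ‖y‖ ^ 2 := by positivity
      rw [hw] at h3
      nlinarith [sq_nonneg ‖y‖]
    · have h2 : ‖x + y‖ ≤ 2 * ‖y‖ := by
        have := norm_add_le x y
        linarith
      have h3 : ‖x + y‖ ^ 2 ≤ (2 * ‖y‖) ^ 2 := by gcongr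
      have h4 : 2 / q * ellQPairing hq1 x y ≥ -(4 * ‖y‖) := by
        rw [hφ]
        have : 2 / q * (‖y‖ * -(2 * q)) ≤ 2 / q * (‖y‖ * ellQPairing hq1 x z) := by
          gcongr; exact hb.1
        have e : 2 / q * (‖y‖ * -(2 * q)) = -(4 * ‖y‖) := by field_simp; ring
        linarith
      have h5 : 0 ≤ C * ‖y‖ ^ 2 := by positivity
      nlinarith
  intro x
  rcases eq_or_ne x 0 with rfl | hx
  · refine ⟨0, fun y => ?_⟩
    have : 0 ≤ ‖y‖ ^ (2 : ℝ) := by positivity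
    simp only [zero_add, norm_zero, LinearMap.zero_apply, Real.zero_rpow two_ne_zero]
    exact le_mul_of_one_le_left this (by linarith)
  · have hs : 0 < ‖x‖ := norm_pos_iff.2 hx
    have hx1 : ‖(‖x‖⁻¹ • x)‖ = 1 := by
      rw [norm_smul, norm_inv, norm_norm, inv_mul_cancel₀ hs.ne']
    refine ⟨(‖x‖ * (2 / q)) • ellQPairing hq1 (‖x‖⁻¹ • x), fun y => ?_⟩
    have h := unit _ hx1 (‖x‖⁻¹ • y)
    rw [← smul_add, map_smul, norm_smul, norm_smul, norm_inv, norm_norm, smul_eq_mul,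
      Real.mul_rpow (by positivity) (norm_nonneg _),
      Real.mul_rpow (by positivity) (norm_nonneg _)] at h
    simp only [Real.rpow_two, LinearMap.smul_apply, smul_eq_mul] at h ⊢
    have h' := mul_le_mul_of_nonneg_left h (sq_nonneg ‖x‖)
    have e1 : ‖x‖ ^ 2 * (‖x‖⁻¹ ^ 2 * ‖x + y‖ ^ 2) = ‖x + y‖ ^ 2 := by field_simp
    rw [e1] at h'
    refine h'.trans (le_of_eq ?_)
    field_simp

/-- `ℓ_q` is power-type smooth with exponent `min 2 q`. -/
theorem exists_powerSmooth_ellQ (hq : 1 < q) :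
    ∃ C : ℝ, 0 ≤ C ∧ PowerSmooth (ellQ T q) (min 2 q) C := by
  rcases le_or_gt q 2 with h | h
  · exact ⟨(q + 1) ^ q + q ^ q + q ^ 2, by positivity, by
      rw [min_eq_right h]; exact powerSmooth_ellQ_of_le_two hq h⟩
  · exact ⟨6 * ((q + 1) ^ q + q ^ q + q ^ 2) + 8, by positivity, by
      rw [min_eq_left h.le]; exact powerSmooth_ellQ_of_two_lt h⟩

end EllQ

/-! ### Counting lattice points in `ℓ₁`-balls -/

theorem sum_pow_natAbs_le {z : ℝ} (hz0 : 0 < z) (hz1 : z < 1) (s : Finset ℤ) :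
    ∑ k ∈ s, z ^ k.natAbs ≤ (1 + z) / (1 - z) := by
  have h1 := hasSum_geometric_of_lt_one hz0.le hz1
  have h2 := h1.mul_left z
  have h : HasSum (fun k : ℤ => z ^ k.natAbs) ((1 - z)⁻¹ + z * (1 - z)⁻¹) := by
    refine HasSum.of_nat_of_neg_add_one (f := fun k : ℤ => z ^ k.natAbs) ?_ ?_
    · simpa using h1
    · have e : (fun n : ℕ => z ^ (-((n : ℤ) + 1)).natAbs) = fun n => z * z ^ n := by
        ext n
        rw [← pow_succ', show (-((n : ℤ) + 1)).natAbs = n + 1 by omega]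
      rw [e]; exact h2
  refine (sum_le_hasSum s (fun k _ => by positivity) h).trans (le_of_eq ?_)
  field_simp

/-- The integer vectors of `ℓ₁`-norm at most `M`. -/
def latticeBall (ι : Type) [Fintype ι] (M : ℕ) : Finset (ι → ℤ) := by
  classical
  exact (Fintype.piFinset fun _ : ι => Finset.Icc (-(M : ℤ)) M).filter
    fun k => ∑ i, (k i).natAbs ≤ M

theorem mem_latticeBall {ι : Type} [Fintype ι] {M : ℕ} {k : ι → ℤ} :
    k ∈ latticeBall ι M ↔ ∑ i, (k i).natAbs ≤ M := by
  classical
  simp only [latticeBall, Finset.mem_filter, Fintype.mem_piFinset, Finset.mem_Icc,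
    and_iff_right_iff_imp]
  intro h i
  have := (Finset.single_le_sum (f := fun i => (k i).natAbs) (fun _ _ => Nat.zero_le _)
    (Finset.mem_univ i)).trans h
  omega

theorem card_latticeBall_mul_le (ι : Type) [Fintype ι] (M : ℕ) {z : ℝ} (hz0 : 0 < z)
    (hz1 : z < 1) :
    (latticeBall ι M).card * z ^ M ≤ ((1 + z) / (1 - z)) ^ Fintype.card ι := by
  classical
  calc ((latticeBall ι M).card : ℝ) * z ^ M = ∑ _k ∈ latticeBall ι M, z ^ M := by simp
    _ ≤ ∑ k ∈ latticeBall ι M, ∏ i, z ^ (k i).natAbs := by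
        refine Finset.sum_le_sum fun k hk => ?_
        rw [Finset.prod_pow_eq_pow_sum]
        exact pow_le_pow_of_le_one hz0.le hz1.le (mem_latticeBall.1 hk)
    _ ≤ ∑ k ∈ Fintype.piFinset fun _ : ι => Finset.Icc (-(M : ℤ)) M,
          ∏ i, z ^ (k i).natAbs := by
        refine Finset.sum_le_sum_of_subset_of_nonneg (Finset.filter_subset _ _) ?_
        intro k _ _
        positivity
    _ = ∏ _i : ι, ∑ k ∈ Finset.Icc (-(M : ℤ)) M, z ^ k.natAbs :=
        (Finset.prod_univ_sum (fun _ : ι => Finset.Icc (-(M : ℤ)) M)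
          (fun _ k => z ^ k.natAbs)).symm
    _ ≤ ∏ _i : ι, (1 + z) / (1 - z) := by
        refine Finset.prod_le_prod (fun _ _ => Finset.sum_nonneg fun _ _ => by positivity) ?_
        intro i _
        exact sum_pow_natAbs_le hz0 hz1 _
    _ = _ := by rw [Finset.prod_const, Finset.card_univ]

theorem exp_le_four_pow (n : ℕ) : Real.exp n ≤ 4 ^ n := by
  have h := Real.exp_one_lt_d9
  calc Real.exp n = Real.exp 1 ^ n := by rw [← Real.exp_nat_mul, mul_one]
    _ ≤ 4 ^ n := by gcongr; linarith

theorem card_latticeBall_le_of_le (ι : Type) [Fintype ι] {l i : ℕ} (hil : i ≤ l)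
    (hι : Fintype.card ι ≤ 2 ^ l) :
    (latticeBall ι (2 ^ i)).card ≤ 2 ^ (2 ^ i * (l - i + 4)) := by
  obtain ⟨e, rfl⟩ := Nat.exists_eq_add_of_le hil
  rw [Nat.add_sub_cancel_left]
  have h2e : (1 : ℝ) ≤ 2 ^ e := one_le_pow₀ (by norm_num)
  set z : ℝ := 1 / (4 * 2 ^ e) with hz
  have hz0 : 0 < z := by positivity
  have hz4 : z ≤ 1 / 4 := by
    rw [hz]; apply one_div_le_one_div_of_le <;> linarith
  have hz1 : z < 1 := by linarith
  have h := card_latticeBall_mul_le ι (2 ^ i) hz0 hz1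
  have hb : (1 + z) / (1 - z) ≤ Real.exp (4 * z) := by
    have : (1 + z) / (1 - z) ≤ 4 * z + 1 := by
      rw [div_le_iff₀ (by linarith)]; nlinarith
    exact this.trans (Real.add_one_le_exp _)
  have hr : ((1 + z) / (1 - z)) ^ Fintype.card ι ≤ 4 ^ (2 ^ i) := by
    calc ((1 + z) / (1 - z)) ^ Fintype.card ι ≤ Real.exp (4 * z) ^ Fintype.card ι := by
          gcongr
      _ ≤ Real.exp (4 * z) ^ 2 ^ (i + e) :=
          pow_le_pow_right₀ (Real.one_le_exp (by positivity)) hι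
      _ = Real.exp ((2 ^ i : ℕ) : ℝ) := by
          rw [← Real.exp_nat_mul]
          congr 1
          push_cast
          rw [hz, pow_add]
          field_simp
      _ ≤ 4 ^ (2 ^ i) := exp_le_four_pow _
  have h3 : ((latticeBall ι (2 ^ i)).card : ℝ) * z ^ (2 ^ i) ≤ 4 ^ (2 ^ i) := h.trans hr
  have h4 : ((latticeBall ι (2 ^ i)).card : ℝ) ≤ 2 ^ (2 ^ i * (e + 4)) := by
    have hzp : 0 < z ^ (2 ^ i) := by positivity
    rw [← le_div_iff₀ hzp] at h3
    refine h3.trans (le_of_eq ?_)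
    rw [← div_pow, mul_comm (2 ^ i), pow_mul]
    congr 1
    rw [hz]
    simp only [one_div, div_inv_eq_mul]
    rw [pow_add]; ring
  exact_mod_cast h4

theorem card_latticeBall_le_of_ge (ι : Type) [Fintype ι] {l i : ℕ} (hli : l ≤ i)
    (hι : Fintype.card ι ≤ 2 ^ l) :
    (latticeBall ι (2 ^ i)).card ≤ 2 ^ (2 ^ l * (i - l + 4)) := by
  obtain ⟨e, rfl⟩ := Nat.exists_eq_add_of_le hli
  rw [Nat.add_sub_cancel_left]
  have h2e : (1 : ℝ) ≤ 2 ^ e := one_le_pow₀ (by norm_num)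
  set u : ℝ := 1 / (2 * 2 ^ e) with hu
  have hu0 : 0 < u := by positivity
  have hu2 : u ≤ 1 / 2 := by
    rw [hu]; apply one_div_le_one_div_of_le <;> linarith
  have h := card_latticeBall_mul_le ι (2 ^ (l + e)) (z := 1 - u) (by linarith) (by linarith)
  have hr : ((1 + (1 - u)) / (1 - (1 - u))) ^ Fintype.card ι ≤ (4 * 2 ^ e) ^ 2 ^ l := by
    have hb : (1 + (1 - u)) / (1 - (1 - u)) ≤ 4 * 2 ^ e := by
      rw [sub_sub_cancel, div_le_iff₀ hu0, hu]
      field_simp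
      have : 0 < 1 / (2 ^ e : ℝ) := by positivity
      linarith
    calc _ ≤ (4 * 2 ^ e : ℝ) ^ Fintype.card ι := by
          gcongr
          apply div_nonneg <;> linarith
      _ ≤ _ := pow_le_pow_right₀ (by linarith) hι
  have hl : ((4 : ℝ) ^ 2 ^ l)⁻¹ ≤ (1 - u) ^ 2 ^ (l + e) := by
    have h1 : Real.exp (-(2 * u)) ≤ 1 - u := by
      rw [Real.exp_neg]
      apply inv_le_of_inv_le₀ (by linarith)
      refine le_trans ?_ (Real.add_one_le_exp _)
      rw [inv_le_iff_one_le_mul₀ (by linarith)]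
      nlinarith
    calc ((4 : ℝ) ^ 2 ^ l)⁻¹ ≤ (Real.exp ((2 ^ l : ℕ) : ℝ))⁻¹ := by
          gcongr
          exact exp_le_four_pow _
      _ = Real.exp (-(2 * u)) ^ 2 ^ (l + e) := by
          rw [← Real.exp_nat_mul, ← Real.exp_neg]
          congr 1
          push_cast
          rw [hu, pow_add]
          field_simp
      _ ≤ _ := by gcongr
  have h4 : ((latticeBall ι (2 ^ (l + e))).card : ℝ) ≤ 2 ^ (2 ^ l * (e + 4)) := by
    have h5 : ((latticeBall ι (2 ^ (l + e))).card : ℝ) * ((4 : ℝ) ^ 2 ^ l)⁻¹ ≤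
        (4 * 2 ^ e) ^ 2 ^ l := by
      refine le_trans ?_ (h.trans hr)
      gcongr
    rw [← div_eq_mul_inv, div_le_iff₀ (by positivity), ← mul_pow] at h5
    refine h5.trans (le_of_eq ?_)
    rw [mul_comm (2 ^ l), pow_mul]
    congr 1
    rw [pow_add]; ring
  exact_mod_cast h4

/-- The exponent bounding the number of lattice points of norm at most `2 ^ i` in dimension
at most `2 ^ l`. -/
def latticeCost (i l : ℕ) : ℕ := 2 ^ min i l * (i - l + (l - i) + 4)

theorem card_latticeBall_le (ι : Type) [Fintype ι] {l : ℕ} (i : ℕ)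
    (hι : Fintype.card ι ≤ 2 ^ l) :
    (latticeBall ι (2 ^ i)).card ≤ 2 ^ latticeCost i l := by
  unfold latticeCost
  rcases le_total i l with h | h
  · rw [min_eq_left h, Nat.sub_eq_zero_of_le h, zero_add]
    exact card_latticeBall_le_of_le ι h hι
  · rw [min_eq_right h, Nat.sub_eq_zero_of_le h, add_zero]
    exact card_latticeBall_le_of_ge ι h hι

/-! ### Covering absolutely convex hulls -/

/-- `A` is covered by `2 ^ L` closed balls of radius `δ`. -/
def CoveredBy {Y : Type} [NormedAddCommGroup Y] (A : Set Y) (L : ℕ) (δ : ℝ) : Prop :=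
  ∃ F : Finset Y, F.card ≤ 2 ^ L ∧ ∀ a ∈ A, ∃ y ∈ F, ‖a - y‖ ≤ δ

section Covering

variable {Y : Type} [NormedAddCommGroup Y] [NormedSpace ℝ Y]

/-- The absolutely convex hull of a finite family. -/
def absHull {ι : Type} [Fintype ι] (g : ι → Y) : Set Y :=
  {y | ∃ w : ι → ℝ, ∑ i, |w i| ≤ 1 ∧ y = ∑ i, w i • g i}

theorem exists_signed_le {ι : Type} [Fintype ι] (w v : ι → ℝ) (hw : ∑ i, |w i| ≤ 1)
    (hneg : ∑ i, w i * v i < 0) : ∃ i, |v i| ≥ -∑ i, w i * v i := by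
  by_contra! h
  set M := -∑ i, w i * v i with hM
  have hM0 : 0 < M := by linarith
  obtain ⟨i₀, -, hi₀⟩ : ∃ i ∈ Finset.univ, w i * v i < 0 := by
    by_contra! h0
    exact absurd (Finset.sum_nonneg h0) (by linarith)
  have hne : 0 < |w i₀| := abs_pos.2 fun h0 => by simp [h0] at hi₀
  have h1 : M < ∑ i, |w i| * M := by
    calc M = ∑ i, -(w i * v i) := by rw [hM, Finset.sum_neg_distrib]
      _ ≤ ∑ i, |w i| * |v i| := Finset.sum_le_sum fun i _ => by
          rw [← abs_mul]; exact neg_le_abs _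
      _ < ∑ i, |w i| * M := by
          refine Finset.sum_lt_sum (fun i _ => ?_) ⟨i₀, Finset.mem_univ _, ?_⟩
          · exact mul_le_mul_of_nonneg_left (h i).le (abs_nonneg _)
          · exact mul_lt_mul_of_pos_left (h i₀) hne
  rw [← Finset.sum_mul] at h1
  nlinarith

theorem norm_le_of_mem_absHull {ι : Type} [Fintype ι] {g : ι → Y} {r : ℝ} (hr : 0 ≤ r)
    (hg : ∀ i, ‖g i‖ ≤ r) {x : Y} (hx : x ∈ absHull g) : ‖x‖ ≤ r := by
  obtain ⟨w, hw, rfl⟩ := hx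
  calc ‖∑ i, w i • g i‖ ≤ ∑ i, ‖w i • g i‖ := norm_sum_le _ _
    _ ≤ ∑ i, |w i| * r := Finset.sum_le_sum fun i _ => by
        rw [norm_smul, Real.norm_eq_abs]
        exact mul_le_mul_of_nonneg_left (hg i) (abs_nonneg _)
    _ = (∑ i, |w i|) * r := by rw [Finset.sum_mul]
    _ ≤ r := by nlinarith

/-- Maurey's empirical method, in a greedy deterministic form. -/
theorem exists_lattice_approx {p C r : ℝ} (hp : 0 < p) (hC : 0 ≤ C) (hY : PowerSmooth Y p C)
    {ι : Type} [Fintype ι] {g : ι → Y} (hr : 0 ≤ r) (hg : ∀ i, ‖g i‖ ≤ r) {x : Y}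
    (hx : x ∈ absHull g) (M : ℕ) :
    ∃ k : ι → ℤ, ∑ i, (k i).natAbs ≤ M ∧
      ‖∑ i, (k i : ℝ) • g i - (M : ℝ) • x‖ ^ p ≤ M * (C * (2 * r) ^ p) := by
  classical
  have hxr := norm_le_of_mem_absHull hr hg hx
  induction M with
  | zero => exact ⟨0, by simp, by simp [Real.zero_rpow hp.ne']⟩
  | succ M ih =>
    obtain ⟨k, hk, hkx⟩ := ih
    obtain ⟨φ, hφ⟩ := hY (∑ i, (k i : ℝ) • g i - (M : ℝ) • x)
    have key : ∃ v : Y, ‖v‖ ≤ r ∧ φ v ≤ φ x ∧ ∃ k' : ι → ℤ, ∑ i, (k' i).natAbs ≤ M + 1 ∧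
        ∑ i, (k' i : ℝ) • g i = ∑ i, (k i : ℝ) • g i + v := by
      rcases le_or_gt 0 (φ x) with h0 | h0
      · exact ⟨0, by simpa using hr, by simpa using h0, k, by omega, by simp⟩
      · obtain ⟨w, hw, hxw⟩ := hx
        have e : φ x = ∑ i, w i * φ (g i) := by
          rw [hxw, map_sum]; simp only [map_smul, smul_eq_mul]
        rw [e] at h0
        obtain ⟨i, hi⟩ := exists_signed_le w (fun i => φ (g i)) hw h0
        rw [← e] at hi
        obtain ⟨s, hs, hsφ⟩ : ∃ s : ℤ, s.natAbs = 1 ∧ (s : ℝ) * φ (g i) = -|φ (g i)| := by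
          rcases le_total 0 (φ (g i)) with h | h
          · exact ⟨-1, rfl, by rw [abs_of_nonneg h]; simp⟩
          · exact ⟨1, rfl, by rw [abs_of_nonpos h]; simp⟩
        refine ⟨(s : ℝ) • g i, ?_, ?_, (k + Pi.single i s : ι → ℤ), ?_, ?_⟩
        · have : ‖(s : ℝ)‖ = 1 := by
            rw [Real.norm_eq_abs, ← Int.cast_abs, Int.abs_eq_natAbs, hs]; simp
          rw [norm_smul, this, one_mul]; exact hg i
        · rw [map_smul, smul_eq_mul, hsφ]; linarith
        · calc ∑ j, ((k + Pi.single i s : ι → ℤ) j).natAbs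
              ≤ ∑ j, ((k j).natAbs + (if j = i then 1 else 0)) := by
                refine Finset.sum_le_sum fun j _ => ?_
                rcases eq_or_ne j i with rfl | h
                · simp only [Pi.add_apply, Pi.single_eq_same, if_true]
                  exact (Int.natAbs_add_le _ _).trans (by rw [hs])
                · simp [h]
            _ = ∑ j, (k j).natAbs + 1 := by
                rw [Finset.sum_add_distrib, Finset.sum_ite_eq' Finset.univ i]
                simp
            _ ≤ M + 1 := by omega
        · simp only [Pi.add_apply, Int.cast_add, add_smul, Finset.sum_add_distrib]
          congr 1
          rw [Finset.sum_eq_single i]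
          · simp
          · intro j _ hj; simp [Pi.single_eq_of_ne hj]
          · simp
    obtain ⟨v, hv, hvφ, k', hk', hsum⟩ := key
    refine ⟨k', hk', ?_⟩
    have e : ∑ i, (k' i : ℝ) • g i - ((M + 1 : ℕ) : ℝ) • x =
        (∑ i, (k i : ℝ) • g i - (M : ℝ) • x) + (v - x) := by
      rw [hsum]; push_cast; rw [add_smul, one_smul]; abel
    rw [e]
    have h1 : ‖v - x‖ ^ p ≤ (2 * r) ^ p := by
      gcongr
      exact (norm_sub_le _ _).trans (by linarith)
    have h2 := hφ (v - x)
    rw [map_sub] at h2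
    have h3 := mul_le_mul_of_nonneg_left h1 hC
    push_cast
    linarith

theorem coveredBy_absHull {p C r : ℝ} (hp : 0 < p) (hC : 0 ≤ C) (hY : PowerSmooth Y p C)
    {ι : Type} [Fintype ι] {g : ι → Y} (hr : 0 ≤ r) (hg : ∀ i, ‖g i‖ ≤ r) {l : ℕ}
    (hι : Fintype.card ι ≤ 2 ^ l) (i : ℕ) :
    CoveredBy (absHull g) (latticeCost i l)
      (2 * C ^ (1 / p) * r * 2 ^ (-((1 - 1 / p) * i))) := by
  classical
  refine ⟨(latticeBall ι (2 ^ i)).image fun k => ((2 : ℝ) ^ i)⁻¹ • ∑ j, (k j : ℝ) • g j,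
    Finset.card_image_le.trans (card_latticeBall_le ι i hι), fun x hx => ?_⟩
  obtain ⟨k, hk, hkx⟩ := exists_lattice_approx hp hC hY hr hg hx (2 ^ i)
  refine ⟨_, Finset.mem_image_of_mem _ (mem_latticeBall.2 hk), ?_⟩
  have h2 : (0 : ℝ) < 2 ^ i := by positivity
  set S := ∑ j, (k j : ℝ) • g j
  have e : x - ((2 : ℝ) ^ i)⁻¹ • S = -(((2 : ℝ) ^ i)⁻¹ • (S - ((2 : ℝ) ^ i) • x)) := by
    rw [smul_sub, smul_smul, inv_mul_cancel₀ h2.ne', one_smul]; abel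
  push_cast at hkx
  have h3 : ‖S - ((2 : ℝ) ^ i) • x‖ ≤ ((2 : ℝ) ^ i * (C * (2 * r) ^ p)) ^ (1 / p) := by
    rw [one_div, Real.le_rpow_inv_iff_of_pos (norm_nonneg _) (by positivity) hp]
    exact hkx
  rw [e, norm_neg, norm_smul, norm_inv, Real.norm_of_nonneg h2.le]
  calc _ ≤ ((2 : ℝ) ^ i)⁻¹ * ((2 : ℝ) ^ i * (C * (2 * r) ^ p)) ^ (1 / p) := by gcongr
    _ = _ := by
      rw [Real.mul_rpow h2.le (by positivity), Real.mul_rpow hC (by positivity),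
        ← Real.rpow_mul (by positivity) p, mul_one_div_cancel hp.ne', Real.rpow_one,
        ← Real.rpow_natCast, ← Real.rpow_mul zero_le_two, ← Real.rpow_neg zero_le_two]
      have : -((1 - 1 / p) * (i : ℝ)) = -(i : ℝ) + (i : ℝ) * (1 / p) := by ring
      rw [this, Real.rpow_add zero_lt_two]
      ring

end Covering

theorem CoveredBy.add {Y : Type} [NormedAddCommGroup Y] {A B : Set Y} {L L' : ℕ} {δ δ' : ℝ}
    (hA : CoveredBy A L δ)
    (hB : CoveredBy B L' δ') :
    CoveredBy {y | ∃ a ∈ A, ∃ b ∈ B, y = a + b} (L + L') (δ + δ') := by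
  classical
  obtain ⟨F, hF, hFA⟩ := hA
  obtain ⟨F', hF', hFB⟩ := hB
  refine ⟨(F ×ˢ F').image fun u => u.1 + u.2, ?_, ?_⟩
  · refine Finset.card_image_le.trans ?_
    rw [Finset.card_product, pow_add]
    exact Nat.mul_le_mul hF hF'
  · rintro _ ⟨a, ha, b, hb, rfl⟩
    obtain ⟨y, hy, hay⟩ := hFA a ha
    obtain ⟨y', hy', hby⟩ := hFB b hb
    refine ⟨y + y', Finset.mem_image.2 ⟨(y, y'), Finset.mk_mem_product hy hy', rfl⟩, ?_⟩
    rw [add_sub_add_comm]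
    exact (norm_add_le _ _).trans (add_le_add hay hby)

/-! ### Chaining -/

section Chaining

variable {Y : Type} [NormedAddCommGroup Y] [NormedSpace ℝ Y]

/-- A symmetric convex set containing the origin. -/
structure SymmConvex (A : Set Y) : Prop where
  convex : Convex ℝ A
  neg_mem : ∀ y ∈ A, -y ∈ A
  zero_mem : (0 : Y) ∈ A

theorem SymmConvex.smul_mem {A : Set Y} (hA : SymmConvex A) {y : Y} (hy : y ∈ A) {c : ℝ}
    (h0 : 0 ≤ c) (h1 : c ≤ 1) : c • y ∈ A := by
  have := hA.convex hA.zero_mem hy (by linarith : 0 ≤ 1 - c) h0 (by ring)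
  simpa using this

theorem SymmConvex.sum_mem {A : Set Y} (hA : SymmConvex A) {T : Type} (F : Finset T)
    (w : T → ℝ) (f : T → Y) (hw : ∑ s ∈ F, |w s| ≤ 1) (hf : ∀ s, f s ∈ A) :
    ∑ s ∈ F, w s • f s ∈ A := by
  have hsign : ∀ s, ∃ y ∈ A, w s • f s = |w s| • y := by
    intro s
    rcases le_total 0 (w s) with h | h
    · exact ⟨f s, hf s, by rw [abs_of_nonneg h]⟩
    · exact ⟨-f s, hA.neg_mem _ (hf s), by rw [abs_of_nonpos h]; simp⟩
  choose y hy hwy using hsign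
  rw [Finset.sum_congr rfl fun s _ => hwy s]
  rcases (Finset.sum_nonneg fun s (_ : s ∈ F) => abs_nonneg (w s)).eq_or_lt with h0 | h0
  · have : ∀ s ∈ F, |w s| • y s = 0 := fun s hs => by
      rw [(Finset.sum_eq_zero_iff_of_nonneg fun s _ => abs_nonneg (w s)).1 h0.symm s hs,
        zero_smul]
    rw [Finset.sum_eq_zero this]
    exact hA.zero_mem
  · have h1 := hA.convex.centerMass_mem (t := F) (w := fun s => |w s|) (z := y)
      (fun s _ => abs_nonneg _) h0 fun s _ => hy s
    have h2 := hA.smul_mem h1 h0.le hw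
    rwa [Finset.centerMass, smul_smul, mul_inv_cancel₀ h0.ne', one_smul] at h2

theorem symmConvex_absHull {ι : Type} [Fintype ι] (g : ι → Y) : SymmConvex (absHull g) where
  convex := by
    rintro _ ⟨w, hw, rfl⟩ _ ⟨v, hv, rfl⟩ a b ha hb hab
    refine ⟨fun i => a * w i + b * v i, ?_, ?_⟩
    · calc ∑ i, |a * w i + b * v i| ≤ ∑ i, (a * |w i| + b * |v i|) :=
            Finset.sum_le_sum fun i _ => by
              refine (abs_add_le _ _).trans ?_
              rw [abs_mul, abs_mul, abs_of_nonneg ha, abs_of_nonneg hb]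
        _ = a * ∑ i, |w i| + b * ∑ i, |v i| := by
            rw [Finset.sum_add_distrib, Finset.mul_sum, Finset.mul_sum]
        _ ≤ a * 1 + b * 1 := by gcongr
        _ = 1 := by linarith
    · simp only [add_smul, Finset.sum_add_distrib, Finset.smul_sum, smul_smul]
  neg_mem := by
    rintro _ ⟨w, hw, rfl⟩
    exact ⟨fun i => -w i, by simpa using hw, by simp⟩
  zero_mem := ⟨0, by simp, by simp⟩

theorem mem_absHull {ι : Type} [Fintype ι] (g : ι → Y) (i : ι) : g i ∈ absHull g := by
  classical
  refine ⟨Pi.single i 1, ?_, ?_⟩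
  · rw [Finset.sum_eq_single i]
    · simp
    · intro j _ hj; simp [hj]
    · simp
  · rw [Finset.sum_eq_single i]
    · simp
    · intro j _ hj; simp [hj]
    · simp

theorem SymmConvex.add {A B : Set Y} (hA : SymmConvex A) (hB : SymmConvex B) :
    SymmConvex {y | ∃ a ∈ A, ∃ b ∈ B, y = a + b} where
  convex := by
    rintro _ ⟨a, ha, b, hb, rfl⟩ _ ⟨a', ha', b', hb', rfl⟩ u v hu hv huv
    exact ⟨_, hA.convex ha ha' hu hv huv, _, hB.convex hb hb' hu hv huv, by
      simp only [smul_add]; abel⟩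
  neg_mem := by
    rintro _ ⟨a, ha, b, hb, rfl⟩
    exact ⟨_, hA.neg_mem a ha, _, hB.neg_mem b hb, by abel⟩
  zero_mem := ⟨0, hA.zero_mem, 0, hB.zero_mem, by simp⟩

theorem symmConvex_closedBall {ε : ℝ} (hε : 0 ≤ ε) : SymmConvex {y : Y | ‖y‖ ≤ ε} where
  convex := by
    have := convex_closedBall (0 : Y) ε
    have e : Metric.closedBall (0 : Y) ε = {y : Y | ‖y‖ ≤ ε} := by ext; simp
    rwa [e] at this
  neg_mem y hy := by simpa using hy
  zero_mem := by simpa using hε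

/-- The radii of the successive families of increments in a chain. -/
def chainRadius (K : ℝ) (ε : ℕ → ℝ) : ℕ → ℝ
  | 0 => K
  | j + 1 => ε j

theorem exists_chain_hull {p C K : ℝ} (hp : 0 < p) (hC : 0 ≤ C) (hY : PowerSmooth Y p C)
    {T : Type} {f : T → Y} (hf : ∀ s, ‖f s‖ ≤ K) (hK : 0 ≤ K) {S : ℕ → Finset T} {ε : ℕ → ℝ}
    (hε : ∀ j, 0 ≤ ε j) {l : ℕ → ℕ} (hl : ∀ j, (S j).card ≤ 2 ^ l j)
    (hnet : ∀ j s, ∃ t ∈ S j, ∃ c : ℝ, 0 ≤ c ∧ c ≤ 1 ∧ ‖f s - c • f t‖ ≤ ε j)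
    (i : ℕ → ℕ) (J : ℕ) :
    ∃ A : Set Y, SymmConvex A ∧ (∀ t ∈ S J, f t ∈ A) ∧
      CoveredBy A (∑ j ∈ Finset.range (J + 1), latticeCost (i j) (l j))
        (∑ j ∈ Finset.range (J + 1),
          2 * C ^ (1 / p) * chainRadius K ε j * 2 ^ (-((1 - 1 / p) * (i j : ℝ)))) := by
  induction J with
  | zero =>
    refine ⟨absHull fun t : S 0 => f t, symmConvex_absHull _,
      fun t ht => mem_absHull (fun t : S 0 => f t) ⟨t, ht⟩, ?_⟩
    simp only [zero_add, Finset.sum_range_one]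
    exact coveredBy_absHull hp hC hY (g := fun t : S 0 => f t) hK (fun t => hf t)
      (by simpa using hl 0) (i 0)
  | succ J ih =>
    obtain ⟨A, hA, hfA, hcov⟩ := ih
    choose π hπ c hc0 hc1 hc using hnet J
    set g : S (J + 1) → Y := fun t => f t - c t • f (π t) with hg
    refine ⟨_, (hA.add (symmConvex_absHull g)), ?_, ?_⟩
    · intro t ht
      refine ⟨_, hA.smul_mem (hfA _ (hπ t)) (hc0 t) (hc1 t), _, mem_absHull g ⟨t, ht⟩, ?_⟩
      simp [hg]
    · rw [Finset.sum_range_succ, Finset.sum_range_succ (n := J + 1)]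
      exact hcov.add (coveredBy_absHull hp hC hY (g := g) (hε J) (fun t => hc t)
        (by simpa using hl (J + 1)) (i (J + 1)))

end Chaining

/-! ### Entropy numbers of operators on `ℓ₁` -/

section Entropy

variable {T : Type} {Y : Type} [NormedAddCommGroup Y] [NormedSpace ℝ Y]

/-- The unit vector of `ℓ₁(T)` at the node `s`. -/
def unitVec (s : T) : ellOne T := by
  classical
  exact lp.single 1 s (1 : ℝ)

theorem unitVec_apply_self (s : T) : (unitVec s : ∀ _ : T, ℝ) s = 1 := by
  classical
  simp [unitVec, lp.single_apply]

theorem unitVec_apply_of_ne {s t : T} (h : t ≠ s) : (unitVec s : ∀ _ : T, ℝ) t = 0 := by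
  classical
  simp [unitVec, lp.single_apply, h]

theorem norm_unitVec (s : T) : ‖unitVec s‖ = 1 := by
  classical
  simp [unitVec, lp.norm_single]

theorem hasSum_unitVec (x : ellOne T) :
    HasSum (fun s => (x : ∀ _ : T, ℝ) s • unitVec s) x := by
  classical
  have h := lp.hasSum_single (p := 1) ENNReal.one_ne_top x
  convert h using 2 with s
  rw [unitVec, ← lp.single_smul]
  simp

theorem sum_abs_le_norm (x : ellOne T) (F : Finset T) :
    ∑ s ∈ F, |(x : ∀ _ : T, ℝ) s| ≤ ‖x‖ := by
  have := lp.sum_rpow_le_norm_rpow (p := 1) (by simp) x F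
  simpa using this

theorem entropyNumber_le_of_hull (V : ellOne T →L[ℝ] Y) {A : Set Y} (hA : SymmConvex A)
    {L : ℕ} {δ ε : ℝ} (hε : 0 ≤ ε) (hcov : CoveredBy A L δ)
    (hnet : ∀ s, ∃ a ∈ A, ‖V (unitVec s) - a‖ ≤ ε) :
    entropyNumber (L + 1) V ≤ δ + ε := by
  obtain ⟨F, hF, hFA⟩ := hcov
  have hδ : 0 ≤ δ := by
    obtain ⟨y, -, hy⟩ := hFA 0 hA.zero_mem
    exact (norm_nonneg _).trans hy
  refine le_of_forall_pos_le_add fun η hη => csInf_le ⟨0, fun _ h => h.1.le⟩ ?_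
  refine ⟨by positivity, F, by simpa using hF, fun x hx => ?_⟩
  have hsum : HasSum (fun s => (x : ∀ _ : T, ℝ) s • V (unitVec s)) (V x) := by
    simpa using V.hasSum (hasSum_unitVec x)
  obtain ⟨G, hG⟩ := (hsum.eventually (Metric.ball_mem_nhds (V x) hη)).exists
  rw [dist_eq_norm, ← norm_neg, neg_sub] at hG
  have hmem := (hA.add (symmConvex_closedBall (Y := Y) hε)).sum_mem G _
    (fun s => V (unitVec s)) ((sum_abs_le_norm x G).trans hx) fun s => by
      obtain ⟨a, ha, h⟩ := hnet s
      exact ⟨a, ha, _, h, by abel⟩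
  obtain ⟨a, ha, b, hb, hab⟩ := hmem
  obtain ⟨y, hy, hay⟩ := hFA a ha
  refine ⟨y, hy, ?_⟩
  rw [hab] at hG
  have e : V x - y = (V x - (a + b)) + (a - y) + b := by abel
  rw [e]
  have hb' : ‖b‖ ≤ ε := hb
  linarith [norm_add_le ((V x - (a + b)) + (a - y)) b, norm_add_le (V x - (a + b)) (a - y)]

theorem entropyNumber_le_chain {p C : ℝ} (hp : 0 < p) (hC : 0 ≤ C) (hY : PowerSmooth Y p C)
    (V : ellOne T →L[ℝ] Y) {S : ℕ → Finset T} {ε : ℕ → ℝ}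
    (hε : ∀ j, 0 ≤ ε j) {l : ℕ → ℕ} (hl : ∀ j, (S j).card ≤ 2 ^ l j)
    (hnet : ∀ j s, ∃ t ∈ S j, ∃ c : ℝ, 0 ≤ c ∧ c ≤ 1 ∧
      ‖V (unitVec s) - c • V (unitVec t)‖ ≤ ε j) (i : ℕ → ℕ) (J : ℕ) :
    entropyNumber (∑ j ∈ Finset.range (J + 1), latticeCost (i j) (l j) + 1) V ≤
      ∑ j ∈ Finset.range (J + 1),
        2 * C ^ (1 / p) * chainRadius ‖V‖ ε j * 2 ^ (-((1 - 1 / p) * (i j : ℝ))) + ε J := by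
  obtain ⟨A, hA, hfA, hcov⟩ := exists_chain_hull hp hC hY (f := fun s => V (unitVec s))
    (fun s => by simpa [norm_unitVec] using V.le_opNorm (unitVec s)) (norm_nonneg V)
    hε hl hnet i J
  refine entropyNumber_le_of_hull V hA (hε J) hcov fun s => ?_
  obtain ⟨t, ht, c, h0, h1, h⟩ := hnet J s
  exact ⟨_, hA.smul_mem (hfA t ht) h0 h1, h⟩

theorem entropyNumber_anti (V : ellOne T →L[ℝ] Y) {n n' : ℕ} (h : n ≤ n') :
    entropyNumber n' V ≤ entropyNumber n V := by
  refine csInf_le_csInf ⟨0, fun _ h => h.1.le⟩ ?_ ?_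
  · refine ⟨‖V‖ + 1, by positivity, {0}, by simpa using Nat.one_le_two_pow, fun x hx => ?_⟩
    refine ⟨0, by simp, ?_⟩
    rw [sub_zero]
    have := V.le_opNorm x
    nlinarith [norm_nonneg V, norm_nonneg x]
  · rintro ε ⟨h0, F, hF, hFV⟩
    exact ⟨h0, F, hF.trans (Nat.pow_le_pow_right (by norm_num) (by omega)), hFV⟩

theorem entropyNumber_le_norm (V : ellOne T →L[ℝ] Y) (n : ℕ) :
    entropyNumber n V ≤ ‖V‖ + 1 := by
  refine csInf_le ⟨0, fun _ h => h.1.le⟩ ⟨by positivity, {0},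
    by simpa using Nat.one_le_two_pow, fun x hx => ⟨0, by simp, ?_⟩⟩
  rw [sub_zero]
  have := V.le_opNorm x
  nlinarith [norm_nonneg V, norm_nonneg x]

end Entropy

/-! ### Nets in the tree -/

section Tree

variable {T : Type} [PartialOrder T]

open Classical in
theorem summation_unitVec_apply {q : ℝ} {α σ : T → ℝ}
    {V : ellOne T → ellQ T q}
    (hV : ∀ (x : ellOne T) (t : T), (V x : ∀ _ : T, ℝ) t =
      α t * ∑' s : {s : T // t ≤ s}, σ s.1 * (x : ∀ _ : T, ℝ) s.1) (s r : T) :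
    (V (unitVec s) : ∀ _ : T, ℝ) r = if r ≤ s then α r * σ s else 0 := by
  rw [hV]
  split_ifs with h
  · rw [tsum_eq_single (⟨s, h⟩ : {s : T // r ≤ s}), unitVec_apply_self, mul_one]
    intro u hu
    rw [unitVec_apply_of_ne, mul_zero]
    exact fun e => hu (Subtype.ext e)
  · have : ∀ u : {s : T // r ≤ s}, σ u.1 * (unitVec s : ∀ _ : T, ℝ) u.1 = 0 := by
      intro u
      rw [unitVec_apply_of_ne, mul_zero]
      rintro rfl
      exact h u.2
    rw [tsum_congr this, tsum_zero, mul_zero]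

theorem norm_summation_sub_le [OrderBot T] (htree : IsTree T) {q : ℝ} (hq : 1 < q)
    [Fact (1 ≤ ENNReal.ofReal q)] {α σ : T → ℝ} (hα : ∀ t, 0 < α t) (hσ : ∀ t, 0 < σ t)
    {V : ellOne T → ellQ T q}
    (hV : ∀ (x : ellOne T) (t : T), (V x : ∀ _ : T, ℝ) t =
      α t * ∑' s : {s : T // t ≤ s}, σ s.1 * (x : ∀ _ : T, ℝ) s.1) {t s : T} (hts : t ≤ s) :
    ‖V (unitVec s) - (σ s / σ t) • V (unitVec t)‖ ≤ dOrd q α σ t s := by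
  classical
  have hq0 : 0 < q := by linarith
  have hfin : (Set.Ioc t s).Finite := (htree.1 s).subset fun r hr => hr.2
  have hcoord : ∀ r, (V (unitVec s) - (σ s / σ t) • V (unitVec t) : ellQ T q) r =
      if r ∈ Set.Ioc t s then α r * σ s else 0 := by
    intro r
    rw [lp.coeFn_sub, Pi.sub_apply, lp.coeFn_smul, Pi.smul_apply, smul_eq_mul,
      summation_unitVec_apply hV, summation_unitVec_apply hV]
    by_cases h1 : r ≤ t
    · have h2 : r ∉ Set.Ioc t s := fun h => h.1.not_ge h1
      rw [if_pos h1, if_pos (h1.trans hts), if_neg h2]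
      have := (hσ t).ne'
      field_simp
      ring
    · rw [if_neg h1, mul_zero, sub_zero]
      by_cases h2 : r ≤ s
      · have h3 : t < r := by
          rcases htree.2.1 s t r hts h2 with h | h
          · exact lt_of_le_of_ne h fun e => h1 e.ge
          · exact absurd h h1
        rw [if_pos h2, if_pos ⟨h3, h2⟩]
      · rw [if_neg h2, if_neg fun h => h2 h.2]
  have hsum : ‖V (unitVec s) - (σ s / σ t) • V (unitVec t)‖ ^ q =
      (∑ᶠ r ∈ Set.Ioc t s, α r ^ q) * σ s ^ q := by
    rw [ellQ_norm_rpow hq, tsum_eq_sum (s := hfin.toFinset),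
      finsum_mem_eq_finite_toFinset_sum _ hfin, Finset.sum_mul]
    · refine Finset.sum_congr rfl fun r hr => ?_
      rw [hcoord, if_pos (hfin.mem_toFinset.1 hr), abs_of_pos (mul_pos (hα r) (hσ s)),
        Real.mul_rpow (hα r).le (hσ s).le]
    · intro r hr
      rw [hcoord, if_neg fun h => hr (hfin.mem_toFinset.2 h), abs_zero,
        Real.zero_rpow hq0.ne']
  have hnn : 0 ≤ ∑ᶠ r ∈ Set.Ioc t s, α r ^ q :=
    finsum_nonneg fun r => finsum_nonneg fun _ => Real.rpow_nonneg (hα r).le q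
  have hnorm : ‖V (unitVec s) - (σ s / σ t) • V (unitVec t)‖ =
      (∑ᶠ r ∈ Set.Ioc t s, α r ^ q) ^ (1 / q) * σ s := by
    rw [← Real.rpow_rpow_inv (norm_nonneg _) hq0.ne', hsum,
      Real.mul_rpow hnn (by have := hσ s; positivity), Real.rpow_rpow_inv (hσ s).le hq0.ne',
      one_div]
  rw [hnorm, dOrd]
  rcases eq_or_lt_of_le hts with rfl | hlt
  · simp [hq0.ne']
  · exact le_csSup (hfin.image _).bddAbove ⟨s, ⟨hlt, le_rfl⟩, rfl⟩

theorem exists_orderNet {d : T → T → ℝ} {ε B : ℝ} (hB : 0 ≤ B)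
    (h : orderCoveringNumber d ε ≤ ENNReal.ofReal B) :
    ∃ S : Finset T, (S.card : ℝ) ≤ B ∧ ∀ t, ∃ s ∈ S, s ≤ t ∧ d s t < ε := by
  by_contra! hcon
  have h1 : ((⌊B⌋₊ + 1 : ℕ) : ℝ≥0∞) ≤ orderCoveringNumber d ε := by
    refine le_iInf₂ fun S hS => ?_
    by_contra! hlt
    have h2 : S.card < ⌊B⌋₊ + 1 := by exact_mod_cast hlt
    obtain ⟨t, ht⟩ := hcon S ((Nat.cast_le.2 (Nat.lt_succ_iff.1 h2)).trans (Nat.floor_le hB))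
    obtain ⟨s, hs, hst, hd⟩ := hS t
    exact (ht s hs hst).not_gt hd
  have h3 := h1.trans h
  rw [← ENNReal.ofReal_natCast, ENNReal.ofReal_le_ofReal_iff hB] at h3
  push_cast at h3
  linarith [Nat.lt_floor_add_one B]

/-- An order net of the tree yields a net for the images of the unit vectors. -/
theorem exists_summation_net [OrderBot T] (htree : IsTree T) {q : ℝ} (hq : 1 < q)
    [Fact (1 ≤ ENNReal.ofReal q)] {α σ : T → ℝ} (hα : ∀ t, 0 < α t) (hσ : ∀ t, 0 < σ t)
    (hσmono : ∀ ⦃t s : T⦄, t ≤ s → σ s ≤ σ t) {V : ellOne T → ellQ T q}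
    (hV : ∀ (x : ellOne T) (t : T), (V x : ∀ _ : T, ℝ) t =
      α t * ∑' s : {s : T // t ≤ s}, σ s.1 * (x : ∀ _ : T, ℝ) s.1)
    (glb : T → T → T) {ε B : ℝ} (hB : 0 ≤ B)
    (h : orderCoveringNumber (treeDist q α σ glb) ε ≤ ENNReal.ofReal B) :
    ∃ S : Finset T, (S.card : ℝ) ≤ B ∧ ∀ s, ∃ t ∈ S, ∃ c : ℝ, 0 ≤ c ∧ c ≤ 1 ∧
      ‖V (unitVec s) - c • V (unitVec t)‖ ≤ ε := by
  obtain ⟨S, hS, hnet⟩ := exists_orderNet hB h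
  refine ⟨S, hS, fun s => ?_⟩
  obtain ⟨t, ht, hts, hd⟩ := hnet s
  rw [treeDist, if_pos hts] at hd
  exact ⟨t, ht, σ s / σ t, (div_pos (hσ s) (hσ t)).le, (div_le_one (hσ t)).2 (hσmono hts),
    (norm_summation_sub_le htree hq hα hσ hV hts).trans hd.le⟩

end Tree

/-! ### Elementary estimates -/

theorem exists_add_one_rpow_le (v : ℝ) {δ : ℝ} (hδ : 0 < δ) :
    ∃ c : ℝ, 0 < c ∧ ∀ x : ℝ, 0 ≤ x → (x + 1) ^ v ≤ c * 2 ^ (δ * x) := by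
  have hlog : 0 < Real.log 2 := Real.log_pos one_lt_two
  rcases le_or_gt v 0 with hv | hv
  · refine ⟨1, one_pos, fun x hx => ?_⟩
    have h1 : (x + 1) ^ v ≤ 1 := Real.rpow_le_one_of_one_le_of_nonpos (by linarith) hv
    have h2 : (1 : ℝ) ≤ 2 ^ (δ * x) := Real.one_le_rpow one_le_two (by positivity)
    linarith
  · set t := Real.log 2 * δ / v with ht
    have ht0 : 0 < t := by positivity
    refine ⟨(1 + 1 / t) ^ v, by positivity, fun x hx => ?_⟩
    have h1 : x + 1 ≤ (1 + 1 / t) * Real.exp (t * x) := by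
      have := Real.add_one_le_exp (t * x)
      have h2 : (1 + 1 / t) * (t * x + 1) ≤ (1 + 1 / t) * Real.exp (t * x) := by gcongr
      have h3 : (1 + 1 / t) * (t * x + 1) = x + 1 + t * x + 1 / t := by field_simp; ring
      have h4 : 0 ≤ t * x + 1 / t := by positivity
      linarith
    calc (x + 1) ^ v ≤ ((1 + 1 / t) * Real.exp (t * x)) ^ v := by gcongr
      _ = (1 + 1 / t) ^ v * 2 ^ (δ * x) := by
        rw [Real.mul_rpow (by positivity) (Real.exp_nonneg _), ← Real.exp_mul,
          Real.rpow_def_of_pos zero_lt_two]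
        congr 2
        rw [ht]; field_simp

theorem exists_sum_two_rpow_le {δ : ℝ} (hδ : 0 < δ) :
    ∃ c : ℝ, 0 < c ∧ ∀ n m : ℕ,
      ∑ j ∈ Finset.range n, (2 : ℝ) ^ (-(δ * |(j : ℝ) - m|)) ≤ c := by
  set f : ℤ → ℝ := fun z => 2 ^ (-(δ * |(z : ℝ)|)) with hf
  have hgeo : Summable fun n : ℕ => ((2 : ℝ) ^ (-δ)) ^ n :=
    summable_geometric_of_lt_one (by positivity)
      (Real.rpow_lt_one_of_one_lt_of_neg one_lt_two (by linarith))
  have hnat : Summable fun n : ℕ => (2 : ℝ) ^ (-(δ * (n : ℝ))) := by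
    refine hgeo.congr fun n => ?_
    rw [← Real.rpow_natCast, ← Real.rpow_mul zero_le_two, neg_mul]
  have hs : Summable f := by
    refine Summable.of_nat_of_neg ?_ ?_
    · simpa [hf] using hnat
    · simpa [hf] using hnat
  refine ⟨∑' z, f z, ?_, fun n m => ?_⟩
  · exact hs.tsum_pos (fun z => by positivity) 0 (by positivity)
  · have hinj : Function.Injective fun j : ℕ => (j : ℤ) - m := fun a b h => by
      simp only at h; omega
    calc _ = ∑ z ∈ (Finset.range n).map ⟨fun j : ℕ => (j : ℤ) - m, hinj⟩, f z := by
          simp [hf]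
      _ ≤ _ := hs.sum_le_tsum _ fun z _ => by positivity

theorem latticeCost_le (i l : ℕ) : latticeCost i l ≤ 2 ^ i * (l + 5) := by
  unfold latticeCost
  rcases le_total i l with h | h
  · rw [min_eq_left h]
    exact Nat.mul_le_mul_left _ (by omega)
  · obtain ⟨e, rfl⟩ := Nat.exists_eq_add_of_le h
    rw [min_eq_right h, pow_add, mul_assoc]
    gcongr
    have : e < 2 ^ e := Nat.lt_two_pow_self
    have h1 : l + e - l + (l - (l + e)) + 4 = e + 4 := by omega
    rw [h1]
    nlinarith

theorem latticeCost_cast_le {i l : ℕ} {x y : ℝ} (hx : ((min i l : ℕ) : ℝ) ≤ x)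
    (hy : |(i : ℝ) - l| ≤ y) : (latticeCost i l : ℝ) ≤ 2 ^ x * (y + 4) := by
  have h1 : ((i - l + (l - i) : ℕ) : ℝ) = |(i : ℝ) - l| := by
    rcases le_total i l with h | h
    · rw [Nat.sub_eq_zero_of_le h, zero_add, Nat.cast_sub h, abs_sub_comm,
        abs_of_nonneg (by simpa using h)]
    · rw [Nat.sub_eq_zero_of_le h, add_zero, Nat.cast_sub h, abs_of_nonneg (by simpa using h)]
  unfold latticeCost
  rw [Nat.cast_mul, Nat.cast_add _ 4, h1, Nat.cast_pow, ← Real.rpow_natCast]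
  push_cast at hx ⊢
  gcongr
  · exact one_le_two

theorem chainRadius_le {K R u v : ℝ} {ε : ℕ → ℝ} (hK : 0 ≤ K) (hR : 0 ≤ R)
    (hv : 0 ≤ v) (hε : ∀ j : ℕ, ε j ≤ R * 2 ^ (-(u * j)) * ((j : ℝ) + 1) ^ v) (j : ℕ) :
    chainRadius K ε j ≤ (K + R * 2 ^ u) * 2 ^ (-(u * j)) * ((j : ℝ) + 1) ^ v := by
  cases j with
  | zero =>
    simp only [chainRadius, Nat.cast_zero, mul_zero, neg_zero, Real.rpow_zero, mul_one,
      zero_add, Real.one_rpow]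
    have : 0 ≤ R * 2 ^ u := by positivity
    linarith
  | succ j =>
    refine (hε j).trans ?_
    have e : (2 : ℝ) ^ (-(u * (j : ℝ))) = 2 ^ u * 2 ^ (-(u * ((j + 1 : ℕ) : ℝ))) := by
      rw [← Real.rpow_add zero_lt_two]; congr 1; push_cast; ring
    have h1 : ((j : ℝ) + 1) ^ v ≤ (((j + 1 : ℕ) : ℝ) + 1) ^ v := by
      gcongr; linarith
    calc _ = R * 2 ^ u * 2 ^ (-(u * ((j + 1 : ℕ) : ℝ))) * ((j : ℝ) + 1) ^ v := by rw [e]; ring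
      _ ≤ (K + R * 2 ^ u) * 2 ^ (-(u * ((j + 1 : ℕ) : ℝ))) * (((j + 1 : ℕ) : ℝ) + 1) ^ v := by
        gcongr
        linarith

/-- Passing from a bound along dyadic indices to a bound for all indices. -/
theorem exists_rate_of_dyadic {T Y : Type} [NormedAddCommGroup Y] [NormedSpace ℝ Y]
    (V : ellOne T →L[ℝ] Y) {u v C : ℝ} (hu : 0 ≤ u) (hC : 0 ≤ C) {A m₀ : ℕ} (hA : 1 ≤ A)
    (h : ∀ m ≥ m₀, entropyNumber (A * 2 ^ m + 1) V ≤
      C * (2 ^ (-(u * (m : ℝ))) * ((m : ℝ) + 1) ^ v)) :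
    ∃ c' > 0, ∀ n : ℕ, 2 ≤ n →
      entropyNumber n V ≤ c' * (n : ℝ) ^ (-u) * Real.log n ^ v := by
  have hlog2 : 0 < Real.log 2 := Real.log_pos one_lt_two
  have hlog21 : Real.log 2 ≤ 1 := Real.log_two_lt_d9.le.trans (by norm_num)
  have hA' : (1 : ℝ) ≤ A := by exact_mod_cast hA
  set a₁ := 2 / Real.log 2 with ha₁
  set a₂ := Real.log (2 * A) + 1 with ha₂
  have hlogA : 0 ≤ Real.log (2 * A) := Real.log_nonneg (by linarith)
  set target : ℕ → ℝ := fun n => (n : ℝ) ^ (-u) * Real.log n ^ v with htarget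
  have ht0 : ∀ n : ℕ, 0 ≤ target n := fun n =>
    mul_nonneg (by positivity) (Real.rpow_nonneg (Real.log_natCast_nonneg n) _)
  set B := C * (2 * A) ^ u * (a₁ ^ v + (a₂⁻¹) ^ v) with hB
  have hB0 : 0 ≤ B := by positivity
  set E := (‖V‖ + 1) * ∑ n ∈ Finset.range (A * 2 ^ m₀ + 1), (target n)⁻¹ with hE
  have hE0 : 0 ≤ E := by
    have := Finset.sum_nonneg fun n (_ : n ∈ Finset.range (A * 2 ^ m₀ + 1)) =>
      inv_nonneg.2 (ht0 n)
    positivity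
  refine ⟨B + E + 1, by positivity, fun n hn => ?_⟩
  rw [mul_assoc]
  change entropyNumber n V ≤ (B + E + 1) * target n
  have hn1 : (1 : ℝ) < n := by exact_mod_cast (by omega : 1 < n)
  have hlogn : 0 < Real.log n := Real.log_pos hn1
  have htn : 0 < target n := by
    have : 0 < (n : ℝ) := by linarith
    simp only [htarget]
    positivity
  rcases lt_or_ge n (A * 2 ^ m₀ + 1) with hsmall | hlarge
  · have h1 : (target n)⁻¹ ≤ ∑ n ∈ Finset.range (A * 2 ^ m₀ + 1), (target n)⁻¹ :=
      Finset.single_le_sum (f := fun n => (target n)⁻¹) (fun n _ => inv_nonneg.2 (ht0 n))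
        (Finset.mem_range.2 hsmall)
    calc entropyNumber n V ≤ ‖V‖ + 1 := entropyNumber_le_norm V n
      _ = (‖V‖ + 1) * (target n)⁻¹ * target n := by field_simp
      _ ≤ E * target n := by
        rw [hE]; gcongr
      _ ≤ _ := by gcongr; linarith
  · set m := Nat.log 2 ((n - 1) / A) with hm
    have hdiv : 2 ^ m₀ ≤ (n - 1) / A := by
      rw [Nat.le_div_iff_mul_le hA, mul_comm]; omega
    have hdiv0 : (n - 1) / A ≠ 0 := by
      have : 0 < 2 ^ m₀ := by positivity
      omega
    have hmm : m₀ ≤ m := (Nat.le_log_iff_pow_le (by norm_num) hdiv0).2 hdiv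
    have hlow : A * 2 ^ m + 1 ≤ n := by
      have := Nat.pow_log_le_self 2 hdiv0
      rw [Nat.le_div_iff_mul_le hA, mul_comm, ← hm] at this
      omega
    have hup : n ≤ 2 * A * 2 ^ m := by
      have := Nat.lt_pow_succ_log_self (b := 2) (by norm_num) ((n - 1) / A)
      rw [Nat.div_lt_iff_lt_mul hA, ← hm, pow_succ] at this
      have e : 2 * A * 2 ^ m = 2 ^ m * 2 * A := by ring
      omega
    have hup' : (n : ℝ) ≤ 2 * A * 2 ^ (m : ℝ) := by
      rw [Real.rpow_natCast]; exact_mod_cast hup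
    have hlow' : (2 : ℝ) ^ (m : ℝ) ≤ n := by
      rw [Real.rpow_natCast]
      have : 2 ^ m ≤ n := by nlinarith [Nat.one_le_two_pow (n := m)]
      exact_mod_cast this
    have hl1 : (m : ℝ) + 1 ≤ a₁ * Real.log n := by
      have e1 : (m : ℝ) * Real.log 2 ≤ Real.log n := by
        rw [← Real.log_rpow zero_lt_two]
        exact Real.log_le_log (by positivity) hlow'
      have e2 : Real.log 2 ≤ Real.log n :=
        Real.log_le_log zero_lt_two (by exact_mod_cast hn)
      rw [ha₁, div_mul_eq_mul_div, le_div_iff₀ hlog2]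
      linarith
    have hl2 : a₂⁻¹ * Real.log n ≤ (m : ℝ) + 1 := by
      rw [inv_mul_le_iff₀ (by linarith)]
      have e1 : Real.log n ≤ Real.log (2 * A) + m * Real.log 2 := by
        rw [← Real.log_rpow zero_lt_two, ← Real.log_mul (by positivity) (by positivity)]
        exact Real.log_le_log (by linarith) hup'
      rw [ha₂]
      have hm0 : (0 : ℝ) ≤ m := by positivity
      nlinarith [mul_nonneg hlogA hm0]
    have hpow : ((m : ℝ) + 1) ^ v ≤ (a₁ ^ v + (a₂⁻¹) ^ v) * Real.log n ^ v := by
      have p1 : 0 ≤ a₁ ^ v * Real.log n ^ v := by positivity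
      have p2 : 0 ≤ (a₂⁻¹) ^ v * Real.log n ^ v := by positivity
      rw [add_mul]
      rcases le_total 0 v with hv | hv
      · have : ((m : ℝ) + 1) ^ v ≤ (a₁ * Real.log n) ^ v := by gcongr
        rw [Real.mul_rpow (by positivity) hlogn.le] at this
        linarith
      · have : ((m : ℝ) + 1) ^ v ≤ (a₂⁻¹ * Real.log n) ^ v :=
          Real.rpow_le_rpow_of_nonpos (by positivity) hl2 hv
        rw [Real.mul_rpow (by positivity) hlogn.le] at this
        linarith
    have hpow2 : (2 : ℝ) ^ (-(u * (m : ℝ))) ≤ (2 * A) ^ u * (n : ℝ) ^ (-u) := by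
      have h1 : ((n : ℝ)) ^ u ≤ (2 * A * 2 ^ (m : ℝ)) ^ u := by gcongr
      rw [Real.mul_rpow (by positivity) (by positivity), ← Real.rpow_mul zero_le_two] at h1
      have hnu : 0 < (n : ℝ) ^ u := by positivity
      rw [Real.rpow_neg zero_le_two, Real.rpow_neg (by linarith), mul_comm u, ← div_eq_mul_inv,
        le_div_iff₀ hnu, inv_mul_le_iff₀ (by positivity), mul_comm ((2 : ℝ) ^ _)]
      exact h1
    calc entropyNumber n V ≤ entropyNumber (A * 2 ^ m + 1) V := entropyNumber_anti V hlow
      _ ≤ C * (2 ^ (-(u * (m : ℝ))) * ((m : ℝ) + 1) ^ v) := h m hmm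
      _ ≤ C * (((2 * A) ^ u * (n : ℝ) ^ (-u)) *
            ((a₁ ^ v + (a₂⁻¹) ^ v) * Real.log n ^ v)) := by gcongr
      _ = B * target n := by rw [hB, htarget]; ring
      _ ≤ _ := by gcongr; linarith

/-- Summing the contributions of all levels of a chain. -/
theorem entropyNumber_le_of_levels {T Y : Type} [NormedAddCommGroup Y] [NormedSpace ℝ Y]
    {p C : ℝ} (hp : 0 < p) (hC : 0 ≤ C) (hY : PowerSmooth Y p C)
    (V : ellOne T →L[ℝ] Y) {S : ℕ → Finset T} {ε : ℕ → ℝ}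
    (hε : ∀ j, 0 ≤ ε j) {l : ℕ → ℕ} (hl : ∀ j, (S j).card ≤ 2 ^ l j)
    (hnet : ∀ j s, ∃ t ∈ S j, ∃ c : ℝ, 0 ≤ c ∧ c ≤ 1 ∧
      ‖V (unitVec s) - c • V (unitVec t)‖ ≤ ε j) (i : ℕ → ℕ) (J m A : ℕ)
    {c₁ c₂ c₃ G₁ G₂ X : ℝ} (hc₁ : 0 ≤ c₁) (hc₂ : 0 ≤ c₂) (hX : 0 ≤ X) {w₁ w₂ : ℕ → ℝ}
    (hcost : ∀ j ≤ J, (latticeCost (i j) (l j) : ℝ) ≤ c₁ * 2 ^ (m : ℝ) * w₁ j)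
    (herr : ∀ j ≤ J, chainRadius ‖V‖ ε j * 2 ^ (-((1 - 1 / p) * (i j : ℝ))) ≤ c₂ * X * w₂ j)
    (hJ : ε J ≤ c₃ * X) (hw₁ : ∑ j ∈ Finset.range (J + 1), w₁ j ≤ G₁)
    (hw₂ : ∑ j ∈ Finset.range (J + 1), w₂ j ≤ G₂) (hA : c₁ * G₁ ≤ A) :
    entropyNumber (A * 2 ^ m + 1) V ≤ (2 * C ^ (1 / p) * c₂ * G₂ + c₃) * X := by
  have hle : ∑ j ∈ Finset.range (J + 1), latticeCost (i j) (l j) ≤ A * 2 ^ m := by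
    have : ((∑ j ∈ Finset.range (J + 1), latticeCost (i j) (l j) : ℕ) : ℝ) ≤
        A * 2 ^ (m : ℝ) := by
      push_cast
      calc _ ≤ ∑ j ∈ Finset.range (J + 1), c₁ * 2 ^ (m : ℝ) * w₁ j :=
            Finset.sum_le_sum fun j hj => hcost j (Nat.lt_succ_iff.1 (Finset.mem_range.1 hj))
        _ = c₁ * 2 ^ (m : ℝ) * ∑ j ∈ Finset.range (J + 1), w₁ j := by rw [Finset.mul_sum]
        _ ≤ c₁ * 2 ^ (m : ℝ) * G₁ := by gcongr
        _ = (c₁ * G₁) * 2 ^ (m : ℝ) := by ring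
        _ ≤ _ := by gcongr
    rw [Real.rpow_natCast] at this
    exact_mod_cast this
  refine (entropyNumber_anti V (Nat.succ_le_succ hle)).trans ?_
  refine (entropyNumber_le_chain hp hC hY V hε hl hnet i J).trans ?_
  have hC' : 0 ≤ 2 * C ^ (1 / p) := by positivity
  calc _ ≤ ∑ j ∈ Finset.range (J + 1), 2 * C ^ (1 / p) * (c₂ * X * w₂ j) + c₃ * X := by
        refine add_le_add (Finset.sum_le_sum fun j hj => ?_) hJ
        rw [mul_assoc _ (chainRadius _ _ _)]
        exact mul_le_mul_of_nonneg_left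
          (herr j (Nat.lt_succ_iff.1 (Finset.mem_range.1 hj))) hC'
    _ = 2 * C ^ (1 / p) * (c₂ * X) * ∑ j ∈ Finset.range (J + 1), w₂ j + c₃ * X := by
        rw [Finset.mul_sum]
        congr 1
        exact Finset.sum_congr rfl fun j _ => by ring
    _ ≤ 2 * C ^ (1 / p) * (c₂ * X) * G₂ + c₃ * X := by gcongr
    _ = _ := by ring

/-! ### Rates of decay from the growth of nets -/

/-- The scale at which level `j` is discretised when nets grow polynomially. -/
def levelIndex (κ h m j : ℕ) : ℕ := if j ≤ m then j + κ * (m - j) else m - (j - m) / h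

theorem levelIndex_estimates {κ h m j : ℕ} (D : ℕ) {u β δ : ℝ} (hu : 0 < u)
    (hκ : β + u + 1 ≤ β * κ) (hh : 1 ≤ h) (hhβ : β ≤ h * (u / 2)) (hδ1 : δ ≤ 1)
    (hδu : δ ≤ u / 2) (hj : j ≤ m + h * m) :
    ((min (levelIndex κ h m j) (j + D) : ℕ) : ℝ) ≤ m + D + 1 - |(j : ℝ) - m| / h ∧
    |((levelIndex κ h m j : ℕ) : ℝ) - ((j + D : ℕ) : ℝ)| ≤ (κ + 2) * |(j : ℝ) - m| + D ∧
    (u + β) * m + δ * |(j : ℝ) - m| ≤ u * j + β * (levelIndex κ h m j : ℕ) := by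
  have hh' : (1 : ℝ) ≤ h := by exact_mod_cast hh
  have hD : (0 : ℝ) ≤ D := by positivity
  rcases le_or_gt j m with hjm | hjm
  · obtain ⟨d, rfl⟩ := Nat.exists_eq_add_of_le hjm
    have hi : levelIndex κ h (j + d) j = j + κ * d := by simp [levelIndex]
    have hd : |(j : ℝ) - (j + d : ℕ)| = d := by
      push_cast; rw [sub_add_cancel_left, abs_neg, Nat.abs_cast]
    have hd0 : (0 : ℝ) ≤ d := by positivity
    rw [hi, hd]
    refine ⟨?_, ?_, ?_⟩
    · have h1 : ((min (j + κ * d) (j + D) : ℕ) : ℝ) ≤ (j + D : ℕ) := by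
        exact_mod_cast min_le_right _ _
      have h2 : (d : ℝ) / h ≤ d := div_le_self hd0 hh'
      push_cast at h1 ⊢
      linarith
    · push_cast
      rw [abs_le]
      constructor <;> nlinarith [mul_nonneg (Nat.cast_nonneg (α := ℝ) κ) hd0]
    · push_cast
      nlinarith [mul_le_mul_of_nonneg_right hκ hd0, mul_le_mul_of_nonneg_right hδ1 hd0]
  · obtain ⟨d, rfl⟩ := Nat.exists_eq_add_of_le hjm.le
    have hd : |((m + d : ℕ) : ℝ) - m| = d := by
      push_cast; rw [add_sub_cancel_left, Nat.abs_cast]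
    have hd0 : (0 : ℝ) ≤ d := by positivity
    have hdm : d / h ≤ m := Nat.div_le_of_le_mul (by omega)
    have hi : levelIndex κ h m (m + d) = m - d / h := by
      simp only [levelIndex, add_tsub_cancel_left]
      rw [if_neg (by omega)]
    have hf1 : ((d / h : ℕ) : ℝ) ≤ d / h := Nat.cast_div_le
    have hf2 : (d : ℝ) / h ≤ (d / h : ℕ) + 1 := by
      rw [div_le_iff₀ (by linarith)]
      have := Nat.lt_mul_div_succ d (by omega : 0 < h)
      have h3 : (d : ℝ) ≤ h * ((d / h : ℕ) + 1) := by exact_mod_cast this.le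
      linarith
    have h2 : (d : ℝ) / h ≤ d := div_le_self hd0 hh'
    have hf0 : (0 : ℝ) ≤ (d / h : ℕ) := by positivity
    rw [hi, hd]
    refine ⟨?_, ?_, ?_⟩
    · have h1 : ((min (m - d / h) (m + d + D) : ℕ) : ℝ) ≤ (m - d / h : ℕ) := by
        exact_mod_cast min_le_left _ _
      rw [Nat.cast_sub hdm] at h1
      linarith
    · rw [Nat.cast_sub hdm]
      push_cast
      rw [abs_le]
      constructor <;> nlinarith [mul_nonneg (Nat.cast_nonneg (α := ℝ) κ) hd0]
    · rw [Nat.cast_sub hdm]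
      push_cast
      have h4 : β * (d / h : ℕ) ≤ u / 2 * d := by
        calc β * (d / h : ℕ) ≤ (h * (u / 2)) * (d / h) := by gcongr
          _ = u / 2 * d := by field_simp
      nlinarith [mul_le_mul_of_nonneg_right hδu hd0]

section Rates

variable {T Y : Type} [NormedAddCommGroup Y] [NormedSpace ℝ Y]

theorem exists_rate_of_polynomial_nets {p C : ℝ} (hp : 1 < p) (hC : 0 ≤ C)
    (hY : PowerSmooth Y p C) (V : ellOne T →L[ℝ] Y) {S : ℕ → Finset T} {ε : ℕ → ℝ}
    {R u v : ℝ} {D : ℕ} (hR : 0 ≤ R) (hu : 0 < u) (hv : 0 ≤ v) (hε : ∀ j, 0 ≤ ε j)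
    (hεR : ∀ j : ℕ, ε j ≤ R * 2 ^ (-(u * j)) * ((j : ℝ) + 1) ^ v)
    (hcard : ∀ j, (S j).card ≤ 2 ^ (j + D))
    (hnet : ∀ j s, ∃ t ∈ S j, ∃ c : ℝ, 0 ≤ c ∧ c ≤ 1 ∧
      ‖V (unitVec s) - c • V (unitVec t)‖ ≤ ε j) :
    ∃ c' > 0, ∀ n : ℕ, 2 ≤ n →
      entropyNumber n V ≤ c' * (n : ℝ) ^ (-(u + (1 - 1 / p))) * Real.log n ^ v := by
  set β := 1 - 1 / p with hβdef
  have hβ : 0 < β := by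
    have : 1 / p < 1 := by rw [div_lt_one (by linarith)]; exact hp
    linarith
  obtain ⟨κ, hκ'⟩ := exists_nat_ge ((β + u + 1) / β)
  have hκ : β + u + 1 ≤ β * κ := by rw [div_le_iff₀ hβ] at hκ'; linarith
  obtain ⟨h₀, hh₀⟩ := exists_nat_ge (β / (u / 2))
  set h := h₀ + 1 with hh
  have hhβ : β ≤ h * (u / 2) := by
    rw [div_le_iff₀ (by linarith)] at hh₀
    rw [hh]; push_cast; linarith
  have hh1 : 1 ≤ h := by omega
  have hhpos : (0 : ℝ) < h := by exact_mod_cast hh1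
  set δ := min 1 (u / 2) with hδ
  have hδ0 : 0 < δ := lt_min one_pos (by linarith)
  set η : ℝ := 1 / (2 * h) with hη
  have hη0 : 0 < η := by positivity
  obtain ⟨cv, hcv, hcv'⟩ := exists_add_one_rpow_le v (half_pos hδ0)
  obtain ⟨c₀, hc₀, hc₀'⟩ := exists_add_one_rpow_le 1 hη0
  obtain ⟨G₁, hG₁, hG₁'⟩ := exists_sum_two_rpow_le hη0
  obtain ⟨G₂, hG₂, hG₂'⟩ := exists_sum_two_rpow_le (half_pos hδ0)
  set c₁ : ℝ := 2 ^ ((D : ℝ) + 1) * (κ + D + 6) * c₀ with hc₁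
  set R' : ℝ := ‖V‖ + R * 2 ^ u with hR'
  have hR'0 : 0 ≤ R' := by positivity
  set A := ⌈c₁ * G₁⌉₊ + 1 with hA
  have hA' : c₁ * G₁ ≤ A := (Nat.le_ceil _).trans (by rw [hA]; push_cast; linarith)
  refine exists_rate_of_dyadic (C := 2 * C ^ (1 / p) * (R' * cv) * G₂ + R * cv) (A := A)
    (m₀ := 0) V (by positivity) (by positivity) (by omega) fun m _ => ?_
  set X : ℝ := 2 ^ (-((u + β) * (m : ℝ))) * ((m : ℝ) + 1) ^ v with hX
  have hX0 : 0 ≤ X := by positivity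
  have hdecay : ∀ j ≤ m + h * m,
      (2 : ℝ) ^ (-(u * j)) * ((j : ℝ) + 1) ^ v * 2 ^ (-(β * (levelIndex κ h m j : ℕ))) ≤
        cv * X * 2 ^ (-(δ / 2 * |(j : ℝ) - m|)) := by
    intro j hj
    obtain ⟨-, -, h3⟩ := levelIndex_estimates D hu hκ hh1 hhβ (min_le_left _ _)
      (min_le_right 1 (u / 2)) hj
    rw [← hδ] at h3
    set d := |(j : ℝ) - m| with hd
    have hd0 : 0 ≤ d := abs_nonneg _
    have hjd : (j : ℝ) + 1 ≤ (m + 1) * (d + 1) := by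
      have : (j : ℝ) - m ≤ d := le_abs_self _
      nlinarith [mul_nonneg (Nat.cast_nonneg (α := ℝ) m) hd0]
    calc _ = (2 : ℝ) ^ (-(u * j + β * (levelIndex κ h m j : ℕ))) * ((j : ℝ) + 1) ^ v := by
          rw [neg_add, Real.rpow_add zero_lt_two]; ring
      _ ≤ 2 ^ (-((u + β) * m + δ * d)) * ((m + 1) * (d + 1)) ^ v := by
          gcongr
          exact one_le_two
      _ = X * 2 ^ (-(δ * d)) * (d + 1) ^ v := by
          rw [Real.mul_rpow (by positivity) (by positivity), neg_add,
            Real.rpow_add zero_lt_two, hX]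
          ring
      _ ≤ X * 2 ^ (-(δ * d)) * (cv * 2 ^ (δ / 2 * d)) := by
          gcongr
          exact hcv' d hd0
      _ = cv * X * (2 ^ (-(δ * d)) * 2 ^ (δ / 2 * d)) := by ring
      _ = cv * X * 2 ^ (-(δ / 2 * d)) := by
          rw [← Real.rpow_add zero_lt_two]; ring_nf
  refine entropyNumber_le_of_levels (by linarith) hC hY V hε hcard hnet (levelIndex κ h m)
    (m + h * m) m A (c₁ := c₁) (by positivity) (by positivity) hX0
    (w₁ := fun j => 2 ^ (-(η * |(j : ℝ) - m|)))
    (w₂ := fun j => 2 ^ (-(δ / 2 * |(j : ℝ) - m|))) (fun j hj => ?_) (fun j hj => ?_) ?_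
    (hG₁' _ _) (hG₂' _ _) hA'
  · obtain ⟨h1, h2, -⟩ := levelIndex_estimates D hu hκ hh1 hhβ (min_le_left _ _)
      (min_le_right 1 (u / 2)) hj
    refine (latticeCost_cast_le h1 h2).trans ?_
    set d := |(j : ℝ) - m| with hd
    have hd0 : 0 ≤ d := abs_nonneg _
    have h3 := hc₀' d hd0
    rw [Real.rpow_one] at h3
    have h4 : (κ + 2) * d + D + 4 ≤ (κ + D + 6) * (d + 1) := by
      nlinarith [mul_nonneg (Nat.cast_nonneg (α := ℝ) D) hd0, Nat.cast_nonneg (α := ℝ) κ]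
    calc _ ≤ (2 : ℝ) ^ ((m : ℝ) + D + 1 - d / h) * ((κ + D + 6) * (c₀ * 2 ^ (η * d))) := by
          gcongr
          exact h4.trans (by gcongr)
      _ = (κ + D + 6) * c₀ * (2 ^ ((m : ℝ) + D + 1 - d / h) * 2 ^ (η * d)) := by ring
      _ = (κ + D + 6) * c₀ * (2 ^ ((D : ℝ) + 1) * 2 ^ (m : ℝ) * 2 ^ (-(η * d))) := by
          rw [← Real.rpow_add zero_lt_two, ← Real.rpow_add zero_lt_two,
            ← Real.rpow_add zero_lt_two]
          congr 2
          rw [hη]; field_simp; ring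
      _ = _ := by rw [hc₁]; ring
  · calc _ ≤ R' * 2 ^ (-(u * j)) * ((j : ℝ) + 1) ^ v *
          2 ^ (-(β * (levelIndex κ h m j : ℕ))) := by
          gcongr
          exact chainRadius_le (norm_nonneg _) hR hv hεR j
      _ = R' * (2 ^ (-(u * j)) * ((j : ℝ) + 1) ^ v *
          2 ^ (-(β * (levelIndex κ h m j : ℕ)))) := by ring
      _ ≤ R' * (cv * X * 2 ^ (-(δ / 2 * |(j : ℝ) - m|))) :=
          mul_le_mul_of_nonneg_left (hdecay j hj) hR'0
      _ = _ := by ring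
  · have hi : levelIndex κ h m (m + h * m) = 0 := by
      unfold levelIndex
      rcases Nat.eq_zero_or_pos m with rfl | hm
      · simp
      · have : 0 < h * m := by positivity
        rw [if_neg (by omega), add_tsub_cancel_left, Nat.mul_div_cancel_left _ hh1, Nat.sub_self]
    have h1 := hdecay (m + h * m) le_rfl
    rw [hi, Nat.cast_zero, mul_zero, neg_zero, Real.rpow_zero, mul_one] at h1
    have h2 : (2 : ℝ) ^ (-(δ / 2 * |((m + h * m : ℕ) : ℝ) - m|)) ≤ 1 :=
      Real.rpow_le_one_of_one_le_of_nonpos one_le_two (by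
        have : 0 ≤ δ / 2 * |((m + h * m : ℕ) : ℝ) - m| := by positivity
        linarith)
    calc _ ≤ R * 2 ^ (-(u * (m + h * m : ℕ))) * (((m + h * m : ℕ) : ℝ) + 1) ^ v := hεR _
      _ = R * (2 ^ (-(u * (m + h * m : ℕ))) * (((m + h * m : ℕ) : ℝ) + 1) ^ v) := by ring
      _ ≤ R * (cv * X * 1) :=
          mul_le_mul_of_nonneg_left (h1.trans (by gcongr)) hR
      _ = _ := by ring

theorem exists_rate_of_exponential_nets_of_lt {p C : ℝ} (hp : 1 < p) (hC : 0 ≤ C)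
    (hY : PowerSmooth Y p C) (V : ellOne T →L[ℝ] Y) {S : ℕ → Finset T} {ε : ℕ → ℝ}
    {R u : ℝ} {D : ℕ} (hR : 0 ≤ R) (hu : 0 < u) (hup : u < 1 - 1 / p) (hε : ∀ j, 0 ≤ ε j)
    (hεR : ∀ j : ℕ, ε j ≤ R * 2 ^ (-(u * j))) (hcard : ∀ j, (S j).card ≤ 2 ^ (D * 2 ^ j))
    (hnet : ∀ j s, ∃ t ∈ S j, ∃ c : ℝ, 0 ≤ c ∧ c ≤ 1 ∧
      ‖V (unitVec s) - c • V (unitVec t)‖ ≤ ε j) :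
    ∃ c' > 0, ∀ n : ℕ, 2 ≤ n → entropyNumber n V ≤ c' * (n : ℝ) ^ (-u) := by
  set β := 1 - 1 / p with hβdef
  have hβ : 0 < β := hu.trans hup
  set θ := (u / β + 1) / 2 with hθ
  have huβ : u / β < 1 := by rwa [div_lt_one hβ]
  have hθ0 : 0 < θ := by positivity
  have hθ1 : 0 < 1 - θ := by rw [hθ]; linarith
  have hβθ : β * θ = u + (β - u) / 2 := by rw [hθ]; field_simp; ring
  set δ := (β - u) / 2 with hδ
  have hδ0 : 0 < δ := by rw [hδ]; linarith
  obtain ⟨G₁, hG₁, hG₁'⟩ := exists_sum_two_rpow_le hθ1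
  obtain ⟨G₂, hG₂, hG₂'⟩ := exists_sum_two_rpow_le hδ0
  set c₁ : ℝ := 2 * (D + 5) with hc₁
  set R' : ℝ := ‖V‖ + R * 2 ^ u with hR'
  have hR'0 : 0 ≤ R' := by positivity
  set A := ⌈c₁ * G₁⌉₊ + 1 with hA
  have hA' : c₁ * G₁ ≤ A := (Nat.le_ceil _).trans (by rw [hA]; push_cast; linarith)
  suffices H : ∃ c' > 0, ∀ n : ℕ, 2 ≤ n →
      entropyNumber n V ≤ c' * (n : ℝ) ^ (-u) * Real.log n ^ (0 : ℝ) by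
    simpa using H
  refine exists_rate_of_dyadic (C := 2 * C ^ (1 / p) * R' * G₂ + R) (A := A)
    (m₀ := 0) V hu.le (by positivity) (by omega) fun m _ => ?_
  rw [Real.rpow_zero, mul_one]
  set X : ℝ := 2 ^ (-(u * (m : ℝ))) with hX
  have hX0 : 0 ≤ X := by positivity
  refine entropyNumber_le_of_levels (by linarith) hC hY V hε hcard hnet
    (fun j => ⌈θ * ((m : ℝ) - j)⌉₊) m m A (c₁ := c₁) (by positivity) hR'0 hX0
    (w₁ := fun j => 2 ^ (-((1 - θ) * |(j : ℝ) - m|)))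
    (w₂ := fun j => 2 ^ (-(δ * |(j : ℝ) - m|))) (fun j hj => ?_) (fun j hj => ?_) (hεR m)
    (hG₁' _ _) (hG₂' _ _) hA'
  all_goals
    have hjm : (j : ℝ) ≤ m := by exact_mod_cast hj
    have hd : |(j : ℝ) - m| = m - j := by rw [abs_sub_comm, abs_of_nonneg (by linarith)]
    have hx0 : 0 ≤ θ * ((m : ℝ) - j) := mul_nonneg hθ0.le (by linarith)
    simp only [hd]
  · have h1 : (latticeCost ⌈θ * ((m : ℝ) - j)⌉₊ (D * 2 ^ j) : ℝ) ≤
        2 ^ (⌈θ * ((m : ℝ) - j)⌉₊ : ℝ) * (D * 2 ^ (j : ℝ) + 5) := by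
      rw [Real.rpow_natCast, Real.rpow_natCast]
      exact_mod_cast latticeCost_le _ _
    have h2 : (1 : ℝ) ≤ 2 ^ (j : ℝ) := Real.one_le_rpow one_le_two (by positivity)
    calc _ ≤ _ := h1
      _ ≤ 2 ^ (θ * ((m : ℝ) - j) + 1) * ((D + 5) * 2 ^ (j : ℝ)) := by
          gcongr
          · exact one_le_two
          · exact (Nat.ceil_lt_add_one hx0).le
          · linarith
      _ = (D + 5) * (2 ^ (θ * ((m : ℝ) - j) + 1) * 2 ^ (j : ℝ)) := by ring
      _ = (D + 5) * (2 * 2 ^ (m : ℝ) * 2 ^ (-((1 - θ) * ((m : ℝ) - j)))) := by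
          rw [← Real.rpow_add zero_lt_two]
          nth_rw 2 [← Real.rpow_one 2]
          rw [← Real.rpow_add zero_lt_two, ← Real.rpow_add zero_lt_two]
          congr 2
          ring
      _ = _ := by rw [hc₁]; ring
  · have h1 : chainRadius ‖V‖ ε j ≤ R' * 2 ^ (-(u * j)) := by
      simpa using chainRadius_le (v := 0) (norm_nonneg V) hR le_rfl (by simpa using hεR) j
    calc _ ≤ R' * 2 ^ (-(u * j)) * 2 ^ (-(β * (θ * ((m : ℝ) - j)))) := by
          gcongr
          · exact one_le_two
          · exact Nat.le_ceil _
      _ = R' * (2 ^ (-(u * j)) * 2 ^ (-(β * (θ * ((m : ℝ) - j))))) := by ring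
      _ = R' * (X * 2 ^ (-(δ * ((m : ℝ) - j)))) := by
          rw [hX, ← Real.rpow_add zero_lt_two, ← Real.rpow_add zero_lt_two]
          congr 2
          rw [← mul_assoc, hβθ]
          ring
      _ = _ := by ring

theorem exists_rate_of_exponential_nets_of_gt {p C : ℝ} (hp : 1 < p) (hC : 0 ≤ C)
    (hY : PowerSmooth Y p C) (V : ellOne T →L[ℝ] Y) {S : ℕ → Finset T} {ε : ℕ → ℝ}
    {R u : ℝ} {D : ℕ} (hR : 0 ≤ R) (hD : 1 ≤ D) (hup : 1 - 1 / p < u) (hε : ∀ j, 0 ≤ ε j)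
    (hεR : ∀ j : ℕ, ε j ≤ R * 2 ^ (-(u * j))) (hcard : ∀ j, (S j).card ≤ 2 ^ (D * 2 ^ j))
    (hnet : ∀ j s, ∃ t ∈ S j, ∃ c : ℝ, 0 ≤ c ∧ c ≤ 1 ∧
      ‖V (unitVec s) - c • V (unitVec t)‖ ≤ ε j) :
    ∃ c' > 0, ∀ n : ℕ, 2 ≤ n →
      entropyNumber n V ≤ c' * (n : ℝ) ^ (-(1 - 1 / p)) * Real.log n ^ (1 - 1 / p - u) := by
  set β := 1 - 1 / p with hβdef
  have hβ : 0 < β := by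
    have : 1 / p < 1 := by rw [div_lt_one (by linarith)]; exact hp
    linarith
  set γ := u - β with hγ
  have hγ0 : 0 < γ := by rw [hγ]; linarith
  set θ := γ / (2 * β) with hθ
  have hθ0 : 0 < θ := by positivity
  have hβθ : β * θ = γ / 2 := by rw [hθ]; field_simp
  obtain ⟨c₀, hc₀, hc₀'⟩ := exists_add_one_rpow_le 1 (half_pos one_pos)
  obtain ⟨cγ, hcγ, hcγ'⟩ := exists_add_one_rpow_le γ hβ
  obtain ⟨G, hG, hG'⟩ := exists_sum_two_rpow_le hθ0
  obtain ⟨G', hG0', hG''⟩ := exists_sum_two_rpow_le one_pos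
  obtain ⟨G₂, hG₂, hG₂'⟩ := exists_sum_two_rpow_le (half_pos hγ0)
  set c₁ : ℝ := 4 * c₀ + 2 * (D + 5) with hc₁
  set c₂ : ℝ := ‖V‖ * cγ + R * 2 ^ u * (4 * D) ^ γ with hc₂
  have hc₂0 : 0 ≤ c₂ := by positivity
  set A := ⌈c₁ * (G + G')⌉₊ + 1 with hA
  have hA' : c₁ * (G + G') ≤ A := (Nat.le_ceil _).trans (by rw [hA]; push_cast; linarith)
  refine exists_rate_of_dyadic (C := 2 * C ^ (1 / p) * c₂ * G₂ + R * (4 * D) ^ γ) (A := A)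
    (m₀ := 2 * D) V hβ.le (by positivity) (by omega) fun m hm => ?_
  have hγ' : β - u = -γ := by rw [hγ]; ring
  rw [hγ']
  set X : ℝ := 2 ^ (-(β * (m : ℝ))) * ((m : ℝ) + 1) ^ (-γ) with hX
  have hX0 : 0 ≤ X := by positivity
  set k₀ := Nat.log 2 (m / (2 * D)) with hk₀
  have hdiv0 : m / (2 * D) ≠ 0 := (Nat.div_pos hm (by omega)).ne'
  have hlow : 2 * D * 2 ^ k₀ ≤ m := by
    have := Nat.pow_log_le_self 2 hdiv0
    rwa [Nat.le_div_iff_mul_le (by omega), mul_comm, ← hk₀] at this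
  have hhigh : m + 1 ≤ 4 * D * 2 ^ k₀ := by
    have := Nat.lt_pow_succ_log_self (b := 2) (by norm_num) (m / (2 * D))
    rw [Nat.div_lt_iff_lt_mul (by omega), ← hk₀, pow_succ] at this
    have e : 4 * D * 2 ^ k₀ = 2 ^ k₀ * 2 * (2 * D) := by ring
    omega
  have hk₀m : k₀ ≤ m := by
    have h1 : k₀ < 2 ^ k₀ := Nat.lt_two_pow_self
    nlinarith
  have hk₀γ : (2 : ℝ) ^ (-(γ * k₀)) ≤ (4 * D) ^ γ * ((m : ℝ) + 1) ^ (-γ) := by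
    have h1 : ((m : ℝ) + 1) ≤ 4 * D * 2 ^ (k₀ : ℝ) := by
      rw [Real.rpow_natCast]; exact_mod_cast hhigh
    have h2 : ((m : ℝ) + 1) ^ γ ≤ (4 * D * 2 ^ (k₀ : ℝ)) ^ γ := by gcongr
    rw [Real.mul_rpow (by positivity) (by positivity), ← Real.rpow_mul zero_le_two] at h2
    rw [Real.rpow_neg zero_le_two, Real.rpow_neg (by positivity), mul_comm γ, ← div_eq_mul_inv,
      le_div_iff₀ (by positivity), inv_mul_le_iff₀ (by positivity), mul_comm ((2 : ℝ) ^ _)]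
    exact h2
  set x : ℕ → ℝ := fun k => (m : ℝ) - (k₀ + k) - θ * k with hx
  refine entropyNumber_le_of_levels (by linarith) hC hY V (S := fun k => S (k₀ + k))
    (ε := fun k => ε (k₀ + k)) (l := fun k => D * 2 ^ (k₀ + k)) (fun k => hε _)
    (fun k => hcard _) (fun k => hnet _) (fun k => if k = 0 then 2 * m else ⌈x k⌉₊) (m - k₀) m A
    (c₁ := c₁) (by positivity) hc₂0 hX0
    (w₁ := fun k => 2 ^ (-(θ * |(k : ℝ) - (0 : ℕ)|)) +
      2 ^ (-(1 * |(k : ℝ) - (m - k₀ : ℕ)|)))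
    (w₂ := fun k => 2 ^ (-(γ / 2 * |(k : ℝ) - (0 : ℕ)|)))
    (fun k hk => ?_) (fun k hk => ?_) ?_ ?_ (hG₂' _ _) hA'
  · rcases Nat.eq_zero_or_pos k with rfl | hk0
    · simp only [if_true, add_zero]
      have hlm : ((D * 2 ^ k₀ : ℕ) : ℝ) ≤ 1 / 2 * m := by
        have h1 : ((2 * D * 2 ^ k₀ : ℕ) : ℝ) ≤ m := by exact_mod_cast hlow
        push_cast at h1 ⊢
        linarith
      have h1 : ((min (2 * m) (D * 2 ^ k₀) : ℕ) : ℝ) ≤ 1 / 2 * m :=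
        le_trans (by exact_mod_cast min_le_right _ _) hlm
      have h2 : |((2 * m : ℕ) : ℝ) - (D * 2 ^ k₀ : ℕ)| ≤ 2 * m := by
        have h0 : (0 : ℝ) ≤ (D * 2 ^ k₀ : ℕ) := by positivity
        rw [abs_le]
        constructor <;> push_cast at h0 hlm ⊢ <;> linarith
      have h3 := hc₀' m (by positivity)
      rw [Real.rpow_one] at h3
      have hw : (1 : ℝ) ≤ 2 ^ (-(θ * |((0 : ℕ) : ℝ) - (0 : ℕ)|)) +
          2 ^ (-(1 * |((0 : ℕ) : ℝ) - (m - k₀ : ℕ)|)) := by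
        simp
      calc _ ≤ (2 : ℝ) ^ (1 / 2 * (m : ℝ)) * (2 * m + 4) := latticeCost_cast_le h1 h2
        _ ≤ 2 ^ (1 / 2 * (m : ℝ)) * (4 * (c₀ * 2 ^ (1 / 2 * (m : ℝ)))) := by
            gcongr
            linarith [Nat.cast_nonneg (α := ℝ) m]
        _ = 4 * c₀ * (2 ^ (1 / 2 * (m : ℝ)) * 2 ^ (1 / 2 * (m : ℝ))) := by ring
        _ = 4 * c₀ * 2 ^ (m : ℝ) * 1 := by
            rw [← Real.rpow_add zero_lt_two]; ring_nf
        _ ≤ _ := by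
            gcongr
            rw [hc₁]
            have : (0 : ℝ) ≤ 2 * (D + 5) := by positivity
            linarith
    · simp only [if_neg hk0.ne']
      have hkJ : |(k : ℝ) - (m - k₀ : ℕ)| = m - k₀ - k := by
        have : (k : ℝ) ≤ (m - k₀ : ℕ) := by exact_mod_cast hk
        rw [abs_sub_comm, abs_of_nonneg (by linarith), Nat.cast_sub hk₀m]
      have hk1 : |(k : ℝ) - (0 : ℕ)| = k := by simp
      rw [hkJ, hk1]
      have h1 : (latticeCost ⌈x k⌉₊ (D * 2 ^ (k₀ + k)) : ℝ) ≤
          2 ^ (⌈x k⌉₊ : ℝ) * (D * 2 ^ ((k₀ : ℝ) + k) + 5) := by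
        rw [← Nat.cast_add k₀ k, Real.rpow_natCast, Real.rpow_natCast]
        exact_mod_cast latticeCost_le _ _
      have h2 : (1 : ℝ) ≤ 2 ^ ((k₀ : ℝ) + k) := Real.one_le_rpow one_le_two (by positivity)
      have h3 : (D : ℝ) * 2 ^ ((k₀ : ℝ) + k) + 5 ≤ (D + 5) * 2 ^ ((k₀ : ℝ) + k) := by linarith
      have h4 : (2 : ℝ) ^ (⌈x k⌉₊ : ℝ) ≤ 2 * 2 ^ x k + 1 := by
        have p0 : (0 : ℝ) < 2 ^ x k := by positivity
        rcases le_or_gt (x k) 0 with hxk | hxk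
        · rw [Nat.ceil_eq_zero.2 hxk, Nat.cast_zero, Real.rpow_zero]
          linarith
        · have : (2 : ℝ) ^ (⌈x k⌉₊ : ℝ) ≤ 2 ^ (x k + 1) :=
            Real.rpow_le_rpow_of_exponent_le one_le_two (Nat.ceil_lt_add_one hxk.le).le
          rw [Real.rpow_add zero_lt_two, Real.rpow_one] at this
          linarith
      have e1 : (2 : ℝ) ^ x k * 2 ^ ((k₀ : ℝ) + k) = 2 ^ (m : ℝ) * 2 ^ (-(θ * k)) := by
        rw [← Real.rpow_add zero_lt_two, ← Real.rpow_add zero_lt_two, hx]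
        congr 1
        ring
      have e2 : (2 : ℝ) ^ ((k₀ : ℝ) + k) = 2 ^ (m : ℝ) * 2 ^ (-(1 * ((m : ℝ) - k₀ - k))) := by
        rw [← Real.rpow_add zero_lt_two]
        congr 1
        ring
      calc _ ≤ _ := h1
        _ ≤ (2 * 2 ^ x k + 1) * ((D + 5) * 2 ^ ((k₀ : ℝ) + k)) := by gcongr
        _ = (D + 5) * (2 * (2 ^ x k * 2 ^ ((k₀ : ℝ) + k)) + 2 ^ ((k₀ : ℝ) + k)) := by ring
        _ = (D + 5) * 2 ^ (m : ℝ) *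
            (2 * 2 ^ (-(θ * k)) + 2 ^ (-(1 * ((m : ℝ) - k₀ - k)))) := by
            rw [e1, e2]; ring
        _ ≤ (D + 5) * 2 ^ (m : ℝ) *
            (2 * 2 ^ (-(θ * k)) + 2 * 2 ^ (-(1 * ((m : ℝ) - k₀ - k)))) := by
            gcongr
            have : (0 : ℝ) ≤ 2 ^ (-(1 * ((m : ℝ) - k₀ - k))) := by positivity
            linarith
        _ = 2 * (D + 5) * 2 ^ (m : ℝ) *
            (2 ^ (-(θ * k)) + 2 ^ (-(1 * ((m : ℝ) - k₀ - k)))) := by ring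
        _ ≤ _ := by
            gcongr
            rw [hc₁]
            linarith
  · rcases Nat.eq_zero_or_pos k with rfl | hk0
    · have e : (2 : ℝ) ^ (-(β * ((2 * m : ℕ) : ℝ))) ≤ cγ * X := by
        have h1 := hcγ' m (by positivity)
        have h2 : (1 : ℝ) ≤ cγ * 2 ^ (β * (m : ℝ)) * ((m : ℝ) + 1) ^ (-γ) := by
          rw [Real.rpow_neg (by positivity), ← div_eq_mul_inv, le_div_iff₀ (by positivity), one_mul]
          exact h1
        calc (2 : ℝ) ^ (-(β * ((2 * m : ℕ) : ℝ))) = 2 ^ (-(β * ((2 * m : ℕ) : ℝ))) * 1 := by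
              rw [mul_one]
          _ ≤ 2 ^ (-(β * ((2 * m : ℕ) : ℝ))) *
              (cγ * 2 ^ (β * (m : ℝ)) * ((m : ℝ) + 1) ^ (-γ)) := by gcongr
          _ = cγ * ((2 ^ (-(β * ((2 * m : ℕ) : ℝ))) * 2 ^ (β * (m : ℝ))) *
              ((m : ℝ) + 1) ^ (-γ)) := by ring
          _ = cγ * X := by
              rw [← Real.rpow_add zero_lt_two, hX]
              congr 3
              push_cast
              ring
      simp only [if_true, chainRadius, sub_self, abs_zero, mul_zero, neg_zero, Real.rpow_zero,
        mul_one]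
      calc _ ≤ ‖V‖ * (cγ * X) := by gcongr
        _ = ‖V‖ * cγ * X := by ring
        _ ≤ c₂ * X := by
            gcongr
            rw [hc₂]
            have : 0 ≤ R * 2 ^ u * (4 * D : ℝ) ^ γ := by positivity
            linarith
    · obtain ⟨k, rfl⟩ := Nat.exists_eq_succ_of_ne_zero hk0.ne'
      simp only [if_neg hk0.ne', Nat.succ_eq_add_one, chainRadius]
      have hk1 : |((k + 1 : ℕ) : ℝ) - (0 : ℕ)| = (k + 1 : ℕ) := by simp; positivity
      rw [hk1]
      have e : (2 : ℝ) ^ (-(u * ((k₀ + k : ℕ) : ℝ))) * 2 ^ (-(β * x (k + 1))) =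
          2 ^ u * (2 ^ (-(β * (m : ℝ))) * 2 ^ (-(γ * k₀)) *
            2 ^ (-(γ / 2 * ((k + 1 : ℕ) : ℝ)))) := by
        simp only [← Real.rpow_add zero_lt_two, hx]
        congr 1
        push_cast
        linear_combination ((k : ℝ) + 1) * hβθ + ((k₀ : ℝ) + k + 1) * hγ
      calc _ ≤ R * 2 ^ (-(u * ((k₀ + k : ℕ) : ℝ))) * 2 ^ (-(β * x (k + 1))) := by
            gcongr
            · exact hεR _
            · exact one_le_two
            · exact Nat.le_ceil _
        _ = R * (2 ^ (-(u * ((k₀ + k : ℕ) : ℝ))) * 2 ^ (-(β * x (k + 1)))) := by ring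
        _ ≤ R * (2 ^ u * (2 ^ (-(β * (m : ℝ))) * ((4 * D) ^ γ * ((m : ℝ) + 1) ^ (-γ)) *
            2 ^ (-(γ / 2 * ((k + 1 : ℕ) : ℝ))))) := by
            rw [e]
            gcongr
        _ = R * 2 ^ u * (4 * D) ^ γ * X * 2 ^ (-(γ / 2 * ((k + 1 : ℕ) : ℝ))) := by
            rw [hX]; ring
        _ ≤ _ := by
            gcongr
            rw [hc₂]
            have : 0 ≤ ‖V‖ * cγ := by positivity
            linarith
  · have hJ : k₀ + (m - k₀) = m := by omega
    rw [hJ]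
    have hk₀m' : (k₀ : ℝ) ≤ m := by exact_mod_cast hk₀m
    calc ε m ≤ R * 2 ^ (-(u * m)) := hεR m
      _ = R * (2 ^ (-(β * (m : ℝ))) * 2 ^ (-(γ * (m : ℝ)))) := by
          rw [← Real.rpow_add zero_lt_two, hγ]; ring_nf
      _ ≤ R * (2 ^ (-(β * (m : ℝ))) * ((4 * D) ^ γ * ((m : ℝ) + 1) ^ (-γ))) := by
          gcongr
          refine le_trans ?_ hk₀γ
          gcongr
          exact one_le_two
      _ = _ := by rw [hX]; ring
  · rw [Finset.sum_add_distrib]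
    exact add_le_add (hG' _ _) (hG'' _ _)

end Rates

/-! ### Sequences of nets from covering number bounds -/

theorem exists_exponential_nets {ι : Type} {P : Finset ι → ℝ → Prop} {a c ε₀ : ℝ} (ha : 0 < a)
    (hε₀ : 0 < ε₀) (h : ∀ ε : ℝ, 0 < ε → ε < ε₀ →
      ∃ S : Finset ι, (S.card : ℝ) ≤ Real.exp (c * ε ^ (-a)) ∧ P S ε) :
    ∃ (S : ℕ → Finset ι) (ε : ℕ → ℝ) (R : ℝ) (D : ℕ), 0 ≤ R ∧ 1 ≤ D ∧ (∀ j, 0 ≤ ε j) ∧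
      (∀ j : ℕ, ε j ≤ R * 2 ^ (-(1 / a * j))) ∧ (∀ j, (S j).card ≤ 2 ^ (D * 2 ^ j)) ∧
      ∀ j, P (S j) (ε j) := by
  have hlog : 0 < Real.log 2 := Real.log_pos one_lt_two
  set ε : ℕ → ℝ := fun j => ε₀ / 2 * 2 ^ (-(1 / a * j)) with hε
  have hpos : ∀ j, 0 < ε j := fun j => by positivity
  have hlt : ∀ j, ε j < ε₀ := fun j => by
    have : (2 : ℝ) ^ (-(1 / a * (j : ℝ))) ≤ 1 :=
      Real.rpow_le_one_of_one_le_of_nonpos one_le_two (by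
        have : 0 ≤ 1 / a * (j : ℝ) := by positivity
        linarith)
    calc ε j ≤ ε₀ / 2 * 1 := by simp only [hε]; gcongr
      _ < ε₀ := by linarith
  choose S hcard hP using fun j => h (ε j) (hpos j) (hlt j)
  set D := ⌈c * (ε₀ / 2) ^ (-a) / Real.log 2⌉₊ + 1 with hD
  have hD' : c * (ε₀ / 2) ^ (-a) ≤ Real.log 2 * D := by
    have := Nat.le_ceil (c * (ε₀ / 2) ^ (-a) / Real.log 2)
    rw [div_le_iff₀ hlog] at this
    rw [hD]; push_cast; linarith
  refine ⟨S, ε, ε₀ / 2, D, by positivity, by omega, fun j => (hpos j).le, fun j => le_rfl,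
    fun j => ?_, hP⟩
  have e : ε j ^ (-a) = (ε₀ / 2) ^ (-a) * 2 ^ (j : ℝ) := by
    simp only [hε]
    rw [Real.mul_rpow (by positivity) (by positivity), ← Real.rpow_mul zero_le_two]
    congr 2
    field_simp
  have key : ((S j).card : ℝ) ≤ 2 ^ ((D : ℝ) * 2 ^ (j : ℝ)) := by
    refine (hcard j).trans ?_
    rw [Real.rpow_def_of_pos zero_lt_two, e, ← mul_assoc, ← mul_assoc]
    gcongr
  have : ((S j).card : ℝ) ≤ ((2 ^ (D * 2 ^ j) : ℕ) : ℝ) := by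
    rw [Real.rpow_natCast 2 j] at key
    rw [Nat.cast_pow, ← Real.rpow_natCast _ (D * 2 ^ j)]
    push_cast
    exact key
  exact_mod_cast this

theorem exists_polynomial_nets {ι : Type} {P : Finset ι → ℝ → Prop} {a b c ε₀ : ℝ} (ha : 0 < a)
    (hb : 0 ≤ b) (hc : 0 < c) (hε₀ : 0 < ε₀) (h : ∀ ε : ℝ, 0 < ε → ε < ε₀ →
      ∃ S : Finset ι, (S.card : ℝ) ≤ c * ε ^ (-a) * |Real.log ε| ^ b ∧ P S ε) :
    ∃ (S : ℕ → Finset ι) (ε : ℕ → ℝ) (R : ℝ) (D : ℕ), 0 ≤ R ∧ (∀ j, 0 ≤ ε j) ∧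
      (∀ j : ℕ, ε j ≤ R * 2 ^ (-(1 / a * j)) * ((j : ℝ) + 1) ^ (b / a)) ∧
      (∀ j, (S j).card ≤ 2 ^ (j + D)) ∧ ∀ j, P (S j) (ε j) := by
  have hlog : 0 < Real.log 2 := Real.log_pos one_lt_two
  obtain ⟨M, hM, hM'⟩ := exists_add_one_rpow_le (b / a) (one_div_pos.2 ha)
  set r := min ε₀ 1 with hr
  have hr0 : 0 < r := lt_min hε₀ one_pos
  set R := r / (2 * M) with hR
  have hR0 : 0 < R := by positivity
  set ε : ℕ → ℝ := fun j => R * 2 ^ (-(1 / a * j)) * ((j : ℝ) + 1) ^ (b / a) with hε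
  have hpos : ∀ j, 0 < ε j := fun j => by positivity
  have hlt : ∀ j, ε j < r := fun j => by
    calc ε j ≤ R * 2 ^ (-(1 / a * j)) * (M * 2 ^ (1 / a * j)) := by
          simp only [hε]; gcongr; exact hM' j (by positivity)
      _ = R * M * (2 ^ (-(1 / a * j)) * 2 ^ (1 / a * j)) := by ring
      _ = r / 2 := by
          rw [← Real.rpow_add zero_lt_two, neg_add_cancel, Real.rpow_zero, hR]
          field_simp
      _ < r := by linarith
  choose S hcard hP using fun j => h (ε j) (hpos j) ((hlt j).trans_le (min_le_left _ _))
  set L := |Real.log R| + Real.log 2 / a with hL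
  have hL0 : 0 ≤ L := by positivity
  have hlogε : ∀ j : ℕ, |Real.log (ε j)| ≤ L * (j + 1) := fun j => by
    have hj0 : (0 : ℝ) ≤ j := by positivity
    have h1 : ε j ≤ 1 := (hlt j).le.trans (min_le_right _ _)
    have h2 : R * 2 ^ (-(1 / a * (j : ℝ))) ≤ ε j := by
      have : (1 : ℝ) ≤ ((j : ℝ) + 1) ^ (b / a) :=
        Real.one_le_rpow (by linarith) (by positivity)
      exact le_mul_of_one_le_right (by positivity) this
    have h3 := Real.log_le_log (by positivity) h2
    rw [Real.log_mul hR0.ne' (by positivity), Real.log_rpow zero_lt_two] at h3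
    rw [abs_of_nonpos (Real.log_nonpos (hpos j).le h1)]
    have h4 : -Real.log R ≤ |Real.log R| := neg_le_abs _
    have h5 : 1 / a * (j : ℝ) * Real.log 2 = Real.log 2 / a * j := by ring
    have h6 : 0 ≤ Real.log 2 / a := by positivity
    rw [hL]
    nlinarith [mul_nonneg (abs_nonneg (Real.log R)) hj0]
  obtain ⟨D, hD⟩ := exists_nat_ge (c * R ^ (-a) * L ^ b)
  refine ⟨S, ε, R, D, hR0.le, fun j => (hpos j).le, fun j => le_rfl, fun j => ?_, hP⟩
  have e : ε j ^ (-a) = R ^ (-a) * 2 ^ (j : ℝ) * (((j : ℝ) + 1) ^ b)⁻¹ := by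
    simp only [hε]
    rw [Real.mul_rpow (by positivity) (by positivity),
      Real.mul_rpow (by positivity) (by positivity), ← Real.rpow_mul zero_le_two,
      ← Real.rpow_mul (by positivity), ← Real.rpow_neg (by positivity)]
    congr 2
    · congr 1; field_simp
    · field_simp
  have hD2 : (D : ℝ) ≤ 2 ^ D := by exact_mod_cast Nat.lt_two_pow_self.le
  have : ((S j).card : ℝ) ≤ ((2 ^ (j + D) : ℕ) : ℝ) := by
    calc ((S j).card : ℝ) ≤ c * ε j ^ (-a) * |Real.log (ε j)| ^ b := hcard j
      _ ≤ c * ε j ^ (-a) * (L * (j + 1)) ^ b := by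
          gcongr
          exact hlogε j
      _ = (c * R ^ (-a) * L ^ b) * 2 ^ (j : ℝ) := by
          rw [e, Real.mul_rpow hL0 (by positivity)]
          field_simp
      _ ≤ D * 2 ^ (j : ℝ) := by gcongr
      _ ≤ 2 ^ D * 2 ^ (j : ℝ) := by gcongr
      _ = _ := by rw [Real.rpow_natCast]; push_cast; ring
  exact_mod_cast this

theorem stmt6 {T : Type} [Countable T] [PartialOrder T] [OrderBot T]
    (htree : IsTree T) (q : ℝ) (hq : 1 < q)
    (α σ : T → ℝ) (hα : ∀ t, 0 < α t) (hσpos : ∀ t, 0 < σ t)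
    (hσmono : ∀ ⦃t s : T⦄, t ≤ s → σ s ≤ σ t)
    (K : ℝ) (hK : ∀ s : T, (∑ᶠ r ∈ Set.Iic s, α r ^ q) ^ (1 / q) * σ s ≤ K)
    (glb : T → T → T) (hglb : IsGCA glb)
    [Fact (1 ≤ ENNReal.ofReal q)]
    (V : ellOne T →L[ℝ] ellQ T q)
    (hV : ∀ (x : ellOne T) (t : T), (V x : ∀ _ : T, ℝ) t =
      α t * ∑' s : {s : T // t ≤ s}, σ s.1 * (x : ∀ _ : T, ℝ) s.1)
    (p p' : ℝ) (hp : p = min 2 q) (hp' : 1 / p' = 1 - 1 / p) :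
    (∀ a b c : ℝ, 0 < a → 0 ≤ b → 0 < c →
      (∃ ε₀ > 0, ∀ ε : ℝ, 0 < ε → ε < ε₀ →
        orderCoveringNumber (treeDist q α σ glb) ε ≤
          ENNReal.ofReal (c * ε ^ (-a) * |Real.log ε| ^ b)) →
      ∃ c' > 0, ∀ n : ℕ, 2 ≤ n →
        entropyNumber n V ≤ c' * (n : ℝ) ^ (-(1 / a) - 1 / p') * Real.log n ^ (b / a)) ∧
    (∀ a c : ℝ, 0 < a → 0 < c → a < p' →
      (∃ ε₀ > 0, ∀ ε : ℝ, 0 < ε → ε < ε₀ →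
        orderCoveringNumber (treeDist q α σ glb) ε ≤
          ENNReal.ofReal (Real.exp (c * ε ^ (-a)))) →
      ∃ c' > 0, ∀ n : ℕ, 2 ≤ n →
        entropyNumber n V ≤ c' * (n : ℝ) ^ (-(1 / p')) * Real.log n ^ (1 / p' - 1 / a)) ∧
    (∀ a c : ℝ, 0 < a → 0 < c → p' < a →
      (∃ ε₀ > 0, ∀ ε : ℝ, 0 < ε → ε < ε₀ →
        orderCoveringNumber (treeDist q α σ glb) ε ≤
          ENNReal.ofReal (Real.exp (c * ε ^ (-a)))) →
      ∃ c' > 0, ∀ n : ℕ, 2 ≤ n →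
        entropyNumber n V ≤ c' * (n : ℝ) ^ (-(1 / a))) := by
  have hp1 : 1 < p := by rw [hp]; exact lt_min one_lt_two hq
  have hβ : 0 < 1 - 1 / p := by
    have : 1 / p < 1 := by rw [div_lt_one (by linarith)]; exact hp1
    linarith
  have hp'0 : 0 < p' := one_div_pos.1 (hp' ▸ hβ)
  obtain ⟨C, hC, hY⟩ := exists_powerSmooth_ellQ (T := T) hq
  rw [← hp] at hY
  have hnet := fun {ε B : ℝ} (hB : 0 ≤ B) =>
    exists_summation_net (ε := ε) (B := B) htree hq hα hσpos hσmono (V := V) hV glb hB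
  refine ⟨fun a b c ha hb hc ⟨ε₀, hε₀, hN⟩ => ?_, fun a c ha hc hap ⟨ε₀, hε₀, hN⟩ => ?_,
    fun a c ha hc hap ⟨ε₀, hε₀, hN⟩ => ?_⟩
  · obtain ⟨S, ε, R, D, hR, hε, hεR, hcard, hS⟩ := exists_polynomial_nets ha hb hc hε₀
      fun ε h0 h1 => hnet (by positivity) (hN ε h0 h1)
    have := exists_rate_of_polynomial_nets hp1 hC hY V hR (one_div_pos.2 ha) (by positivity) hε
      hεR hcard hS
    rwa [← hp', neg_add'] at this
  · obtain ⟨S, ε, R, D, hR, hD, hε, hεR, hcard, hS⟩ := exists_exponential_nets ha hε₀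
      fun ε h0 h1 => hnet (Real.exp_nonneg _) (hN ε h0 h1)
    have hlt : 1 - 1 / p < 1 / a := hp' ▸ one_div_lt_one_div_of_lt ha hap
    have := exists_rate_of_exponential_nets_of_gt hp1 hC hY V hR hD hlt hε hεR hcard hS
    rwa [← hp'] at this
  · obtain ⟨S, ε, R, D, hR, hD, hε, hεR, hcard, hS⟩ := exists_exponential_nets ha hε₀
      fun ε h0 h1 => hnet (Real.exp_nonneg _) (hN ε h0 h1)
    have hlt : 1 / a < 1 - 1 / p := hp' ▸ one_div_lt_one_div_of_lt hp'0 hap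
    exact exists_rate_of_exponential_nets_of_lt hp1 hC hY V hR (one_div_pos.2 ha) hlt hε hεR
      hcard hS
end
end

section
/- Suppose there exist m pairs t_i ≺ s_i in T (1 ≤ i ≤ m) such that the order intervals (t_i, s_i] = {r : t_i ≺ r ⪯ s_i} are pairwise disjoint, and for some ε > 0 one has d(t_i, s_i) ≥ ε for all i. Then there is a constant c > 0 depending only on q such that for every integer n with log m ≤ n ≤ m, e_n(V_{α,σ} : ℓ_1(T) → ℓ_q(T)) ≥ c ε (log(1 + m/n)/n)^{1/q'}, where 1/q' = 1 − 1/q. -/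
open scoped ENNReal NNReal
open MeasureTheory

noncomputable section

/-- At most `2 ^ k * |A| ^ (k / 2)` words of length `k` differ from a given word in fewer than
half of the positions. -/
theorem card_words_near_le {A : Type} [Fintype A] [DecidableEq A] [Nonempty A] (k : ℕ)
    (w₀ : Fin k → A) (S : Finset (Fin k → A))
    (hS : ∀ w ∈ S, 2 * (Finset.univ.filter fun i => w i ≠ w₀ i).card < k) :
    S.card ≤ 2 ^ k * Fintype.card A ^ (k / 2) := by
  classical
  set P : Finset (Finset (Fin k)) := Finset.univ.filter fun D => 2 * D.card < k
  have hsub : S ⊆ P.biUnion fun D =>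
      Fintype.piFinset fun i => if i ∈ D then (Finset.univ : Finset A) else {w₀ i} := by
    intro w hw
    refine Finset.mem_biUnion.2 ⟨Finset.univ.filter fun i => w i ≠ w₀ i, ?_, ?_⟩
    · simpa [P] using hS w hw
    · rw [Fintype.mem_piFinset]
      intro i
      by_cases h : w i = w₀ i <;> simp [h]
  have hP : P.card ≤ 2 ^ k := by
    have := Finset.card_le_univ P
    simpa using this
  have hA : 0 < Fintype.card A := Fintype.card_pos
  refine (Finset.card_le_card hsub).trans ((Finset.card_biUnion_le_card_mul _ _ _ ?_).trans
    (Nat.mul_le_mul_right _ hP))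
  intro D hD
  have hD' : 2 * D.card < k := by simpa [P] using hD
  have hcard : (Fintype.piFinset fun i => if i ∈ D then (Finset.univ : Finset A)
      else {w₀ i}).card = Fintype.card A ^ D.card := by
    have h : ∀ i : Fin k, (if i ∈ D then (Finset.univ : Finset A) else {w₀ i}).card =
        if i ∈ D then Fintype.card A else 1 := by
      intro i; split_ifs <;> simp
    simp [Fintype.card_piFinset, h]
  rw [hcard]
  exact Nat.pow_le_pow_right hA (by omega)

/-- If words of length `k` over an alphabet of `16 * b` letters are distributed over at most
`2 ^ (n - 1)` classes and `4 ^ n ≤ (4 * b) ^ k`, then two words of the same class differ in at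
least half of the positions. -/
theorem exists_far_words {A Y : Type} [Fintype A] [DecidableEq A] [DecidableEq Y] {n k b : ℕ}
    (hn : 1 ≤ n) (hb : 1 ≤ b) (hA : Fintype.card A = 16 * b) (hkb : 4 ^ n ≤ (4 * b) ^ k)
    (F : Finset Y) (hF : F.card ≤ 2 ^ (n - 1)) (f : (Fin k → A) → Y) (hf : ∀ w, f w ∈ F) :
    ∃ w w', f w = f w' ∧ k ≤ 2 * (Finset.univ.filter fun i => w i ≠ w' i).card := by
  by_contra! hcon
  have : Nonempty A := Fintype.card_pos_iff.1 (by omega)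
  have hfib : ∀ y ∈ F, (Finset.univ.filter fun w => f w = y).card ≤
      2 ^ k * Fintype.card A ^ (k / 2) := by
    intro y _
    rcases (Finset.univ.filter fun w => f w = y).eq_empty_or_nonempty with h | ⟨w₀, hw₀⟩
    · simp [h]
    · refine card_words_near_le k w₀ _ fun w hw => hcon w w₀ ?_
      simp only [Finset.mem_filter, Finset.mem_univ, true_and] at hw hw₀
      rw [hw, hw₀]
  have htot : (Finset.univ : Finset (Fin k → A)).card ≤
      F.card * (2 ^ k * Fintype.card A ^ (k / 2)) := by
    rw [Finset.card_eq_sum_card_fiberwise (f := f) (t := F) (fun w _ => hf w)]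
    simpa using Finset.sum_le_card_nsmul F _ _ hfib
  simp only [Finset.card_univ, Fintype.card_pi, Finset.prod_const, Fintype.card_fin] at htot
  rw [hA] at htot
  have h1 : (16 * b) ^ k ≤ 2 ^ (n - 1) * (2 ^ k * (16 * b) ^ (k / 2)) :=
    htot.trans (Nat.mul_le_mul_right _ hF)
  have h2 : ((16 * b) ^ k) ^ 2 ≤ (2 ^ (n - 1) * (2 ^ k * (16 * b) ^ (k / 2))) ^ 2 :=
    Nat.pow_le_pow_left h1 2
  have h3 : ((16 * b) ^ (k / 2)) ^ 2 ≤ (16 * b) ^ k := by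
    rw [← pow_mul]
    exact Nat.pow_le_pow_right (by omega) (by omega)
  have h4 : ((16 * b) ^ k) ^ 2 ≤ 4 ^ (n - 1) * (4 ^ k * (16 * b) ^ k) := by
    calc ((16 * b) ^ k) ^ 2 ≤ (2 ^ (n - 1) * (2 ^ k * (16 * b) ^ (k / 2))) ^ 2 := h2
      _ = 4 ^ (n - 1) * (4 ^ k * ((16 * b) ^ (k / 2)) ^ 2) := by
        rw [mul_pow, mul_pow, ← pow_mul 2, ← pow_mul 2, mul_comm (n - 1), mul_comm k 2,
          pow_mul 2 2, pow_mul 2 2]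
        norm_num
      _ ≤ _ := by gcongr
  have hpos : 0 < 4 ^ k * (16 * b) ^ k := by positivity
  have h5 : (16 * b) ^ k = 4 ^ k * (4 * b) ^ k := by rw [← mul_pow]; congr 1; ring
  have h6 : (4 ^ k * (16 * b) ^ k) * (4 * b) ^ k ≤ (4 ^ k * (16 * b) ^ k) * 4 ^ (n - 1) := by
    calc (4 ^ k * (16 * b) ^ k) * (4 * b) ^ k = ((16 * b) ^ k) ^ 2 := by
          rw [sq]; nth_rewrite 2 [h5]; ring
      _ ≤ _ := h4.trans_eq (by ring)
  have h7 := (Nat.le_of_mul_le_mul_left h6 hpos)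
  have h8 : 4 ^ (n - 1) < 4 ^ n := Nat.pow_lt_pow_right (by norm_num) (by omega)
  omega

/-- Suitable word length `k` and alphabet parameter `b` for the packing argument. -/
theorem exists_word_length {m n : ℕ} (hn : 1 ≤ n) (hlog : Real.log m ≤ n) (hnm : n ≤ m) :
    ∃ k b : ℕ, 1 ≤ k ∧ 1 ≤ b ∧ k * b ≤ m ∧ 4 ^ n ≤ (4 * b) ^ k ∧
      (k : ℝ) * Real.log (1 + (m : ℝ) / n) ≤ 6 * n := by
  set b := m / n
  have hb : 1 ≤ b := (Nat.one_le_div_iff (by omega)).2 hnm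
  have hbR : (1 : ℝ) ≤ b := by exact_mod_cast hb
  have hnR : (1 : ℝ) ≤ n := by exact_mod_cast hn
  have hlb : 0 ≤ Real.log b := Real.log_nonneg hbR
  have hl2 := Real.log_two_gt_d9
  have hl2' := Real.log_two_lt_d9
  set u : ℝ := 1 + Real.log b / (2 * Real.log 2) with hu
  have hu1 : 1 ≤ u := by
    have : 0 ≤ Real.log b / (2 * Real.log 2) := by positivity
    linarith
  have hu0 : 0 < u := by linarith
  have humul : u * (2 * Real.log 2) = Real.log (4 * b) := by
    rw [Real.log_mul (by norm_num) (by positivity), show (4 : ℝ) = 2 ^ 2 by norm_num,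
      Real.log_pow, hu]
    field_simp
    push_cast
    ring
  have hbm : (b : ℝ) ≤ m := by exact_mod_cast Nat.div_le_self m n
  have hlbn : Real.log b ≤ n := (Real.log_le_log (by positivity) hbm).trans hlog
  have hu2 : u ≤ 2 * n := by
    have h : Real.log b / (2 * Real.log 2) ≤ n := by
      rw [div_le_iff₀ (by positivity)]
      nlinarith
    linarith
  have hL : Real.log (1 + (m : ℝ) / n) ≤ 2 * u := by
    have h1 : (m : ℝ) / n ≤ b + 1 := by
      rw [div_le_iff₀ (by positivity)]
      have h : m < (b + 1) * n := by
        rw [mul_comm]; exact Nat.lt_mul_div_succ m (by omega)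
      exact_mod_cast h.le
    have h2 : Real.log (1 + (m : ℝ) / n) ≤ Real.log (4 * b) :=
      Real.log_le_log (by positivity) (by linarith)
    rw [← humul] at h2
    nlinarith
  set k := ⌈(n : ℝ) / u⌉₊
  have hnu : 0 < (n : ℝ) / u := by positivity
  have hk1 : 1 ≤ k := Nat.ceil_pos.2 hnu
  have hkn : k ≤ n := Nat.ceil_le.2 (div_le_self (by positivity) hu1)
  have hle : (n : ℝ) / u ≤ k := Nat.le_ceil _
  have hlt : (k : ℝ) < n / u + 1 := Nat.ceil_lt_add_one hnu.le
  refine ⟨k, b, hk1, hb, (Nat.mul_le_mul_right b hkn).trans (Nat.mul_div_le m n), ?_, ?_⟩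
  · have h : ((4 : ℝ) ^ n) ≤ (4 * b) ^ k := by
      rw [← Real.log_le_log_iff (by positivity) (by positivity), Real.log_pow, Real.log_pow,
        ← humul, show (4 : ℝ) = 2 ^ 2 by norm_num, Real.log_pow]
      have : (n : ℝ) ≤ k * u := (div_le_iff₀ hu0).1 hle
      push_cast
      nlinarith
    exact_mod_cast h
  · have h1 : (k : ℝ) * u ≤ n + u := by
      have := mul_le_mul_of_nonneg_right hlt.le hu0.le
      rwa [add_mul, div_mul_cancel₀ _ hu0.ne', one_mul] at this
    have hk0 : (0 : ℝ) ≤ k := by positivity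
    nlinarith [mul_le_mul_of_nonneg_left hL hk0]

/-- A lower bound for the covering radius of an operator mapping `k * b` vectors of norm at most
`2` to a system that dominates the unit vectors of `ℓ_q`. -/
theorem covering_radius_ge {X Y : Type} [NormedAddCommGroup X] [NormedSpace ℝ X]
    [NormedAddCommGroup Y] [NormedSpace ℝ Y] (V : X →L[ℝ] Y) {q ε : ℝ} (hq : 1 < q)
    (hε : 0 < ε) {n k b : ℕ} (hn : 1 ≤ n) (hk : 1 ≤ k) (hb : 1 ≤ b)
    (hkb : 4 ^ n ≤ (4 * b) ^ k) (ξ : Fin k × Fin b → X) (hξ : ∀ p, ‖ξ p‖ ≤ 2)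
    (hV : ∀ (D : Finset (Fin k × Fin b)) (a : Fin k × Fin b → ℝ), (∀ p ∈ D, 1 ≤ |a p|) →
      ε * (D.card : ℝ) ^ (1 / q) ≤ ‖V (∑ p, a p • ξ p)‖)
    {δ : ℝ} (F : Finset Y) (hF : F.card ≤ 2 ^ (n - 1))
    (hcov : ∀ x : X, ‖x‖ ≤ 1 → ∃ y ∈ F, ‖V x - y‖ < δ) :
    ε / 128 * (k : ℝ) ^ (1 / q - 1) ≤ δ := by
  classical
  have hkR : (1 : ℝ) ≤ k := by exact_mod_cast hk
  let a : (Fin k → Fin b × Fin 16) → Fin k × Fin b → ℝ := fun w p =>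
    if (w p.1).1 = p.2 then ((w p.1).2 : ℝ) + 1 else 0
  let x : (Fin k → Fin b × Fin 16) → X := fun w => (1 / (32 * k) : ℝ) • ∑ p, a w p • ξ p
  have ha0 : ∀ w p, 0 ≤ a w p := by
    intro w p
    simp only [a]
    split_ifs <;> positivity
  have hasum : ∀ w, ∑ p, a w p ≤ 16 * k := by
    intro w
    rw [Fintype.sum_prod_type]
    have h : ∀ i : Fin k, ∑ j : Fin b, a w (i, j) ≤ 16 := by
      intro i
      simp only [a, Finset.sum_ite_eq, Finset.mem_univ, if_true]
      have : (((w i).2 : ℕ) : ℝ) + 1 ≤ 16 := by exact_mod_cast (w i).2.isLt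
      exact this
    calc ∑ i : Fin k, ∑ j : Fin b, a w (i, j) ≤ ∑ _i : Fin k, (16 : ℝ) :=
          Finset.sum_le_sum fun i _ => h i
      _ = 16 * k := by simp [mul_comm]
  have hx : ∀ w, ‖x w‖ ≤ 1 := by
    intro w
    have h1 : ‖∑ p, a w p • ξ p‖ ≤ 32 * k := by
      calc ‖∑ p, a w p • ξ p‖ ≤ ∑ p, a w p * 2 := by
            refine norm_sum_le_of_le _ fun p _ => ?_
            rw [norm_smul, Real.norm_of_nonneg (ha0 w p)]
            exact mul_le_mul_of_nonneg_left (hξ p) (ha0 w p)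
        _ = (∑ p, a w p) * 2 := by rw [Finset.sum_mul]
        _ ≤ 32 * k := by linarith [hasum w]
    simp only [x]
    rw [norm_smul, Real.norm_of_nonneg (by positivity), one_div, inv_mul_le_iff₀ (by positivity)]
    linarith
  choose f hfF hf using fun w => hcov (x w) (hx w)
  obtain ⟨w, w', hww, hfar⟩ := exists_far_words hn hb (by simp [mul_comm]) hkb F hF f hfF
  set E : Finset (Fin k) := Finset.univ.filter fun i => w i ≠ w' i with hE
  let D : Finset (Fin k × Fin b) := E.image fun i => (i, (w i).1)
  have hDcard : D.card = E.card :=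
    Finset.card_image_of_injective _ fun i j hij => (Prod.ext_iff.1 hij).1
  have hD : ∀ p ∈ D, 1 ≤ |a w p - a w' p| := by
    intro p hp
    obtain ⟨i, hi, rfl⟩ := Finset.mem_image.1 hp
    have hne : w i ≠ w' i := by simpa [hE] using hi
    simp only [a, if_true]
    split_ifs with h
    · have h2 : ((w i).2 : ℕ) ≠ ((w' i).2 : ℕ) := fun h2 =>
        hne (Prod.ext h.symm (Fin.ext h2))
      have h3 : (1 : ℤ) ≤ |(((w i).2 : ℕ) : ℤ) - (((w' i).2 : ℕ) : ℤ)| :=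
        Int.one_le_abs (sub_ne_zero.2 (by exact_mod_cast h2))
      rw [add_sub_add_right_eq_sub]
      exact_mod_cast h3
    · rw [sub_zero, abs_of_nonneg (by positivity)]
      linarith [show (0 : ℝ) ≤ (((w i).2 : ℕ) : ℝ) by positivity]
  have hlow := hV D (fun p => a w p - a w' p) hD
  have hdiff : V (x w) - V (x w') = (1 / (32 * k) : ℝ) • V (∑ p, (a w p - a w' p) • ξ p) := by
    simp only [x, ← map_sub, ← smul_sub, ← Finset.sum_sub_distrib, sub_smul, map_smul]
  have hup : ‖V (x w) - V (x w')‖ ≤ 2 * δ := by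
    have h1 := hf w
    have h2 := hf w'
    rw [← hww] at h2
    have h3 : V (x w) - V (x w') = (V (x w) - f w) - (V (x w') - f w) := by abel
    rw [h3]
    linarith [norm_sub_le (V (x w) - f w) (V (x w') - f w)]
  rw [hdiff, norm_smul, Real.norm_of_nonneg (by positivity), one_div,
    inv_mul_le_iff₀ (by positivity)] at hup
  have hcard : (k : ℝ) ^ (1 / q) / 2 ≤ (D.card : ℝ) ^ (1 / q) := by
    have h1 : (k : ℝ) / 2 ≤ D.card := by
      rw [hDcard, div_le_iff₀ (by norm_num)]
      exact_mod_cast (by omega : k ≤ E.card * 2)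
    have hq0 : 0 ≤ 1 / q := by positivity
    have hq1 : 1 / q ≤ 1 := by rw [div_le_one (by linarith)]; exact hq.le
    have h2 : (2 : ℝ) ^ (1 / q) ≤ 2 := by
      simpa using Real.rpow_le_rpow_of_exponent_le (by norm_num : (1 : ℝ) ≤ 2) hq1
    calc (k : ℝ) ^ (1 / q) / 2 ≤ (k : ℝ) ^ (1 / q) / 2 ^ (1 / q) := by gcongr
      _ = ((k : ℝ) / 2) ^ (1 / q) := by rw [Real.div_rpow (by positivity) (by norm_num)]
      _ ≤ _ := Real.rpow_le_rpow (by positivity) h1 hq0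
  have hfin : ε * ((k : ℝ) ^ (1 / q) / 2) ≤ 32 * k * (2 * δ) :=
    (mul_le_mul_of_nonneg_left hcard hε.le).trans (hlow.trans hup)
  rw [Real.rpow_sub (by positivity), Real.rpow_one, div_mul_div_comm, div_le_iff₀ (by positivity)]
  linarith

/-- The summation operator on a multiple of a unit vector. -/
theorem summation_single_apply {T : Type} [PartialOrder T] [DecidableEq T] {q : ℝ}
    [Fact (1 ≤ ENNReal.ofReal q)] {α σ : T → ℝ} {V : ellOne T →L[ℝ] ellQ T q}
    (hV : ∀ (x : ellOne T) (t : T), (V x : ∀ _ : T, ℝ) t =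
      α t * ∑' s : {s : T // t ≤ s}, σ s.1 * (x : ∀ _ : T, ℝ) s.1)
    (u r : T) (c : ℝ) [Decidable (r ≤ u)] :
    (V (lp.single 1 u c) : ∀ _ : T, ℝ) r = if r ≤ u then α r * (σ u * c) else 0 := by
  rw [hV]
  split_ifs with h
  · rw [tsum_eq_single (⟨u, h⟩ : {s : T // r ≤ s})]
    · simp
    · intro s hs
      have : s.1 ≠ u := fun hsu => hs (Subtype.ext hsu)
      simp [this]
  · rw [mul_eq_zero]
    right
    refine (tsum_congr fun s => ?_).trans tsum_zero
    have : s.1 ≠ u := fun hsu => h (hsu ▸ s.2)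
    simp [this]

/-- The difference of two unit vectors whose image under the summation operator is supported in
the order interval `(t, v]`. -/
def intervalVector {T : Type} [DecidableEq T] (σ : T → ℝ) (t v : T) : ellOne T :=
  lp.single 1 v 1 - lp.single 1 t (σ v / σ t)

theorem norm_intervalVector_le {T : Type} [DecidableEq T] {σ : T → ℝ} (hσ : ∀ t, 0 < σ t)
    {t v : T} (h : σ v ≤ σ t) : ‖intervalVector σ t v‖ ≤ 2 := by
  refine (norm_sub_le _ _).trans ?_
  rw [lp.norm_single (by norm_num), lp.norm_single (by norm_num), norm_one,
    Real.norm_of_nonneg (div_pos (hσ v) (hσ t)).le]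
  have := (div_le_one (hσ t)).2 h
  linarith

theorem summation_intervalVector_apply {T : Type} [PartialOrder T] [DecidableEq T] {q : ℝ}
    [Fact (1 ≤ ENNReal.ofReal q)] {α σ : T → ℝ} {V : ellOne T →L[ℝ] ellQ T q}
    (hV : ∀ (x : ellOne T) (t : T), (V x : ∀ _ : T, ℝ) t =
      α t * ∑' s : {s : T // t ≤ s}, σ s.1 * (x : ∀ _ : T, ℝ) s.1)
    (hσ : ∀ t, 0 < σ t) (htree : ∀ s a b : T, a ≤ s → b ≤ s → a ≤ b ∨ b ≤ a)
    {t v : T} (htv : t < v) (r : T) [Decidable (r ∈ Set.Ioc t v)] :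
    (V (intervalVector σ t v) : ∀ _ : T, ℝ) r =
      if r ∈ Set.Ioc t v then α r * σ v else 0 := by
  classical
  have hne : σ t ≠ 0 := (hσ t).ne'
  rw [intervalVector, map_sub, lp.coeFn_sub, Pi.sub_apply, summation_single_apply hV,
    summation_single_apply hV, mul_one, mul_div_cancel₀ _ hne]
  by_cases hrv : r ≤ v
  · by_cases hrt : r ≤ t
    · have : r ∉ Set.Ioc t v := fun h => (h.1.trans_le hrt).false
      rw [if_pos hrv, if_pos hrt, if_neg this, sub_self]
    · have : r ∈ Set.Ioc t v := by
        refine ⟨?_, hrv⟩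
        rcases htree v r t hrv htv.le with h | h
        · exact absurd h hrt
        · exact lt_of_le_of_ne h fun h' => hrt h'.ge
      rw [if_pos hrv, if_neg hrt, if_pos this, sub_zero]
  · have hrt : ¬ r ≤ t := fun h => hrv (h.trans htv.le)
    have : r ∉ Set.Ioc t v := fun h => hrv h.2
    rw [if_neg hrv, if_neg hrt, if_neg this, sub_zero]

/-- The images of interval vectors of disjoint order intervals dominate the unit vectors
of `ℓ_q`. -/
theorem norm_summation_sum_ge {T ι : Type} [Fintype ι] [PartialOrder T] [DecidableEq T] {q ε : ℝ}
    [Fact (1 ≤ ENNReal.ofReal q)] (hq : 1 < q) (hε : 0 < ε) {α σ : T → ℝ}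
    {V : ellOne T →L[ℝ] ellQ T q}
    (hV : ∀ (x : ellOne T) (t : T), (V x : ∀ _ : T, ℝ) t =
      α t * ∑' s : {s : T // t ≤ s}, σ s.1 * (x : ∀ _ : T, ℝ) s.1)
    (hα : ∀ t, 0 < α t) (hσ : ∀ t, 0 < σ t) (hfin : ∀ s : T, (Set.Iic s).Finite)
    (htree : ∀ s a b : T, a ≤ s → b ≤ s → a ≤ b ∨ b ≤ a)
    (t v : ι → T) (htv : ∀ i, t i < v i)
    (hdisj : Pairwise fun i j => Disjoint (Set.Ioc (t i) (v i)) (Set.Ioc (t j) (v j)))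
    (hd : ∀ i, ε ≤ (∑ᶠ r ∈ Set.Ioc (t i) (v i), α r ^ q) ^ (1 / q) * σ (v i))
    (D : Finset ι) (a : ι → ℝ) (ha : ∀ i ∈ D, 1 ≤ |a i|) :
    ε * (D.card : ℝ) ^ (1 / q) ≤ ‖V (∑ i, a i • intervalVector σ (t i) (v i))‖ := by
  classical
  have hq0 : 0 < q := by linarith
  have hqR : (ENNReal.ofReal q).toReal = q := ENNReal.toReal_ofReal hq0.le
  set g := V (∑ i, a i • intervalVector σ (t i) (v i)) with hg
  have hI : ∀ i, (Set.Ioc (t i) (v i)).Finite := fun i => (hfin (v i)).subset fun r hr => hr.2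
  have hgr : ∀ i, ∀ r ∈ Set.Ioc (t i) (v i), (g : ∀ _ : T, ℝ) r = a i * (α r * σ (v i)) := by
    intro i r hr
    have h1 : (g : ∀ _ : T, ℝ) r = ∑ j, a j *
        (V (intervalVector σ (t j) (v j)) : ∀ _ : T, ℝ) r := by
      rw [hg, map_sum, lp.coeFn_sum, Finset.sum_apply]
      refine Finset.sum_congr rfl fun j _ => ?_
      rw [map_smul, lp.coeFn_smul, Pi.smul_apply, smul_eq_mul]
    rw [h1, Finset.sum_eq_single i]
    · rw [summation_intervalVector_apply hV hσ htree (htv i), if_pos hr]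
    · intro j _ hji
      rw [summation_intervalVector_apply hV hσ htree (htv j), if_neg, mul_zero]
      exact fun h => Set.disjoint_left.1 (hdisj hji) h hr
    · simp
  have hterm : ∀ i ∈ D, ε ^ q ≤ ∑ r ∈ (hI i).toFinset, ‖(g : ∀ _ : T, ℝ) r‖ ^ q := by
    intro i hi
    have hS0 : 0 ≤ ∑ r ∈ (hI i).toFinset, α r ^ q :=
      Finset.sum_nonneg fun r _ => Real.rpow_nonneg (hα r).le q
    have h1 := Real.rpow_le_rpow hε.le (hd i) hq0.le
    rw [finsum_mem_eq_finite_toFinset_sum _ (hI i),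
      Real.mul_rpow (Real.rpow_nonneg hS0 _) (hσ _).le, ← Real.rpow_mul hS0,
      one_div_mul_cancel hq0.ne', Real.rpow_one, Finset.sum_mul] at h1
    refine h1.trans (Finset.sum_le_sum fun r hr => ?_)
    rw [hgr i r ((hI i).mem_toFinset.1 hr), ← Real.mul_rpow (hα r).le (hσ _).le, norm_mul]
    have hpos : 0 < α r * σ (v i) := mul_pos (hα r) (hσ _)
    rw [Real.norm_of_nonneg hpos.le, Real.norm_eq_abs]
    exact Real.rpow_le_rpow hpos.le (le_mul_of_one_le_left hpos.le (ha i hi)) hq0.le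
  have hsum : (D.card : ℝ) * ε ^ q ≤ ‖g‖ ^ q := by
    have h1 := lp.sum_rpow_le_norm_rpow (by rw [hqR]; exact hq0) g
      (D.biUnion fun i => (hI i).toFinset)
    rw [hqR, Finset.sum_biUnion] at h1
    · refine le_trans ?_ h1
      have := Finset.card_nsmul_le_sum D _ _ hterm
      rwa [nsmul_eq_mul] at this
    · intro i _ j _ hij
      exact Set.Finite.disjoint_toFinset.2 (hdisj hij)
  have h2 := Real.rpow_le_rpow (by positivity) hsum (one_div_nonneg.2 hq0.le)
  rwa [Real.mul_rpow (by positivity) (by positivity), ← Real.rpow_mul hε.le,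
    ← Real.rpow_mul (norm_nonneg _), mul_one_div_cancel hq0.ne', Real.rpow_one, Real.rpow_one,
    mul_comm] at h2

/-- The maximum in the definition of the distance along a branch is attained. -/
theorem exists_dOrd_eq {T : Type} [PartialOrder T] (q : ℝ) (α σ : T → ℝ) {t s : T}
    (hfin : (Set.Iic s).Finite) (hts : t < s) :
    ∃ v ∈ Set.Ioc t s,
      dOrd q α σ t s = (∑ᶠ r ∈ Set.Ioc t v, α r ^ q) ^ (1 / q) * σ v := by
  have hI : (Set.Ioc t s).Finite := hfin.subset fun r hr => hr.2
  have hne : (Set.Ioc t s).Nonempty := ⟨s, hts, le_rfl⟩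
  obtain ⟨v, hv, h⟩ := (hne.image
    (fun v => (∑ᶠ r ∈ Set.Ioc t v, α r ^ q) ^ (1 / q) * σ v)).csSup_mem (hI.image _)
  exact ⟨v, hv, h.symm⟩

/-- To bound an entropy number from below it suffices to bound all admissible radii. -/
theorem le_entropyNumber {X Y : Type} [NormedAddCommGroup X] [NormedSpace ℝ X]
    [NormedAddCommGroup Y] [NormedSpace ℝ Y] {n : ℕ} {V : X →L[ℝ] Y} {C : ℝ}
    (h : ∀ δ : ℝ, 0 < δ → ∀ F : Finset Y, F.card ≤ 2 ^ (n - 1) →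
      (∀ x : X, ‖x‖ ≤ 1 → ∃ y ∈ F, ‖V x - y‖ < δ) → C ≤ δ) : C ≤ entropyNumber n V := by
  refine le_csInf ⟨‖V‖ + 1, by positivity, {0}, ?_, ?_⟩ ?_
  · simpa using Nat.one_le_two_pow
  · intro x hx
    refine ⟨0, by simp, ?_⟩
    rw [sub_zero]
    linarith [V.le_opNorm_of_le hx]
  · rintro δ ⟨hδ, F, hF, hcov⟩
    exact h δ hδ F hF hcov

theorem stmt7 (q q' : ℝ) (hq : 1 < q) (hq' : 1 / q' = 1 - 1 / q) :
    ∃ c : ℝ, 0 < c ∧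
      ∀ (T : Type) [Countable T] [PartialOrder T] [OrderBot T]
        [Fact (1 ≤ ENNReal.ofReal q)] (α σ : T → ℝ) (glb : T → T → T)
        (V : ellOne T →L[ℝ] ellQ T q),
        IsTree T → (∀ t, 0 < α t) → (∀ t, 0 < σ t) →
        (∀ ⦃t s : T⦄, t ≤ s → σ s ≤ σ t) →
        (∃ K : ℝ, ∀ s : T, (∑ᶠ r ∈ Set.Iic s, α r ^ q) ^ (1 / q) * σ s ≤ K) →
        IsGCA glb →
        (∀ (x : ellOne T) (t : T), (V x : ∀ _ : T, ℝ) t =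
          α t * ∑' s : {s : T // t ≤ s}, σ s.1 * (x : ∀ _ : T, ℝ) s.1) →
        ∀ (m : ℕ) (ts ss : Fin m → T) (ε : ℝ), 0 < ε →
          (∀ i, ts i < ss i) →
          (Pairwise fun i j =>
            Disjoint (Set.Ioc (ts i) (ss i)) (Set.Ioc (ts j) (ss j))) →
          (∀ i, ε ≤ treeDist q α σ glb (ts i) (ss i)) →
          ∀ n : ℕ, Real.log m ≤ n → n ≤ m →
            c * ε * (Real.log (1 + (m : ℝ) / n) / n) ^ (1 / q') ≤
              entropyNumber n V := by
  refine ⟨1 / 768, by norm_num, ?_⟩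
  intro T _ _ _ _ α σ glb V hT hα hσ hanti _ _ hV m ts ss ε hε hts hdisj hd n hlog hnm
  classical
  have hq0 : 0 < q := by linarith
  have hinv : 1 / q < 1 := by rw [div_lt_one hq0]; exact hq
  rw [hq']
  refine le_entropyNumber fun δ hδ F hF hcov => ?_
  rcases Nat.eq_zero_or_pos n with rfl | hn
  · rw [Nat.cast_zero, div_zero, Real.zero_rpow (by linarith), mul_zero]
    exact hδ.le
  obtain ⟨k, b, hk, hb, hkbm, hkb, hkL⟩ := exists_word_length hn hlog hnm
  choose v hv hdv using fun i => exists_dOrd_eq q α σ (hT.1 (ss i)) (hts i)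
  have hd' : ∀ i, ε ≤ (∑ᶠ r ∈ Set.Ioc (ts i) (v i), α r ^ q) ^ (1 / q) * σ (v i) := by
    intro i
    have h := hd i
    rwa [treeDist, if_pos (hts i).le, hdv i] at h
  let e : Fin k × Fin b → Fin m := fun p => Fin.castLE hkbm (finProdFinEquiv p)
  have he : Function.Injective e :=
    (Fin.castLE_injective hkbm).comp finProdFinEquiv.injective
  have hdisj' : Pairwise fun i j => Disjoint (Set.Ioc (ts (e i)) (v (e i)))
      (Set.Ioc (ts (e j)) (v (e j))) := fun i j hij =>
    (hdisj (he.ne hij)).mono (Set.Ioc_subset_Ioc_right (hv _).2)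
      (Set.Ioc_subset_Ioc_right (hv _).2)
  have hmain := covering_radius_ge V hq hε hn hk hb hkb
    (fun p => intervalVector σ (ts (e p)) (v (e p)))
    (fun p => norm_intervalVector_le hσ (hanti (hv (e p)).1.le))
    (norm_summation_sum_ge hq hε hV hα hσ hT.1 hT.2.1 (fun p => ts (e p)) (fun p => v (e p))
      (fun p => (hv (e p)).1) hdisj' (fun p => hd' (e p))) F hF hcov
  refine le_trans ?_ hmain
  have hkR : (0 : ℝ) < k := by exact_mod_cast hk
  have hnR : (0 : ℝ) < n := by exact_mod_cast hn
  have hL0 : 0 ≤ Real.log (1 + (m : ℝ) / n) :=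
    Real.log_nonneg (le_add_of_nonneg_right (by positivity))
  have hratio : Real.log (1 + (m : ℝ) / n) / n ≤ 6 * (k : ℝ)⁻¹ := by
    rw [← div_eq_mul_inv, div_le_div_iff₀ hnR hkR]
    linarith
  have h6 : (6 : ℝ) ^ (1 - 1 / q) ≤ 6 := by
    have : 1 - 1 / q ≤ 1 := by linarith [one_div_pos.2 hq0]
    simpa using Real.rpow_le_rpow_of_exponent_le (by norm_num : (1 : ℝ) ≤ 6) this
  have hpow : (Real.log (1 + (m : ℝ) / n) / n) ^ (1 - 1 / q) ≤ 6 * (k : ℝ) ^ (1 / q - 1) := by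
    refine (Real.rpow_le_rpow (by positivity) hratio (by linarith)).trans ?_
    rw [Real.mul_rpow (by norm_num) (by positivity), Real.inv_rpow hkR.le,
      ← Real.rpow_neg hkR.le, neg_sub]
    gcongr
  calc 1 / 768 * ε * (Real.log (1 + (m : ℝ) / n) / n) ^ (1 - 1 / q)
      ≤ 1 / 768 * ε * (6 * (k : ℝ) ^ (1 / q - 1)) := by gcongr
    _ = ε / 128 * (k : ℝ) ^ (1 / q - 1) := by ring
end
end

section
/- For every ε > 0 with N(T,d,2ε) finite, there exist at least N(T,d,2ε) − 1 pairs t_i ≺ s_i in T such that d(t_i, s_i) ≥ ε for each i and the order intervals (t_i, s_i] = {r : t_i ≺ r ⪯ s_i} are pairwise disjoint. -/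
open scoped ENNReal NNReal
open MeasureTheory

noncomputable section

/-- A finite family of pairs `t < s` that are `ε`-separated for `d` and whose order intervals
`(t, s]` are pairwise disjoint. -/
def IsSeparatedFamily {T : Type} [PartialOrder T] (d : T → T → ℝ) (ε : ℝ)
    (P : Finset (T × T)) : Prop :=
  (∀ p ∈ P, p.1 < p.2 ∧ ε ≤ d p.1 p.2) ∧
    (P : Set (T × T)).Pairwise fun p p' => Disjoint (Set.Ioc p.1 p.2) (Set.Ioc p'.1 p'.2)

/-- On a finite part of a tree, some order `ε`-net has at most one more element than some
separated family. -/
theorem exists_separatedFamily_net_finset {T : Type} [PartialOrder T] [OrderBot T]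
    (htree : IsTree T) (d : T → T → ℝ) (ε : ℝ) (hd : ∀ t, d t t < ε) (F : Finset T) :
    ∃ (S : Finset T) (P : Finset (T × T)), S.card ≤ P.card + 1 ∧ IsSeparatedFamily d ε P ∧
      (∀ p ∈ P, p.2 ∈ F) ∧ ∀ t ∈ F, ∃ s ∈ S, s ≤ t ∧ d s t < ε := by
  classical
  obtain ⟨hfin, hchain, -⟩ := htree
  induction F using Finset.strongInduction with
  | H F ih =>
    let A : Set T := {t | ∃ s ∈ F, t < s ∧ ε ≤ d t s}
    have hA : A.Finite := by
      refine (F.finite_toSet.biUnion fun s _ => hfin s).subset ?_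
      rintro t ⟨s, hs, hts, -⟩
      exact Set.mem_biUnion (Finset.mem_coe.2 hs) hts.le
    rcases A.eq_empty_or_nonempty with hAe | hAne
    · refine ⟨{⊥}, ∅, by simp, ⟨by simp, by simp⟩, by simp, fun t ht => ⟨⊥, by simp, bot_le, ?_⟩⟩
      by_contra! hle
      have hmem : ⊥ ∈ A := by
        refine ⟨t, ht, bot_lt_iff_ne_bot.2 ?_, hle⟩
        rintro rfl
        exact (hd ⊥).not_ge hle
      simp [hAe] at hmem
    · obtain ⟨t, ⟨s, hsF, hts, hds⟩, hmax⟩ := hA.exists_maximal hAne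
      obtain ⟨u, ⟨htu, hus⟩, hmin⟩ := ((hfin s).subset
        (Set.Ioc_subset_Iic_self : Set.Ioc t s ⊆ _)).exists_minimal ⟨s, hts, le_rfl⟩
      have hIoc : ∀ r ∈ Set.Ioc t s, u ≤ r := fun r hr =>
        (hchain s u r hus hr.2).elim id fun h => hmin hr h
      have hF' : F.filter (fun r => ¬ u ≤ r) ⊂ F :=
        Finset.filter_ssubset.2 ⟨s, hsF, not_not.2 hus⟩
      obtain ⟨S, P, hcard, ⟨hsep, hdisj⟩, hPF, hnet⟩ := ih _ hF'
      have hnot : (t, s) ∉ P := fun h => (Finset.mem_filter.1 (hPF _ h)).2 hus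
      have hdis : ∀ p ∈ P, Disjoint (Set.Ioc t s) (Set.Ioc p.1 p.2) := fun p hp =>
        Set.disjoint_left.2 fun r hr hr' =>
          (Finset.mem_filter.1 (hPF p hp)).2 ((hIoc r hr).trans hr'.2)
      refine ⟨insert u S, insert (t, s) P, ?_, ⟨?_, ?_⟩, ?_, fun r hr => ?_⟩
      · rw [Finset.card_insert_of_notMem hnot]
        exact (Finset.card_insert_le _ _).trans (by lia)
      · exact Finset.forall_mem_insert _ _ _ |>.2 ⟨⟨hts, hds⟩, hsep⟩
      · rw [Finset.coe_insert]
        exact hdisj.insert fun p hp _ => ⟨hdis p hp, (hdis p hp).symm⟩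
      · exact Finset.forall_mem_insert _ _ _ |>.2
          ⟨hsF, fun p hp => (Finset.mem_filter.1 (hPF p hp)).1⟩
      · by_cases hur : u ≤ r
        · refine ⟨u, Finset.mem_insert_self _ _, hur, ?_⟩
          by_contra! hle
          have hlt : u < r := lt_of_le_of_ne hur fun h => (hd u).not_ge (h ▸ hle)
          exact htu.not_ge (hmax ⟨r, hr, hlt, hle⟩ htu.le)
        · obtain ⟨w, hw, h⟩ := hnet r (Finset.mem_filter.2 ⟨hr, hur⟩)
          exact ⟨w, Finset.mem_insert_of_mem hw, h⟩

/-- Order nets of bounded size for all finite parts of a tree yield one for the whole tree. -/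
theorem exists_order_net_of_finset {T : Type} [PartialOrder T]
    (hfin : ∀ s : T, (Set.Iic s).Finite) (d : T → T → ℝ) (ε : ℝ) (m : ℕ)
    (h : ∀ F : Finset T, ∃ S : Finset T, S.card ≤ m ∧ ∀ t ∈ F, ∃ s ∈ S, s ≤ t ∧ d s t < ε) :
    ∃ S : Finset T, S.card ≤ m ∧ ∀ t, ∃ s ∈ S, s ≤ t ∧ d s t < ε := by
  classical
  choose S hcard hnet using h
  let U : Ultrafilter (Finset T) := Ultrafilter.of Filter.atTop
  have hU : (U : Filter (Finset T)) ≤ Filter.atTop := Ultrafilter.of_le _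
  let L : Set T := {s | ∀ᶠ F in (U : Filter (Finset T)), s ∈ S F}
  have hL : ∀ G : Finset T, (G : Set T) ⊆ L → G.card ≤ m := fun G hG => by
    have : ∀ᶠ F in (U : Filter (Finset T)), ∀ s ∈ G, s ∈ S F :=
      (Filter.eventually_all_finset G).2 fun s hs => hG hs
    obtain ⟨F, hF⟩ := this.exists
    exact (Finset.card_le_card hF).trans (hcard F)
  have hLfin : L.Finite := by
    by_contra hinf
    obtain ⟨G, hG, hGc⟩ := Set.Infinite.exists_subset_card_eq hinf (m + 1)
    have := hL G hG
    lia
  refine ⟨hLfin.toFinset, hL _ (by simp), fun t => ?_⟩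
  have hev : ∀ᶠ F in (U : Filter (Finset T)), ∃ s ∈ Set.Iic t, s ∈ S F ∧ d s t < ε :=
    ((Filter.eventually_ge_atTop {t}).filter_mono hU).mono fun F hF => by
      obtain ⟨s, hs, hst, hds⟩ := hnet F t (hF (Finset.mem_singleton_self t))
      exact ⟨s, hst, hs, hds⟩
  obtain ⟨s, hst, hs⟩ := (Ultrafilter.eventually_exists_mem_iff (hfin t)).1 hev
  obtain ⟨_, -, hds⟩ := hs.exists
  exact ⟨s, hLfin.mem_toFinset.2 (hs.mono fun _ h => h.1), hst, hds⟩

theorem stmt8 {T : Type} [Countable T] [PartialOrder T] [OrderBot T]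
    (htree : IsTree T) (q : ℝ) (hq : 1 < q)
    (α σ : T → ℝ) (hα : ∀ t, 0 < α t) (hσpos : ∀ t, 0 < σ t)
    (hσmono : ∀ ⦃t s : T⦄, t ≤ s → σ s ≤ σ t)
    (K : ℝ) (hK : ∀ s : T, (∑ᶠ r ∈ Set.Iic s, α r ^ q) ^ (1 / q) * σ s ≤ K)
    (glb : T → T → T) (hglb : IsGCA glb)
    (ε : ℝ) (hε : 0 < ε) (n : ℕ)
    (hn : coveringNumber (treeDist q α σ glb) (2 * ε) = (n : ℝ≥0∞)) :
    ∃ ts ss : Fin (n - 1) → T,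
      (∀ i, ts i < ss i) ∧
      (∀ i, ε ≤ treeDist q α σ glb (ts i) (ss i)) ∧
      Pairwise fun i j =>
        Disjoint (Set.Ioc (ts i) (ss i)) (Set.Ioc (ts j) (ss j)) := by
  classical
  set d := treeDist q α σ glb with hdef
  have hd : ∀ t, d t t < ε := fun t => by simpa [hdef, treeDist, dOrd] using hε
  suffices hP : ∃ P, IsSeparatedFamily d ε P ∧ n - 1 ≤ P.card by
    obtain ⟨P, ⟨hsep, hdisj⟩, hcard⟩ := hP
    let f : Fin (n - 1) → P := fun i => P.equivFin.symm (Fin.castLE hcard i)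
    have hf : Function.Injective f := P.equivFin.symm.injective.comp (Fin.castLE_injective hcard)
    exact ⟨fun i => (f i).1.1, fun i => (f i).1.2, fun i => (hsep _ (f i).2).1,
      fun i => (hsep _ (f i).2).2, fun i j hij =>
        hdisj (f i).2 (f j).2 fun h => hij (hf (Subtype.ext h))⟩
  by_contra! hP
  have hpos := hP ∅ ⟨by simp, by simp⟩
  obtain ⟨S, hS, hnet⟩ := exists_order_net_of_finset htree.1 d ε (n - 1) fun F => by
    obtain ⟨S, P, hcard, hsep, -, hnet⟩ :=
      exists_separatedFamily_net_finset htree d ε hd F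
    have := hP P hsep
    exact ⟨S, by lia, hnet⟩
  have hle : (n : ℝ≥0∞) ≤ S.card := hn ▸ iInf₂_le S fun t => by
    obtain ⟨s, hs, -, hst⟩ := hnet t
    exact ⟨s, hs, by linarith⟩
  have hle' : n ≤ S.card := by exact_mod_cast hle
  lia
end
end

section
/- Suppose that for some a > 0, b ≥ 0 and c > 0 one has N(T,d,ε) ≥ c ε^{-a} |log ε|^b for all sufficiently small ε > 0. Then there is a constant c̃ > 0 (depending on c, q, a, b) such that e_n(V_{α,σ} : ℓ_1(T) → ℓ_q(T)) ≥ c̃ n^{-1/a − 1/q'} (log n)^{b/a} for all n ≥ 2, where 1/q' = 1 − 1/q. -/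
open scoped ENNReal NNReal
open MeasureTheory

noncomputable section

/-! ### A volume comparison for `ℓ₁`-balls -/

/-- If the image of the unit ball of `ℓ₁^ι` under `L` is covered by `ℓ₁`-balls of radius `R`, then
`|det L|` is at most the number of balls times `R ^ |ι|`. -/
lemma abs_det_le_of_l1_cover {ι : Type} [Fintype ι] [Nonempty ι]
    (L : (ι → ℝ) →ₗ[ℝ] (ι → ℝ)) (F : Finset (ι → ℝ)) {R : ℝ} (hR : 0 ≤ R)
    (hcover : ∀ x : ι → ℝ, ∑ i, |x i| ≤ 1 → ∃ y ∈ F, ∑ i, |L x i - y i| ≤ R) :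
    |LinearMap.det L| ≤ F.card * R ^ Fintype.card ι := by
  set B : ℝ → Set (ι → ℝ) := fun r => {x | ∑ i, |x i| ≤ r} with hB
  obtain ⟨A, hA0, hAtop, hvol⟩ : ∃ A : ℝ≥0∞, A ≠ 0 ∧ A ≠ ∞ ∧
      ∀ r, volume (B r) = ENNReal.ofReal r ^ Fintype.card ι * A := by
    have hform := volume_sum_rpow_le ι (p := 1) le_rfl
    simp only [Real.rpow_one, div_one] at hform
    refine ⟨_, ?_, ENNReal.ofReal_ne_top, hform⟩
    rw [Ne, ENNReal.ofReal_eq_zero, not_le]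
    have h₁ : 0 < Real.Gamma (1 + 1) := Real.Gamma_pos_of_pos (by norm_num)
    have h₂ : 0 < Real.Gamma ((Fintype.card ι : ℝ) + 1) := Real.Gamma_pos_of_pos (by positivity)
    positivity
  have hsub : L '' B 1 ⊆ ⋃ y ∈ F, (fun z => z + -y) ⁻¹' B R := by
    rintro _ ⟨x, hx, rfl⟩
    obtain ⟨y, hy, hxy⟩ := hcover x hx
    simp only [Set.mem_iUnion]
    exact ⟨y, hy, by simpa [hB, sub_eq_add_neg] using hxy⟩
  have hle : ENNReal.ofReal |LinearMap.det L| * A ≤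
      ENNReal.ofReal (F.card * R ^ Fintype.card ι) * A := by
    calc ENNReal.ofReal |LinearMap.det L| * A = volume (L '' B 1) := by
          rw [Measure.addHaar_image_linearMap, hvol 1]; simp
      _ ≤ ∑ y ∈ F, volume ((fun z => z + -y) ⁻¹' B R) :=
          (measure_mono hsub).trans (measure_biUnion_finset_le _ _)
      _ = F.card * (ENNReal.ofReal R ^ Fintype.card ι * A) := by
          simp only [measure_preimage_add_right, hvol, Finset.sum_const, nsmul_eq_mul]
      _ = ENNReal.ofReal (F.card * R ^ Fintype.card ι) * A := by
          rw [ENNReal.ofReal_mul (by positivity), ENNReal.ofReal_natCast,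
            ENNReal.ofReal_pow hR, mul_assoc]
  rw [ENNReal.mul_le_mul_iff_left hA0 hAtop] at hle
  exact (ENNReal.ofReal_le_ofReal_iff (by positivity)).1 hle

/-! ### Segments of a tree -/

/-- The quantity `(∑_{t ≺ r ⪯ v} α(r)^q)^{1/q} σ(v)` attached to the segment `(t, v]`. -/
def segmentWeight {T : Type} [PartialOrder T] (q : ℝ) (α σ : T → ℝ) (t v : T) : ℝ :=
  (∑ᶠ r ∈ Set.Ioc t v, α r ^ q) ^ (1 / q) * σ v

section Segments

variable {T : Type} [PartialOrder T] [OrderBot T]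

lemma IsTree.finite_Ioc (htree : IsTree T) (t v : T) : (Set.Ioc t v).Finite :=
  (htree.1 v).subset fun _ hr => hr.2

lemma treeDist_lt_of_segmentWeight_lt (htree : IsTree T) {q : ℝ} {α σ : T → ℝ}
    {glb : T → T → T} {s t : T} (hst : s ≤ t) {ε : ℝ} (hε : 0 < ε)
    (h : ∀ v ∈ Set.Ioc s t, segmentWeight q α σ s v < ε) :
    treeDist q α σ glb s t < ε := by
  rw [treeDist, if_pos hst, dOrd]
  rcases (Set.Ioc s t).eq_empty_or_nonempty with hem | hne
  · simpa [hem] using hε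
  · rw [((htree.finite_Ioc s t).image _).csSup_lt_iff (hne.image _)]
    rintro _ ⟨v, hv, rfl⟩
    exact h v hv

lemma segmentWeight_le_add (htree : IsTree T) {q : ℝ} (hq : 1 < q) {α σ : T → ℝ}
    (hα : ∀ t, 0 < α t) (hσpos : ∀ t, 0 < σ t) (hσmono : ∀ ⦃t s : T⦄, t ≤ s → σ s ≤ σ t)
    {t u v : T} (huv : u ≤ v) :
    segmentWeight q α σ t v ≤ segmentWeight q α σ t u + segmentWeight q α σ u v := by
  classical
  have hpos : ∀ r, 0 ≤ α r ^ q := fun r => Real.rpow_nonneg (hα r).le _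
  have hnn : ∀ x y : T, 0 ≤ ∑ r ∈ (htree.finite_Ioc x y).toFinset, α r ^ q := fun x y =>
    Finset.sum_nonneg fun r _ => hpos r
  simp only [segmentWeight, finsum_mem_eq_finite_toFinset_sum _ (htree.finite_Ioc _ _)]
  have hsum : ∑ r ∈ (htree.finite_Ioc t v).toFinset, α r ^ q ≤
      ∑ r ∈ (htree.finite_Ioc t u).toFinset, α r ^ q +
        ∑ r ∈ (htree.finite_Ioc u v).toFinset, α r ^ q := by
    refine le_trans (Finset.sum_le_sum_of_subset_of_nonneg ?_ fun r _ _ => hpos r)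
      (b := ∑ r ∈ (htree.finite_Ioc t u).toFinset ∪ (htree.finite_Ioc u v).toFinset, α r ^ q) ?_
    · intro r hr
      simp only [Set.Finite.mem_toFinset, Finset.mem_union, Set.mem_Ioc] at hr ⊢
      rcases htree.2.1 v r u hr.2 huv with h | h
      · exact Or.inl ⟨hr.1, h⟩
      · rcases h.eq_or_lt with rfl | h
        · exact Or.inl ⟨hr.1, le_rfl⟩
        · exact Or.inr ⟨h, hr.2⟩
    · rw [← Finset.sum_union_inter]
      exact le_add_of_nonneg_right (Finset.sum_nonneg fun r _ => hpos r)
  have hq1 : 1 / q ≤ 1 := by rw [div_le_one (by linarith)]; exact hq.le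
  have hq0 : 0 ≤ 1 / q := by positivity
  calc _ ≤ ((∑ r ∈ (htree.finite_Ioc t u).toFinset, α r ^ q) ^ (1 / q) +
        (∑ r ∈ (htree.finite_Ioc u v).toFinset, α r ^ q) ^ (1 / q)) * σ v := by
        refine mul_le_mul_of_nonneg_right ?_ (hσpos v).le
        exact (Real.rpow_le_rpow (hnn t v) hsum hq0).trans
          (Real.rpow_add_le_add_rpow (hnn t u) (hnn u v) hq0 hq1)
    _ ≤ _ := by
        rw [add_mul]
        gcongr
        · exact Real.rpow_nonneg (hnn t u) _
        · exact hσmono huv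

/-- If the covering number at scale `2ε` is at least `2k`, then the tree contains `k` pairwise
disjoint segments of weight at least `ε`. -/
lemma exists_disjoint_segments (htree : IsTree T) {q : ℝ} (hq : 1 < q) {α σ : T → ℝ}
    (hα : ∀ t, 0 < α t) (hσpos : ∀ t, 0 < σ t) (hσmono : ∀ ⦃t s : T⦄, t ≤ s → σ s ≤ σ t)
    (glb : T → T → T) {ε : ℝ} (hε : 0 < ε) (k : ℕ)
    (hk : ((2 * k : ℕ) : ℝ≥0∞) ≤ coveringNumber (treeDist q α σ glb) (2 * ε)) :
    ∃ t v : Fin k → T, (∀ i, ε ≤ segmentWeight q α σ (t i) (v i)) ∧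
      (∀ i, ∀ u ∈ Set.Ioc (t i) (v i), u ≠ v i → segmentWeight q α σ (t i) u < ε) ∧
      Pairwise fun i j => Disjoint (Set.Ioc (t i) (v i)) (Set.Ioc (t j) (v j)) := by
  classical
  induction k with
  | zero => exact ⟨Fin.elim0, Fin.elim0, fun i => i.elim0, fun i => i.elim0, fun i => i.elim0⟩
  | succ k ih =>
    obtain ⟨t, v, hw, hmin, hdisj⟩ := ih (le_trans (by gcongr; omega) hk)
    set S : Finset T := insert ⊥ (Finset.univ.image t ∪ Finset.univ.image v) with hS
    have hcard : S.card ≤ 2 * k + 1 := by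
      have h₁ : (Finset.univ.image t).card ≤ k := by
        simpa using Finset.card_image_le (s := Finset.univ) (f := t)
      have h₂ : (Finset.univ.image v).card ≤ k := by
        simpa using Finset.card_image_le (s := Finset.univ) (f := v)
      have h₃ : S.card ≤ (Finset.univ.image t ∪ Finset.univ.image v).card + 1 :=
        Finset.card_insert_le _ _
      have h₄ := Finset.card_union_le (Finset.univ.image t) (Finset.univ.image v)
      omega
    obtain ⟨x, hx⟩ : ∃ x : T, ∀ s ∈ S, ¬ treeDist q α σ glb s x < 2 * ε := by
      by_contra! hcon
      have h₁ : coveringNumber (treeDist q α σ glb) (2 * ε) ≤ S.card :=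
        iInf₂_le (f := fun (S : Finset T) _ => (S.card : ℝ≥0∞)) S hcon
      have h₂ := hk.trans h₁
      rw [Nat.cast_le] at h₂
      omega
    obtain ⟨u, ⟨hux, hu⟩, humax⟩ := Set.Finite.exists_maximal
      (s := {u | u ≤ x ∧ (u = ⊥ ∨ ∃ i, u ∈ Set.Ioc (t i) (v i))})
      ((htree.1 x).subset fun _ hu => hu.1) ⟨⊥, bot_le, Or.inl rfl⟩
    have hfree : ∀ r ∈ Set.Ioc u x, ∀ i, r ∉ Set.Ioc (t i) (v i) := fun r hr i hri =>
      hr.1.not_ge (humax ⟨hr.2, Or.inr ⟨i, hri⟩⟩ hr.1.le)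
    obtain ⟨y, hyux, hyw⟩ : ∃ y ∈ Set.Ioc u x, ε ≤ segmentWeight q α σ u y := by
      by_contra! hcon
      have hclose : ∀ s ≤ u, (∀ r ∈ Set.Ioc s u, segmentWeight q α σ s r < ε) → s ∉ S := by
        intro s hsu hs hsS
        refine hx s hsS (treeDist_lt_of_segmentWeight_lt htree (hsu.trans hux) (by linarith) ?_)
        intro r hr
        have hru : r ≤ u ∨ u < r := by
          rcases htree.2.1 x r u hr.2 hux with h | h
          · exact Or.inl h
          · exact h.eq_or_lt.imp (fun h => h.ge) id
        rcases hru with h | h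
        · linarith [hs r ⟨hr.1, h⟩]
        · rcases hsu.eq_or_lt with rfl | hsu'
          · linarith [hcon r ⟨h, hr.2⟩]
          · linarith [segmentWeight_le_add htree hq hα hσpos hσmono (t := s) h.le,
              hs u ⟨hsu', le_rfl⟩, hcon r ⟨h, hr.2⟩]
      have hself : u ∉ S := hclose u le_rfl fun r hr => absurd hr.2 hr.1.not_ge
      rcases hu with rfl | ⟨i, hui⟩
      · exact hself (by simp [hS])
      · have huv : u ≠ v i := fun h => hself (by simp [hS, h])
        refine hclose (t i) hui.1.le (fun r hr => hmin i r ⟨hr.1, hr.2.trans hui.2⟩ ?_)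
          (by simp [hS])
        rintro rfl
        exact huv (le_antisymm hui.2 hr.2)
    obtain ⟨z, ⟨hzux, hzw⟩, hzmin⟩ := Set.Finite.exists_minimal
      (s := {z | z ∈ Set.Ioc u x ∧ ε ≤ segmentWeight q α σ u z})
      ((htree.finite_Ioc u x).subset fun _ hz => hz.1) ⟨y, hyux, hyw⟩
    have hnew : ∀ i, Disjoint (Set.Ioc u z) (Set.Ioc (t i) (v i)) := fun i =>
      Set.disjoint_left.2 fun r hr => hfree r ⟨hr.1, hr.2.trans hzux.2⟩ i
    have hnewmin : ∀ r ∈ Set.Ioc u z, r ≠ z → segmentWeight q α σ u r < ε := by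
      intro r hr hrz
      by_contra! hcon
      exact hrz (le_antisymm hr.2 (hzmin ⟨⟨hr.1, hr.2.trans hzux.2⟩, hcon⟩ hr.2))
    refine ⟨Fin.cons u t, Fin.cons z v, Fin.cases hzw hw, Fin.cases hnewmin hmin, ?_⟩
    intro i j hij
    cases i using Fin.cases with
    | zero =>
      cases j using Fin.cases with
      | zero => exact absurd rfl hij
      | succ j => exact hnew j
    | succ i =>
      cases j using Fin.cases with
      | zero => exact (hnew i).symm
      | succ j => exact hdisj fun h => hij (congrArg Fin.succ h)

end Segments

/-! ### Entropy of the summation operator along disjoint segments -/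

open Classical in
/-- The operator maps the unit vector at `s` to `σ(s) ∑_{r ⪯ s} α(r) e_r`. -/
lemma summation_apply_single {T : Type} [PartialOrder T] {q : ℝ} [Fact (1 ≤ ENNReal.ofReal q)] {α σ : T → ℝ}
    {V : ellOne T →L[ℝ] ellQ T q}
    (hV : ∀ (x : ellOne T) (t : T), (V x : ∀ _ : T, ℝ) t =
      α t * ∑' s : {s : T // t ≤ s}, σ s.1 * (x : ∀ _ : T, ℝ) s.1) (s r : T) :
    (V (lp.single 1 s 1) : ∀ _ : T, ℝ) r = if r ≤ s then α r * σ s else 0 := by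
  rw [hV]
  split_ifs with h
  · rw [tsum_eq_single ⟨s, h⟩]
    · simp
    · intro s' hs'
      have : s'.1 ≠ s := fun h' => hs' (Subtype.ext h')
      simp [this]
  · have : ∀ s' : {s' : T // r ≤ s'}, σ s'.1 * (lp.single 1 s 1 : ellOne T) s'.1 = 0 := by
      intro s'
      have : s'.1 ≠ s := fun h' => h (h' ▸ s'.2)
      simp [this]
    rw [tsum_congr this, tsum_zero, mul_zero]

/-- The coefficients of the norming functional of `α` restricted to a finite set `I`. -/
def normingCoeff {T : Type} (q : ℝ) (α : T → ℝ) (I : Finset T) (r : T) : ℝ :=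
  α r ^ (q - 1) / (∑ s ∈ I, α s ^ q) ^ (1 - 1 / q)

/-- The simultaneous pairing with the norming functionals of `α` on the finite sets `I j`. -/
def segmentPairing {T ι : Type} (q : ℝ) [Fact (1 ≤ ENNReal.ofReal q)] (α : T → ℝ)
    (I : ι → Finset T) : ellQ T q →ₗ[ℝ] (ι → ℝ) where
  toFun y j := ∑ r ∈ I j, normingCoeff q α (I j) r * (y : ∀ _ : T, ℝ) r
  map_add' y z := by
    ext j
    simp [mul_add, Finset.sum_add_distrib]
  map_smul' c y := by
    ext j
    simp [Finset.mul_sum, mul_left_comm]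

lemma sum_abs_segmentPairing_le {T ι : Type} [Fintype ι] {q : ℝ} (hq : 1 < q)
    [Fact (1 ≤ ENNReal.ofReal q)] {α : T → ℝ} (hα : ∀ t, 0 < α t) {I : ι → Finset T}
    (hI : ∀ j, 0 < ∑ s ∈ I j, α s ^ q) (hdisj : Pairwise fun i j => Disjoint (I i) (I j))
    (y : ellQ T q) :
    ∑ j, |segmentPairing q α I y j| ≤ (Fintype.card ι : ℝ) ^ (1 - 1 / q) * ‖y‖ := by
  classical
  have hq0 : 0 < q := by linarith
  have hq1 : 0 < q - 1 := by linarith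
  have htoReal : (ENNReal.ofReal q).toReal = q := ENNReal.toReal_ofReal hq0.le
  have hconj : (q / (q - 1)).HolderConjugate q :=
    (Real.HolderConjugate.conjExponent hq).symm
  have hexp : 1 / (q / (q - 1)) = 1 - 1 / q := by field_simp
  have hcoeff : ∀ j r, 0 ≤ normingCoeff q α (I j) r := fun j r =>
    div_nonneg (Real.rpow_nonneg (hα r).le _) (Real.rpow_nonneg (hI j).le _)
  have hpow : ∀ j r, |normingCoeff q α (I j) r| ^ (q / (q - 1)) =
      α r ^ q / ∑ s ∈ I j, α s ^ q := by
    intro j r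
    rw [abs_of_nonneg (hcoeff j r), normingCoeff,
      Real.div_rpow (Real.rpow_nonneg (hα r).le _) (Real.rpow_nonneg (hI j).le _),
      ← Real.rpow_mul (hα r).le, ← Real.rpow_mul (hI j).le]
    have h₁ : (q - 1) * (q / (q - 1)) = q := by field_simp
    have h₂ : (1 - 1 / q) * (q / (q - 1)) = 1 := by field_simp
    rw [h₁, h₂, Real.rpow_one]
  have hleft : ∑ x ∈ Finset.univ.sigma I, |normingCoeff q α (I x.1) x.2| ^ (q / (q - 1)) =
      Fintype.card ι := by
    simp only [hpow, Finset.sum_sigma, ← Finset.sum_div, div_self (hI _).ne', Finset.sum_const,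
      Finset.card_univ, nsmul_eq_mul, mul_one]
  have hright : (∑ x ∈ Finset.univ.sigma I, |‖(y : ∀ _ : T, ℝ) x.2‖| ^ q) ^ (1 / q) ≤ ‖y‖ := by
    have h := lp.sum_rpow_le_norm_rpow (by rwa [htoReal]) y (Finset.univ.biUnion I)
    rw [htoReal, Finset.sum_biUnion fun i _ j _ hij => hdisj hij] at h
    simp only [Finset.sum_sigma, abs_norm]
    calc _ ≤ (‖y‖ ^ q) ^ (1 / q) := by
          refine Real.rpow_le_rpow (Finset.sum_nonneg fun i _ => Finset.sum_nonneg fun r _ => ?_)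
            h (by positivity)
          positivity
      _ = ‖y‖ := by
          rw [← Real.rpow_mul (norm_nonneg _), mul_one_div_cancel hq0.ne', Real.rpow_one]
  calc ∑ j, |segmentPairing q α I y j|
      ≤ ∑ j, ∑ r ∈ I j, normingCoeff q α (I j) r * ‖(y : ∀ _ : T, ℝ) r‖ := by
        refine Finset.sum_le_sum fun j _ => (Finset.abs_sum_le_sum_abs _ _).trans_eq ?_
        refine Finset.sum_congr rfl fun r _ => ?_
        rw [abs_mul, abs_of_nonneg (hcoeff j r), Real.norm_eq_abs]
    _ = ∑ x ∈ Finset.univ.sigma I, normingCoeff q α (I x.1) x.2 * ‖(y : ∀ _ : T, ℝ) x.2‖ := by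
        rw [Finset.sum_sigma]
    _ ≤ _ := Real.inner_le_Lp_mul_Lq _ _ _ hconj
    _ ≤ _ := by
        rw [hleft, hexp]
        gcongr

/-- If `V` maps the unit ball into the union of `|F|` balls of radius `δ`, and the tree contains
`m` disjoint segments of weight at least `ε`, then `ε^m ≤ |F| (δ m^{1-1/q})^m`. -/
lemma pow_le_card_mul_of_cover {T : Type} [PartialOrder T] [OrderBot T] (htree : IsTree T)
    {q : ℝ} (hq : 1 < q)
    [Fact (1 ≤ ENNReal.ofReal q)] {α σ : T → ℝ} (hα : ∀ t, 0 < α t)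
    {V : ellOne T →L[ℝ] ellQ T q}
    (hV : ∀ (x : ellOne T) (t : T), (V x : ∀ _ : T, ℝ) t =
      α t * ∑' s : {s : T // t ≤ s}, σ s.1 * (x : ∀ _ : T, ℝ) s.1)
    {m : ℕ} (hm : 0 < m) (t v : Fin m → T) {ε : ℝ} (hε : 0 < ε)
    (hw : ∀ i, ε ≤ segmentWeight q α σ (t i) (v i))
    (hdisj : Pairwise fun i j => Disjoint (Set.Ioc (t i) (v i)) (Set.Ioc (t j) (v j)))
    {δ : ℝ} (hδ : 0 < δ) (F : Finset (ellQ T q))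
    (hF : ∀ x : ellOne T, ‖x‖ ≤ 1 → ∃ y ∈ F, ‖V x - y‖ < δ) :
    ε ^ m ≤ F.card * (δ * (m : ℝ) ^ (1 - 1 / q)) ^ m := by
  classical
  wlog hsort : Monotone fun i => toLinearExtension (t i) generalizing t v
  · refine this (t ∘ Tuple.sort fun i => toLinearExtension (t i))
      (v ∘ Tuple.sort fun i => toLinearExtension (t i)) (fun i => hw _) (fun i j hij => ?_)
      (Tuple.monotone_sort fun i => toLinearExtension (t i))
    exact hdisj fun h => hij ((Tuple.sort _).injective h)
  have : NeZero m := ⟨hm.ne'⟩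
  have hq0 : 0 < q := by linarith
  set I : Fin m → Finset T := fun i => (htree.finite_Ioc (t i) (v i)).toFinset with hIdef
  have hmem : ∀ {i r}, r ∈ I i ↔ t i < r ∧ r ≤ v i := by simp [hIdef]
  have hw' : ∀ i, ε ≤ (∑ r ∈ I i, α r ^ q) ^ (1 / q) * σ (v i) := fun i => by
    have := hw i
    rwa [segmentWeight, finsum_mem_eq_finite_toFinset_sum _ (htree.finite_Ioc _ _)] at this
  have hI : ∀ i, 0 < ∑ r ∈ I i, α r ^ q := by
    intro i
    refine (Finset.sum_nonneg fun r _ => Real.rpow_nonneg (hα r).le q).lt_of_ne fun h => ?_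
    have := hw' i
    rw [← h, Real.zero_rpow (by positivity), zero_mul] at this
    linarith
  have hIdisj : Pairwise fun i j => Disjoint (I i) (I j) := fun i j hij => by
    simpa [hIdef] using hdisj hij
  set E : (Fin m → ℝ) →ₗ[ℝ] ellOne T :=
    Fintype.linearCombination ℝ fun i => (lp.single 1 (v i) 1 : ellOne T) with hE
  have hEnorm : ∀ x, ‖E x‖ ≤ ∑ i, |x i| := by
    intro x
    rw [hE, Fintype.linearCombination_apply]
    refine (norm_sum_le _ _).trans_eq (Finset.sum_congr rfl fun i _ => ?_)
    rw [norm_smul, lp.norm_single one_pos, norm_one, mul_one, Real.norm_eq_abs]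
  set Φ := segmentPairing q α I with hΦ
  set L : (Fin m → ℝ) →ₗ[ℝ] (Fin m → ℝ) := Φ ∘ₗ V.toLinearMap ∘ₗ E with hL
  have hentry : ∀ j i, LinearMap.toMatrix' L j i = ∑ r ∈ I j, normingCoeff q α (I j) r *
      if r ≤ v i then α r * σ (v i) else 0 := by
    intro j i
    rw [LinearMap.toMatrix'_apply]
    have : E (Pi.single i 1) = lp.single 1 (v i) 1 := by
      simp [hE, Fintype.linearCombination_apply_single]
    simp only [hL, LinearMap.comp_apply, this, hΦ, segmentPairing]
    refine Finset.sum_congr rfl fun r _ => ?_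
    congr 1
    exact summation_apply_single hV (v i) r
  have htri : (LinearMap.toMatrix' L).IsUpperTriangular := by
    intro j i hij
    have hij : i < j := hij
    rw [hentry]
    refine Finset.sum_eq_zero fun r hr => ?_
    rw [if_neg, mul_zero]
    intro hri
    have htv : t i ≤ v i := by
      obtain ⟨s, hs⟩ := Finset.nonempty_of_sum_ne_zero (hI i).ne'
      exact (hmem.1 hs).1.le.trans (hmem.1 hs).2
    have hrt : r ≤ t i := by
      rcases htree.2.1 (v i) r (t i) hri htv with h | h
      · exact h
      · rcases h.eq_or_lt with h | h
        · exact h.ge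
        · exact absurd hr (Finset.disjoint_left.1 (hIdisj hij.ne) (hmem.2 ⟨h, hri⟩))
    have hlt : t j < t i := (hmem.1 hr).1.trans_le hrt
    have heq : toLinearExtension (t j) = toLinearExtension (t i) :=
      le_antisymm (toLinearExtension.monotone hlt.le) (hsort hij.le)
    exact hlt.ne heq
  have hdiag : ∀ j, LinearMap.toMatrix' L j j = (∑ r ∈ I j, α r ^ q) ^ (1 / q) * σ (v j) := by
    intro j
    have h : ∀ r ∈ I j, (normingCoeff q α (I j) r * if r ≤ v j then α r * σ (v j) else 0) =
        α r ^ q * (σ (v j) / (∑ s ∈ I j, α s ^ q) ^ (1 - 1 / q)) := by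
      intro r hr
      rw [if_pos (hmem.1 hr).2, normingCoeff]
      nth_rewrite 2 [← Real.rpow_one (α r)]
      rw [div_mul_eq_mul_div, ← mul_assoc, ← Real.rpow_add (hα r), sub_add_cancel, mul_div_assoc]
    rw [hentry, Finset.sum_congr rfl h, ← Finset.sum_mul]
    have hS := hI j
    set S := ∑ r ∈ I j, α r ^ q
    have : S = S ^ (1 / q) * S ^ (1 - 1 / q) := by
      rw [← Real.rpow_add hS, add_sub_cancel, Real.rpow_one]
    have hne : S ^ (1 - 1 / q) ≠ 0 := (Real.rpow_pos_of_pos hS _).ne'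
    nth_rewrite 1 [this]
    field_simp
  have hdet : ε ^ m ≤ |LinearMap.det L| := by
    rw [← LinearMap.det_toMatrix', Matrix.det_of_isUpperTriangular htri, Finset.abs_prod]
    calc ε ^ m = ∏ _j : Fin m, ε := by simp
      _ ≤ _ := Finset.prod_le_prod (fun _ _ => hε.le) fun j _ =>
        ((hw' j).trans_eq (hdiag j).symm).trans (le_abs_self _)
  have hcover := abs_det_le_of_l1_cover L (F.image Φ) (R := δ * (m : ℝ) ^ (1 - 1 / q))
    (by positivity) (by
      intro x hx
      obtain ⟨y, hy, hxy⟩ := hF (E x) ((hEnorm x).trans hx)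
      refine ⟨Φ y, Finset.mem_image_of_mem _ hy, ?_⟩
      have h := sum_abs_segmentPairing_le hq hα hI hIdisj (V (E x) - y)
      rw [map_sub, Fintype.card_fin] at h
      refine h.trans ?_
      rw [mul_comm]
      gcongr)
  rw [Fintype.card_fin] at hcover
  refine (hdet.trans hcover).trans ?_
  gcongr
  exact Finset.card_image_le

/-! ### Entropy numbers -/

section EntropyNumbers

variable {X Y : Type} [NormedAddCommGroup X] [NormedSpace ℝ X]
  [NormedAddCommGroup Y] [NormedSpace ℝ Y]

lemma entropyNumber_set_nonempty (n : ℕ) (V : X →L[ℝ] Y) :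
    {ε : ℝ | 0 < ε ∧ ∃ F : Finset Y, F.card ≤ 2 ^ (n - 1) ∧
      ∀ x : X, ‖x‖ ≤ 1 → ∃ y ∈ F, ‖V x - y‖ < ε}.Nonempty := by
  refine ⟨‖V‖ + 1, by positivity, {0}, by simpa using Nat.one_le_two_pow, fun x hx => ?_⟩
  refine ⟨0, Finset.mem_singleton_self _, ?_⟩
  rw [sub_zero]
  linarith [V.le_of_opNorm_le_of_le le_rfl hx]

lemma entropyNumber_antitone (V : X →L[ℝ] Y) : Antitone fun n => entropyNumber n V := by
  intro m n hmn
  refine csInf_le_csInf ⟨0, fun ε hε => hε.1.le⟩ (entropyNumber_set_nonempty m V) ?_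
  rintro ε ⟨hε, F, hF, hcover⟩
  exact ⟨hε, F, hF.trans (Nat.pow_le_pow_right two_pos (by omega)), hcover⟩

end EntropyNumbers

lemma le_entropyNumber_s9 {T : Type} [PartialOrder T] [OrderBot T] (htree : IsTree T)
    {q : ℝ} (hq : 1 < q) [Fact (1 ≤ ENNReal.ofReal q)] {α σ : T → ℝ}
    (hα : ∀ t, 0 < α t) (hσpos : ∀ t, 0 < σ t) (hσmono : ∀ ⦃t s : T⦄, t ≤ s → σ s ≤ σ t)
    (glb : T → T → T) {V : ellOne T →L[ℝ] ellQ T q}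
    (hV : ∀ (x : ellOne T) (t : T), (V x : ∀ _ : T, ℝ) t =
      α t * ∑' s : {s : T // t ≤ s}, σ s.1 * (x : ∀ _ : T, ℝ) s.1)
    {ε : ℝ} (hε : 0 < ε) {n : ℕ} (hn : 0 < n)
    (hcov : ((2 * n : ℕ) : ℝ≥0∞) ≤ coveringNumber (treeDist q α σ glb) (2 * ε)) :
    ε / 2 * (n : ℝ) ^ (-(1 - 1 / q)) ≤ entropyNumber n V := by
  obtain ⟨t, v, hw, -, hdisj⟩ :=
    exists_disjoint_segments htree hq hα hσpos hσmono glb hε n hcov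
  refine le_csInf (entropyNumber_set_nonempty n V) ?_
  rintro δ ⟨hδ, F, hFcard, hF⟩
  have hnpos : (0 : ℝ) < (n : ℝ) ^ (1 - 1 / q) :=
    Real.rpow_pos_of_pos (by exact_mod_cast hn) _
  have hcard : (F.card : ℝ) ≤ 2 ^ n := by
    exact_mod_cast hFcard.trans (Nat.pow_le_pow_right two_pos (Nat.sub_le n 1))
  have hpow : ε ^ n ≤ (2 * (δ * (n : ℝ) ^ (1 - 1 / q))) ^ n := by
    refine (pow_le_card_mul_of_cover htree hq hα hV hn t v hε hw hdisj hδ F hF).trans ?_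
    rw [mul_pow 2]
    gcongr
  have hle := le_of_pow_le_pow_left₀ hn.ne' (by positivity) hpow
  rw [Real.rpow_neg (Nat.cast_nonneg n), ← div_eq_mul_inv, div_le_iff₀ hnpos]
  linarith

/-! ### Choice of the scale -/

lemma exists_scale {a b c ε₀ : ℝ} (ha : 0 < a) (hb : 0 ≤ b) (hc : 0 < c) (hε₀ : 0 < ε₀) :
    ∃ κ > 0, ∀ᶠ n : ℕ in Filter.atTop,
      0 < κ * (n : ℝ) ^ (-(1 / a)) * Real.log n ^ (b / a) ∧
      κ * (n : ℝ) ^ (-(1 / a)) * Real.log n ^ (b / a) < ε₀ ∧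
      2 * (n : ℝ) ≤ c * (κ * (n : ℝ) ^ (-(1 / a)) * Real.log n ^ (b / a)) ^ (-a) *
        |Real.log (κ * (n : ℝ) ^ (-(1 / a)) * Real.log n ^ (b / a))| ^ b := by
  set B : ℝ := c * (1 / (2 * a)) ^ b / 2 with hB
  have hBpos : 0 < B := by positivity
  set κ : ℝ := B ^ (1 / a) with hκ
  have hκpos : 0 < κ := by positivity
  have hκa : κ ^ (-a) = B⁻¹ := by
    rw [hκ, ← Real.rpow_mul hBpos.le, ← Real.rpow_neg_one]
    congr 1
    field_simp
  refine ⟨κ, hκpos, ?_⟩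
  have hlittle := ((isLittleO_log_rpow_rpow_atTop (b / a)
    (show 0 < 1 / (2 * a) by positivity)).comp_tendsto tendsto_natCast_atTop_atTop).bound
    (inv_pos.2 hκpos)
  have hsmall : ∀ᶠ n : ℕ in Filter.atTop, (n : ℝ) ^ (-(1 / (2 * a))) < ε₀ :=
    ((tendsto_rpow_neg_atTop (show 0 < 1 / (2 * a) by positivity)).comp
      tendsto_natCast_atTop_atTop).eventually_lt_const hε₀
  filter_upwards [hlittle, hsmall, Filter.eventually_ge_atTop 2] with n hbound hnε₀ hn2
  have hn1 : (1 : ℝ) < n := by exact_mod_cast (by omega : 1 < n)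
  have hn0 : (0 : ℝ) < n := by linarith
  have hlog : 0 < Real.log n := Real.log_pos hn1
  set η := κ * (n : ℝ) ^ (-(1 / a)) * Real.log n ^ (b / a) with hη
  have hηpos : 0 < η := by positivity
  have hηle : η ≤ (n : ℝ) ^ (-(1 / (2 * a))) := by
    simp only [Function.comp_apply, Real.norm_eq_abs] at hbound
    rw [abs_of_pos (by positivity), abs_of_pos (by positivity)] at hbound
    calc η ≤ κ * (n : ℝ) ^ (-(1 / a)) * (κ⁻¹ * (n : ℝ) ^ (1 / (2 * a))) :=
        mul_le_mul_of_nonneg_left hbound (by positivity)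
      _ = (n : ℝ) ^ (-(1 / a)) * (n : ℝ) ^ (1 / (2 * a)) := by field_simp
      _ = (n : ℝ) ^ (-(1 / (2 * a))) := by
        rw [← Real.rpow_add hn0]
        congr 1
        field_simp
        ring
  have hlogη : 1 / (2 * a) * Real.log n ≤ |Real.log η| := by
    have h := Real.log_le_log hηpos hηle
    rw [Real.log_rpow hn0] at h
    linarith [neg_le_abs (Real.log η)]
  refine ⟨hηpos, hηle.trans_lt hnε₀, ?_⟩
  have hηa : η ^ (-a) = B⁻¹ * n * (Real.log n ^ b)⁻¹ := by
    rw [hη, Real.mul_rpow (by positivity) (by positivity), Real.mul_rpow hκpos.le (by positivity),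
      hκa, ← Real.rpow_mul hn0.le, ← Real.rpow_mul hlog.le, ← Real.rpow_neg hlog.le]
    have h₁ : -(1 / a) * -a = 1 := by field_simp
    have h₂ : b / a * -a = -b := by field_simp
    rw [h₁, h₂, Real.rpow_one]
  calc 2 * (n : ℝ) = c * η ^ (-a) * (1 / (2 * a) * Real.log n) ^ b := by
        rw [hηa, Real.mul_rpow (by positivity) hlog.le, hB]
        have : Real.log n ^ b ≠ 0 := by positivity
        have : (1 / (2 * a)) ^ b ≠ 0 := by positivity
        field_simp
    _ ≤ c * η ^ (-a) * |Real.log η| ^ b := by gcongr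

theorem stmt9 {T : Type} [Countable T] [PartialOrder T] [OrderBot T]
    (htree : IsTree T) (q : ℝ) (hq : 1 < q)
    (α σ : T → ℝ) (hα : ∀ t, 0 < α t) (hσpos : ∀ t, 0 < σ t)
    (hσmono : ∀ ⦃t s : T⦄, t ≤ s → σ s ≤ σ t)
    (K : ℝ) (hK : ∀ s : T, (∑ᶠ r ∈ Set.Iic s, α r ^ q) ^ (1 / q) * σ s ≤ K)
    (glb : T → T → T) (hglb : IsGCA glb)
    [Fact (1 ≤ ENNReal.ofReal q)]
    (V : ellOne T →L[ℝ] ellQ T q)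
    (hV : ∀ (x : ellOne T) (t : T), (V x : ∀ _ : T, ℝ) t =
      α t * ∑' s : {s : T // t ≤ s}, σ s.1 * (x : ∀ _ : T, ℝ) s.1)
    (q' : ℝ) (hq' : 1 / q' = 1 - 1 / q)
    (a b c : ℝ) (ha : 0 < a) (hb : 0 ≤ b) (hc : 0 < c)
    (hN : ∃ ε₀ > 0, ∀ ε : ℝ, 0 < ε → ε < ε₀ →
      ENNReal.ofReal (c * ε ^ (-a) * |Real.log ε| ^ b) ≤
        coveringNumber (treeDist q α σ glb) ε) :
    ∃ ct > 0, ∀ n : ℕ, 2 ≤ n →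
      ct * (n : ℝ) ^ (-(1 / a) - 1 / q') * Real.log n ^ (b / a) ≤
        entropyNumber n V := by
  obtain ⟨ε₀, hε₀, hN⟩ := hN
  obtain ⟨κ, hκ, hev⟩ := exists_scale ha hb hc hε₀
  obtain ⟨n₀, hn₀⟩ := Filter.eventually_atTop.1 hev
  set p := n₀ + 2 with hp
  have hs : -(1 / a) - 1 / q' ≤ 0 := by
    have h₁ : 0 < 1 / a := by positivity
    have h₂ : 1 / q ≤ 1 := by rw [div_le_one (by linarith)]; exact hq.le
    linarith
  have hlarge : ∀ n : ℕ, p ≤ n →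
      κ / 4 * (n : ℝ) ^ (-(1 / a) - 1 / q') * Real.log n ^ (b / a) ≤ entropyNumber n V := by
    intro n hn
    obtain ⟨hη0, hηε₀, hcov⟩ := hn₀ n (by omega)
    set η := κ * (n : ℝ) ^ (-(1 / a)) * Real.log n ^ (b / a) with hη
    have hcov' : ((2 * n : ℕ) : ℝ≥0∞) ≤
        coveringNumber (treeDist q α σ glb) (2 * (η / 2)) := by
      rw [mul_div_cancel₀ η two_ne_zero, ← ENNReal.ofReal_natCast]
      refine le_trans (ENNReal.ofReal_le_ofReal ?_) (hN η hη0 hηε₀)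
      exact_mod_cast hcov
    have hn0 : (0 : ℝ) < n := by exact_mod_cast (by omega : 0 < n)
    refine le_of_eq_of_le ?_ (le_entropyNumber_s9 htree hq hα hσpos hσmono glb hV (half_pos hη0)
      (by omega : 0 < n) hcov')
    rw [hη, ← hq', sub_eq_add_neg (-(1 / a)), Real.rpow_add hn0]
    ring
  have hpR : (1 : ℝ) ≤ p := by exact_mod_cast (by omega : 1 ≤ p)
  refine ⟨κ / 4 * (p : ℝ) ^ (-(1 / a) - 1 / q'), by positivity, fun n hn => ?_⟩
  have hnR : (1 : ℝ) ≤ n := by exact_mod_cast (by omega : 1 ≤ n)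
  have hlogn : 0 ≤ Real.log n := Real.log_nonneg hnR
  rcases le_total p n with hpn | hnp
  · refine le_trans ?_ (hlarge n hpn)
    gcongr
    exact mul_le_of_le_one_right (by positivity) (Real.rpow_le_one_of_one_le_of_nonpos hpR hs)
  · refine le_trans ?_ ((hlarge p le_rfl).trans (entropyNumber_antitone V hnp))
    refine mul_le_mul (mul_le_of_le_one_right (by positivity)
      (Real.rpow_le_one_of_one_le_of_nonpos hnR hs)) ?_ (by positivity) (by positivity)
    gcongr
end
end
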